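/- arXiv:1912.03084 — 2 statements merged into one kernel-verified Lean document; each statement's English description precedes it below -/
import Mathlib

section
/- Let M ≥ 1 and ε > 0. Then 𝒜 generates a C₀-semigroup (𝒯(t))_{t≥0} on L²(Ω, μ; H) that is immediately norm-continuous (i.e., t ↦ 𝒯(t) is operator-norm continuous on (0, ∞)) and satisfies ‖𝒯(t)‖ ≤ M e^{−εt} for all t ≥ 0, if and only if for a.e. s ∈ Ω the operator A(s) generates a C₀-semigroup (T(s,t))_{t≥0} on H with ‖T(s,t)‖ ≤ M e^{−εt} for all t ≥ 0, and ‖R(ir, A(s))‖ → 0 as r → ±∞ uniformly for a.e. s ∈ Ω, i.e., for every η > 0 there exists ρ > 0 such that for a.e. s ∈ Ω and every real r with |r| ≥ ρ, ir ∈ ρ(A(s)) and ‖R(ir, A(s))‖ ≤ η. -/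
open MeasureTheory Filter Topology Set

noncomputable section

/-- A `C₀`-semigroup: a family `(T t)_{t ≥ 0}` of bounded operators with `T 0 = I`,
`T (t+u) = T t ∘ T u` for `t, u ≥ 0`, and `t ↦ T t x` continuous on `[0, ∞)` for each `x`.
(Values at negative times are irrelevant.) -/
def IsC0Semigroup {K : Type*} [NormedAddCommGroup K] [NormedSpace ℂ K]
    (T : ℝ → K →L[ℂ] K) : Prop :=
  T 0 = 1 ∧
  (∀ t u : ℝ, 0 ≤ t → 0 ≤ u → T (t + u) = (T t).comp (T u)) ∧
  ∀ x : K, ContinuousOn (fun t => T t x) (Set.Ici (0 : ℝ))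

/-- `R` is the resolvent of the (possibly unbounded) operator `B` at `lam`, i.e.
`lam ∈ ρ(B)` with `R = (lam - B)⁻¹` as a bounded operator. -/
def ResolventAt {K : Type*} [NormedAddCommGroup K] [NormedSpace ℂ K]
    (B : K →ₗ.[ℂ] K) (lam : ℂ) (R : K →L[ℂ] K) : Prop :=
  (∀ y : K, ∃ hy : R y ∈ B.domain, lam • R y - B ⟨R y, hy⟩ = y) ∧
  ∀ x : B.domain, R (lam • (x : K) - B x) = x

/-- `B` is the generator of the semigroup `T`: its domain is the set of `x` for which
`t⁻¹ (T t x - x)` converges as `t → 0⁺`, and `B x` is that limit. -/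
def IsGenerator {K : Type*} [NormedAddCommGroup K] [NormedSpace ℂ K]
    (T : ℝ → K →L[ℂ] K) (B : K →ₗ.[ℂ] K) : Prop :=
  (∀ x : K, x ∈ B.domain ↔
    ∃ y : K, Tendsto (fun t : ℝ => t⁻¹ • (T t x - x)) (𝓝[>] (0:ℝ)) (𝓝 y)) ∧
  ∀ x : B.domain, Tendsto (fun t : ℝ => t⁻¹ • (T t (x : K) - (x : K))) (𝓝[>] (0:ℝ)) (𝓝 (B x))

section Semigroup

variable {K : Type*} [NormedAddCommGroup K] [NormedSpace ℂ K] {T : ℝ → K →L[ℂ] K} {M ε : ℝ}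

/-- A `C₀`-semigroup with `‖T t‖ ≤ M e^{-ε t}`, where `M ≥ 1` and `ε > 0`. -/
structure StableSemigroup (T : ℝ → K →L[ℂ] K) (M ε : ℝ) : Prop where
  c0 : IsC0Semigroup T
  one_le : 1 ≤ M
  pos : 0 < ε
  bound : ∀ t : ℝ, 0 ≤ t → ‖T t‖ ≤ M * Real.exp (-ε * t)

/-- `(x, y)` lies in the graph of the generator of `T`. -/
def HasGen (T : ℝ → K →L[ℂ] K) (x y : K) : Prop :=
  Tendsto (fun t : ℝ => t⁻¹ • (T t x - x)) (𝓝[>] (0 : ℝ)) (𝓝 y)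

theorem HasGen.unique {x y z : K} (h : HasGen T x y) (h' : HasGen T x z) : y = z :=
  tendsto_nhds_unique h h'

/-- The rescaled semigroup `e^{-λt} T(t)`. -/
def damp (T : ℝ → K →L[ℂ] K) (lam : ℂ) (t : ℝ) : K →L[ℂ] K := Complex.exp (-lam * t) • T t

theorem damp_damp_neg (T : ℝ → K →L[ℂ] K) (lam : ℂ) : damp (damp T lam) (-lam) = T := by
  ext t x
  simp [damp, smul_smul, ← Complex.exp_add]

theorem HasGen.damp {x y : K} (h : HasGen T x y) (lam : ℂ) :
    HasGen (damp T lam) x (y - lam • x) := by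
  unfold HasGen at h ⊢
  have hd : HasDerivAt (fun t : ℝ => Complex.exp (-lam * t)) (-lam) 0 := by
    have : HasDerivAt (fun t : ℂ => Complex.exp (-lam * t)) (-lam) ((0 : ℝ) : ℂ) := by
      have := ((hasDerivAt_id (((0 : ℝ) : ℂ))).const_mul (-lam)).cexp
      simpa using this
    exact this.comp_ofReal
  have h1 : Tendsto (fun t : ℝ => t⁻¹ • (Complex.exp (-lam * t) - 1)) (𝓝[>] (0 : ℝ)) (𝓝 (-lam)) := by
    have := hd.tendsto_slope_zero_right
    simpa using this
  have h0 : Tendsto (fun t : ℝ => Complex.exp (-lam * t)) (𝓝[>] (0 : ℝ)) (𝓝 1) := by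
    have := hd.continuousAt.tendsto
    simp only [Complex.ofReal_zero, mul_zero, Complex.exp_zero] at this
    exact this.mono_left nhdsWithin_le_nhds
  have := (h0.smul h).add (h1.smul_const x)
  simp only [one_smul, neg_smul, ← sub_eq_add_neg] at this
  refine this.congr fun t => ?_
  simp only [_root_.damp, smul_apply]
  rw [smul_comm, smul_assoc, ← smul_add]
  congr 1
  rw [smul_sub, sub_smul, one_smul]
  abel

theorem hasGen_damp_iff {x y : K} {lam : ℂ} :
    HasGen (damp T lam) x y ↔ HasGen T x (lam • x + y) := by
  constructor
  · intro h
    have := h.damp (-lam)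
    rw [damp_damp_neg] at this
    simpa [add_comm] using this
  · intro h
    simpa using h.damp lam

theorem IsC0Semigroup.damp (h : IsC0Semigroup T) (lam : ℂ) : IsC0Semigroup (damp T lam) := by
  refine ⟨by simp [_root_.damp, h.1], fun t u ht hu => ?_, fun x => ?_⟩
  · ext x
    simp [_root_.damp, h.2.1 t u ht hu, smul_smul, mul_add, Complex.exp_add, mul_comm]
  · simp only [_root_.damp, smul_apply]
    exact ContinuousOn.smul (by fun_prop) (h.2.2 x)

namespace StableSemigroup

theorem damp (h : StableSemigroup T M ε) {lam : ℂ} (hl : 0 ≤ lam.re) :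
    StableSemigroup (damp T lam) M ε := by
  refine ⟨h.c0.damp lam, h.one_le, h.pos, fun t ht => le_trans ?_ (h.bound t ht)⟩
  rw [_root_.damp, norm_smul, Complex.norm_exp]
  refine mul_le_of_le_one_left (norm_nonneg _) (Real.exp_le_one_iff.2 ?_)
  simp only [Complex.mul_re, Complex.neg_re, Complex.ofReal_re, Complex.neg_im, Complex.ofReal_im,
    mul_zero, sub_zero]
  nlinarith

theorem add_apply (h : StableSemigroup T M ε) {t u : ℝ} (ht : 0 ≤ t) (hu : 0 ≤ u) (x : K) :
    T (t + u) x = T t (T u x) := by rw [h.c0.2.1 t u ht hu]; rfl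

theorem comm_apply (h : StableSemigroup T M ε) {t u : ℝ} (ht : 0 ≤ t) (hu : 0 ≤ u) (x : K) :
    T t (T u x) = T u (T t x) := by
  rw [← h.add_apply ht hu, add_comm, h.add_apply hu ht]

theorem M_nonneg (h : StableSemigroup T M ε) : 0 ≤ M := zero_le_one.trans h.one_le

theorem norm_apply_le (h : StableSemigroup T M ε) {t : ℝ} (ht : 0 ≤ t) (x : K) :
    ‖T t x‖ ≤ M * ‖x‖ * Real.exp (-ε * t) :=
  ((T t).le_of_opNorm_le (h.bound t ht) x).trans (by linarith [mul_right_comm M ‖x‖ (Real.exp (-ε * t))])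

theorem norm_le (h : StableSemigroup T M ε) {t : ℝ} (ht : 0 ≤ t) : ‖T t‖ ≤ M := by
  refine (h.bound t ht).trans (mul_le_of_le_one_right h.M_nonneg (Real.exp_le_one_iff.2 ?_))
  nlinarith [h.pos]

theorem norm_apply_le' (h : StableSemigroup T M ε) {t : ℝ} (ht : 0 ≤ t) (x : K) :
    ‖T t x‖ ≤ M * ‖x‖ := (T t).le_of_opNorm_le (h.norm_le ht) x

theorem aestronglyMeasurable (h : StableSemigroup T M ε) (x : K) {a : ℝ} (ha : 0 ≤ a) :
    AEStronglyMeasurable (fun t => T t x) (volume.restrict (Ioi a)) :=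
  ((h.c0.2.2 x).mono (fun _ ht => ha.trans (le_of_lt ht))).aestronglyMeasurable measurableSet_Ioi

theorem integrableOn_exp (hε : 0 < ε) (a : ℝ) :
    IntegrableOn (fun t : ℝ => Real.exp (-ε * t)) (Ioi a) :=
  integrableOn_exp_mul_Ioi (by linarith) a

theorem integrableOn (h : StableSemigroup T M ε) (x : K) {a : ℝ} (ha : 0 ≤ a) :
    IntegrableOn (fun t => T t x) (Ioi a) := by
  refine Integrable.mono' ((integrableOn_exp h.pos a).const_mul (M * ‖x‖))
    (h.aestronglyMeasurable x ha) ?_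
  filter_upwards [ae_restrict_mem measurableSet_Ioi] with t ht
  exact h.norm_apply_le (ha.trans (le_of_lt ht)) x

theorem integral_exp (hε : 0 < ε) : ∫ t in Ioi (0 : ℝ), Real.exp (-ε * t) = 1 / ε := by
  rw [integral_exp_mul_Ioi (by linarith)]
  simp

theorem norm_integral_le (h : StableSemigroup T M ε) (x : K) :
    ‖∫ t in Ioi (0 : ℝ), T t x‖ ≤ M / ε * ‖x‖ := by
  have := norm_integral_le_of_norm_le ((integrableOn_exp h.pos 0).const_mul (M * ‖x‖))
    (f := fun t => T t x) (by
      filter_upwards [ae_restrict_mem measurableSet_Ioi] with t ht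
      exact h.norm_apply_le (le_of_lt ht) x)
  rw [integral_const_mul, integral_exp h.pos] at this
  refine this.trans (le_of_eq ?_)
  ring

/-- The bounded operator `x ↦ ∫₀^∞ T(t) x dt`, the inverse of minus the generator. -/
def potential (h : StableSemigroup T M ε) : K →L[ℂ] K :=
  LinearMap.mkContinuous
    { toFun := fun x => ∫ t in Ioi (0 : ℝ), T t x
      map_add' := fun x y => by
        simp only [map_add]
        exact integral_add (h.integrableOn x le_rfl) (h.integrableOn y le_rfl)
      map_smul' := fun c x => by
        simp only [map_smul]
        exact integral_smul c _ }
    (M / ε) h.norm_integral_le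

theorem potential_apply (h : StableSemigroup T M ε) (x : K) :
    h.potential x = ∫ t in Ioi (0 : ℝ), T t x := rfl

theorem norm_potential_le (h : StableSemigroup T M ε) : ‖h.potential‖ ≤ M / ε :=
  LinearMap.mkContinuous_norm_le _ (div_nonneg h.M_nonneg h.pos.le) _

theorem intervalIntegrable (h : StableSemigroup T M ε) (x : K) {a b : ℝ} (ha : 0 ≤ a) (hb : 0 ≤ b) :
    IntervalIntegrable (fun t => T t x) volume a b :=
  ((h.c0.2.2 x).mono fun _ ht => (le_min ha hb).trans ht.1).intervalIntegrable

theorem integrableOn_smul (h : StableSemigroup T M ε) (x : K) :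
    IntegrableOn (fun t => t • T t x) (Ioi 0) := by
  have hi : IntegrableOn (fun t : ℝ => t * Real.exp (-ε * t)) (Ioi 0) := by
    simpa using integrableOn_rpow_mul_exp_neg_mul_rpow (p := 1) (s := 1) (by norm_num) one_pos h.pos
  refine Integrable.mono' (hi.const_mul (M * ‖x‖))
    (aestronglyMeasurable_id.smul (h.aestronglyMeasurable x le_rfl)) ?_
  filter_upwards [ae_restrict_mem measurableSet_Ioi] with t ht
  rw [norm_smul, Real.norm_of_nonneg (le_of_lt ht)]
  have := mul_le_mul_of_nonneg_left (h.norm_apply_le (le_of_lt ht) x) (le_of_lt ht)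
  linarith

variable [CompleteSpace K]

theorem apply_potential_comm (h : StableSemigroup T M ε) {t : ℝ} (ht : 0 ≤ t) (x : K) :
    T t (h.potential x) = h.potential (T t x) := by
  rw [potential_apply, potential_apply, ← ContinuousLinearMap.integral_comp_comm _ (h.integrableOn x le_rfl)]
  exact setIntegral_congr_fun measurableSet_Ioi fun u hu => h.comm_apply ht (le_of_lt hu) x

theorem apply_potential_sub (h : StableSemigroup T M ε) {t : ℝ} (ht : 0 ≤ t) (x : K) :
    T t (h.potential x) - h.potential x = -∫ u in (0 : ℝ)..t, T u x := by
  have h1 : T t (h.potential x) = ∫ u in Ioi t, T u x := by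
    rw [potential_apply, ← ContinuousLinearMap.integral_comp_comm _ (h.integrableOn x le_rfl)]
    have := (measurePreserving_add_right volume t).setIntegral_preimage_emb
      (measurableEmbedding_addRight t) (fun u => T u x) (Ioi t)
    rw [← this, preimage_add_const_Ioi, sub_self]
    refine setIntegral_congr_fun measurableSet_Ioi fun u hu => ?_
    simp only [add_comm u t]
    exact (h.add_apply ht (le_of_lt hu) x).symm
  rw [h1, potential_apply, ← intervalIntegral.integral_Ioi_sub_Ioi (h.integrableOn x le_rfl) ht]
  abel

theorem tendsto_average (h : StableSemigroup T M ε) (x : K) :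
    Tendsto (fun t : ℝ => t⁻¹ • ∫ u in (0 : ℝ)..t, T u x) (𝓝[>] (0 : ℝ)) (𝓝 x) := by
  have hc : ContinuousWithinAt (fun t => T t x) (Ioi 0) 0 :=
    ((h.c0.2.2 x) 0 self_mem_Ici).mono Ioi_subset_Ici_self
  have : HasDerivWithinAt (fun t => ∫ u in (0 : ℝ)..t, T u x) (T 0 x) (Ici 0) 0 := by
    refine intervalIntegral.integral_hasDerivWithinAt_right (h.intervalIntegrable x le_rfl le_rfl)
      (t := Ioi 0) ⟨Ioi 0, self_mem_nhdsWithin, h.aestronglyMeasurable x le_rfl⟩ hc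
  have := (hasDerivWithinAt_iff_tendsto_slope' (by simp)).1 this.Ioi_of_Ici
  rw [h.c0.1] at this
  refine this.congr fun t => ?_
  simp [slope]

theorem hasGen_potential (h : StableSemigroup T M ε) (x : K) : HasGen T (h.potential x) (-x) := by
  refine (h.tendsto_average x).neg.congr' ?_
  filter_upwards [self_mem_nhdsWithin] with t ht
  rw [h.apply_potential_sub (le_of_lt ht), smul_neg]

theorem potential_of_hasGen (h : StableSemigroup T M ε) {x y : K} (hx : HasGen T x y) :
    h.potential y = -x := by
  refine HasGen.unique (T := T) (x := h.potential x) ?_ (h.hasGen_potential x)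
  refine ((h.potential.continuous.tendsto y).comp hx).congr' ?_
  filter_upwards [self_mem_nhdsWithin] with t ht
  simp only [Function.comp_apply, ContinuousLinearMap.map_smul_of_tower, map_sub, h.apply_potential_comm (le_of_lt ht)]

theorem hasGen_iff (h : StableSemigroup T M ε) {x y : K} :
    HasGen T x y ↔ h.potential y = -x := by
  refine ⟨h.potential_of_hasGen, fun hy => ?_⟩
  have := h.hasGen_potential (-y)
  rwa [map_neg, hy, neg_neg, neg_neg] at this

theorem apply_sub_of_hasGen (h : StableSemigroup T M ε) {x y : K} (hx : HasGen T x y) {t : ℝ}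
    (ht : 0 ≤ t) : T t x - x = ∫ u in (0 : ℝ)..t, T u y := by
  have := h.apply_potential_sub ht y
  rw [h.potential_of_hasGen hx, map_neg] at this
  rw [← neg_inj, ← this]
  abel

theorem hasGen_apply (h : StableSemigroup T M ε) {x y : K} (hx : HasGen T x y) {t : ℝ}
    (ht : 0 ≤ t) : HasGen T (T t x) (T t y) := by
  rw [h.hasGen_iff, ← h.apply_potential_comm ht, h.hasGen_iff.1 hx, map_neg]

/-- If the orbit of `y = Bx` is bounded by `c`, then `‖T(t)x - x‖ ≤ c t`. -/
theorem norm_apply_sub_le (h : StableSemigroup T M ε) {x y : K} (hx : HasGen T x y) {c t : ℝ}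
    (hc : ∀ u, 0 ≤ u → ‖T u y‖ ≤ c) (ht : 0 ≤ t) : ‖T t x - x‖ ≤ c * t := by
  rw [h.apply_sub_of_hasGen hx ht]
  have := intervalIntegral.norm_integral_le_of_norm_le_const (f := fun u => T u y) (a := 0) (b := t)
    (C := c) fun u hu => hc u (by rw [uIoc_of_le ht] at hu; exact hu.1.le)
  rwa [sub_zero, abs_of_nonneg ht] at this

theorem norm_apply_sub_sub_le (h : StableSemigroup T M ε) {x y z : K} (hx : HasGen T x y)
    (hy : HasGen T y z) {c t : ℝ} (hc : ∀ u, 0 ≤ u → ‖T u z‖ ≤ c) (ht : 0 ≤ t) :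
    ‖T t x - x - t • y‖ ≤ c * t ^ 2 := by
  have hc0 : 0 ≤ c := (norm_nonneg _).trans (hc 0 le_rfl)
  have : T t x - x - t • y = ∫ u in (0 : ℝ)..t, (T u y - y) := by
    rw [intervalIntegral.integral_sub (h.intervalIntegrable y le_rfl ht) (by simp),
      h.apply_sub_of_hasGen hx ht]
    simp
  rw [this]
  have := intervalIntegral.norm_integral_le_of_norm_le_const (f := fun u => T u y - y) (a := 0) (b := t)
    (C := c * t) fun u hu => by
      rw [uIoc_of_le ht] at hu
      exact (h.norm_apply_sub_le hy hc hu.1.le).trans (mul_le_mul_of_nonneg_left hu.2 hc0)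
  rw [sub_zero, abs_of_nonneg ht] at this
  linarith

theorem denseRange_potential (h : StableSemigroup T M ε) : DenseRange h.potential := by
  intro x
  refine mem_closure_of_tendsto (h.tendsto_average x) ?_
  filter_upwards [self_mem_nhdsWithin] with t ht
  refine ⟨-(t⁻¹ • (T t x - x)), ?_⟩
  rw [map_neg, ContinuousLinearMap.map_smul_of_tower, map_sub, ← h.apply_potential_comm (le_of_lt ht),
    h.apply_potential_sub (le_of_lt ht), smul_neg, neg_neg]

/-- The resolvent of the generator at `λ`, for `Re λ ≥ 0`. -/
def res (h : StableSemigroup T M ε) (lam : ℂ) (hl : 0 ≤ lam.re) : K →L[ℂ] K :=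
  (h.damp hl).potential

theorem hasGen_iff_res (h : StableSemigroup T M ε) {lam : ℂ} (hl : 0 ≤ lam.re) {x y : K} :
    HasGen T x y ↔ h.res lam hl (lam • x - y) = x := by
  have := (h.damp hl).hasGen_iff (x := x) (y := y - lam • x)
  rw [hasGen_damp_iff, add_sub_cancel] at this
  rw [this, res, ← neg_sub y, map_neg, neg_eq_iff_eq_neg]

theorem hasGen_res (h : StableSemigroup T M ε) {lam : ℂ} (hl : 0 ≤ lam.re) (x : K) :
    HasGen T (h.res lam hl x) (lam • h.res lam hl x - x) := by
  rw [h.hasGen_iff_res hl, sub_sub_cancel]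

end StableSemigroup

theorem isGenerator_iff {B : K →ₗ.[ℂ] K} :
    IsGenerator T B ↔ ∀ x y, (x, y) ∈ B.graph ↔ HasGen T x y := by
  constructor
  · rintro ⟨h1, h2⟩ x y
    rw [LinearPMap.mem_graph_iff]
    constructor
    · rintro ⟨z, hz, hzy⟩
      simp only at hz hzy
      subst hz hzy
      exact h2 z
    · intro h
      exact ⟨⟨x, (h1 x).2 ⟨y, h⟩⟩, rfl, tendsto_nhds_unique (h2 _) h⟩
  · intro h
    refine ⟨fun x => ⟨fun hx => ⟨B ⟨x, hx⟩, (h _ _).1 (B.mem_graph ⟨x, hx⟩)⟩, ?_⟩,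
      fun x => (h _ _).1 (B.mem_graph x)⟩
    rintro ⟨y, hy⟩
    obtain ⟨z, hz, -⟩ := (LinearPMap.mem_graph_iff _).1 ((h x y).2 hy)
    simp only at hz
    exact hz ▸ z.2

theorem resolventAt_iff {B : K →ₗ.[ℂ] K} {lam : ℂ} {R : K →L[ℂ] K} :
    ResolventAt B lam R ↔ ∀ x y, (x, y) ∈ B.graph ↔ R (lam • x - y) = x := by
  constructor
  · rintro ⟨h1, h2⟩ x y
    rw [LinearPMap.mem_graph_iff]
    constructor
    · rintro ⟨z, hz, hzy⟩
      simp only at hz hzy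
      subst hz hzy
      exact h2 z
    · intro h
      obtain ⟨hy, e⟩ := h1 (lam • x - y)
      refine ⟨⟨_, hy⟩, h, ?_⟩
      simp only
      nth_rewrite 1 [h] at e
      exact sub_right_injective e
  · intro h
    refine ⟨fun y => ?_, fun x => (h _ _).1 (B.mem_graph x)⟩
    have : (R y, lam • R y - y) ∈ B.graph := by rw [h, sub_sub_cancel]
    obtain ⟨z, hz, hzy⟩ := (LinearPMap.mem_graph_iff _).1 this
    simp only at hz hzy
    refine ⟨hz ▸ z.2, ?_⟩
    have : (⟨R y, hz ▸ z.2⟩ : B.domain) = z := Subtype.ext hz.symm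
    rw [this, hzy, sub_sub_cancel]

end Semigroup

section Semigroup2
variable {K : Type*} [NormedAddCommGroup K] [NormedSpace ℂ K] {T : ℝ → K →L[ℂ] K} {M ε : ℝ}

theorem tendsto_apply_of_dense {ι : Type*} {l : Filter ι} {F : ι → K →L[ℂ] K} {G : K →L[ℂ] K}
    {c : ℝ} (hF : ∀ᶠ i in l, ‖F i‖ ≤ c) {s : Set K} (hs : Dense s)
    (h : ∀ x ∈ s, Tendsto (fun i => F i x) l (𝓝 (G x))) (x : K) :
    Tendsto (fun i => F i x) l (𝓝 (G x)) := by
  rcases l.eq_or_neBot with rfl | hl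
  · exact tendsto_bot
  obtain ⟨i₀, hi₀⟩ := hF.exists
  have hc : 0 ≤ c := (norm_nonneg _).trans hi₀
  rw [Metric.tendsto_nhds]
  intro η hη
  set c' := c + ‖G‖ + 1
  have hc' : 0 < c' := by positivity
  obtain ⟨y, hy, hxy⟩ := Metric.dense_iff.1 hs x (η / 2 / c') (by positivity)
  rw [mem_ball_iff_norm'] at hy
  have hys := Metric.tendsto_nhds.1 (h y hxy) (η / 2) (by positivity)
  filter_upwards [hF, hys] with i hi1 hi2
  rw [dist_eq_norm] at hi2 ⊢
  have e : F i x - G x = (F i - G) (x - y) + (F i y - G y) := by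
    simp only [sub_apply, map_sub]
    abel
  have h1 : ‖(F i - G) (x - y)‖ ≤ c' * (η / 2 / c') := by
    refine ((F i - G).le_opNorm _).trans ?_
    have : ‖F i - G‖ ≤ c' := (norm_sub_le _ _).trans (by simp only [c']; linarith)
    exact mul_le_mul this hy.le (norm_nonneg _) hc'.le
  rw [mul_div_cancel₀ _ hc'.ne'] at h1
  rw [e]
  exact (norm_add_le _ _).trans_lt (by linarith)

namespace StableSemigroup

variable [CompleteSpace K]

theorem apply_res_comm (h : StableSemigroup T M ε) {lam : ℂ} (hl : 0 ≤ lam.re) {t : ℝ}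
    (ht : 0 ≤ t) (x : K) : T t (h.res lam hl x) = h.res lam hl (T t x) := by
  have := (h.damp hl).apply_potential_comm ht x
  simp only [_root_.damp, smul_apply, map_smul] at this
  exact smul_right_injective K (Complex.exp_ne_zero _) this

/-- One step of the implicit Euler scheme, `(1 - τB)⁻¹`. -/
def euler (h : StableSemigroup T M ε) (τ : ℝ) (hτ : 0 < τ) : K →L[ℂ] K :=
  ((τ⁻¹ : ℝ) : ℂ) • h.res ((τ⁻¹ : ℝ) : ℂ) (by simpa using hτ.le)

theorem norm_apply_euler_le (h : StableSemigroup T M ε) {τ : ℝ} (hτ : 0 < τ) {c : ℝ} {x : K}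
    (hc : ∀ t, 0 ≤ t → ‖T t x‖ ≤ c) {t : ℝ} (ht : 0 ≤ t) : ‖T t (h.euler τ hτ x)‖ ≤ c := by
  have hl : 0 < τ⁻¹ := inv_pos.2 hτ
  rw [euler, smul_apply, map_smul, h.apply_res_comm _ ht, norm_smul, Complex.norm_real,
    Real.norm_of_nonneg hl.le, res, potential_apply]
  have := norm_integral_le_of_norm_le ((integrableOn_exp hl 0).const_mul c)
    (f := fun u => _root_.damp T ((τ⁻¹ : ℝ) : ℂ) u (T t x)) (by
      filter_upwards [ae_restrict_mem measurableSet_Ioi] with u hu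
      rw [_root_.damp, smul_apply, norm_smul, Complex.norm_exp, ← h.add_apply (le_of_lt hu) ht,
        mul_comm]
      refine mul_le_mul (hc _ (add_nonneg (le_of_lt hu) ht)) ?_ (Real.exp_nonneg _)
        ((norm_nonneg _).trans (hc 0 le_rfl))
      simp)
  rw [integral_const_mul, integral_exp hl] at this
  calc _ ≤ τ⁻¹ * (c * (1 / τ⁻¹)) := mul_le_mul_of_nonneg_left this hl.le
    _ = c := by field_simp

theorem norm_apply_euler_pow_le (h : StableSemigroup T M ε) {τ : ℝ} (hτ : 0 < τ) {c : ℝ} {x : K}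
    (hc : ∀ t, 0 ≤ t → ‖T t x‖ ≤ c) (n : ℕ) {t : ℝ} (ht : 0 ≤ t) :
    ‖T t ((h.euler τ hτ ^ n) x)‖ ≤ c := by
  induction n generalizing t with
  | zero => exact hc t ht
  | succ n ih =>
    rw [pow_succ', mul_apply_eq_comp]
    exact h.norm_apply_euler_le hτ (fun u hu => ih hu) ht

theorem norm_euler_pow_apply_le (h : StableSemigroup T M ε) {τ : ℝ} (hτ : 0 < τ) {c : ℝ} {x : K}
    (hc : ∀ t, 0 ≤ t → ‖T t x‖ ≤ c) (n : ℕ) : ‖(h.euler τ hτ ^ n) x‖ ≤ c := by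
  have := h.norm_apply_euler_pow_le hτ hc n le_rfl
  rwa [h.c0.1] at this

theorem norm_euler_pow_le (h : StableSemigroup T M ε) {τ : ℝ} (hτ : 0 < τ) (n : ℕ) :
    ‖h.euler τ hτ ^ n‖ ≤ M :=
  ContinuousLinearMap.opNorm_le_bound _ h.M_nonneg fun x =>
    h.norm_euler_pow_apply_le hτ (fun _ ht => h.norm_apply_le' ht x) n

theorem euler_of_hasGen (h : StableSemigroup T M ε) {τ : ℝ} (hτ : 0 < τ) {x y : K}
    (hx : HasGen T x y) : h.euler τ hτ x = x + τ • h.euler τ hτ y := by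
  have := (h.hasGen_iff_res (lam := ((τ⁻¹ : ℝ) : ℂ)) (by simpa using hτ.le)).1 hx
  rw [map_sub, map_smul, sub_eq_iff_eq_add] at this
  rw [euler, smul_apply, this, smul_apply, ← Complex.coe_smul τ, smul_smul, ← Complex.ofReal_mul,
    mul_inv_cancel₀ hτ.ne', Complex.ofReal_one, one_smul]

theorem norm_apply_sub_euler_le (h : StableSemigroup T M ε) {τ : ℝ} (hτ : 0 < τ) {x y z : K}
    (hx : HasGen T x y) (hy : HasGen T y z) {c : ℝ} (hc : ∀ u, 0 ≤ u → ‖T u z‖ ≤ c) :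
    ∀ u, 0 ≤ u → ‖T u (T τ x - h.euler τ hτ x)‖ ≤ 2 * M * c * τ ^ 2 := by
  intro u hu
  have e : T τ x - h.euler τ hτ x = (T τ x - x - τ • y) - (τ ^ 2) • h.euler τ hτ z := by
    rw [h.euler_of_hasGen hτ hx, h.euler_of_hasGen hτ hy, smul_add, smul_smul, pow_two]
    abel
  have h1 := h.norm_apply_sub_sub_le hx hy hc hτ.le
  have h2 := h.norm_euler_pow_apply_le hτ hc 1
  rw [pow_one] at h2
  have h3 : ‖T τ x - h.euler τ hτ x‖ ≤ 2 * c * τ ^ 2 := by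
    rw [e]
    refine (norm_sub_le _ _).trans ?_
    rw [norm_smul, Real.norm_of_nonneg (sq_nonneg τ)]
    nlinarith [sq_nonneg τ]
  refine (h.norm_apply_le' hu _).trans ?_
  have := mul_le_mul_of_nonneg_left h3 h.M_nonneg
  linarith

theorem norm_apply_mul_sub_euler_pow_le (h : StableSemigroup T M ε) {τ : ℝ} (hτ : 0 < τ) (n : ℕ)
    {c : ℝ} {x y z : K} (hx : HasGen T x y) (hy : HasGen T y z) (hc : ∀ u, 0 ≤ u → ‖T u z‖ ≤ c) :
    ‖T (n * τ) x - (h.euler τ hτ ^ n) x‖ ≤ n * (2 * M * c * τ ^ 2) := by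
  induction n generalizing x y z with
  | zero => simp [h.c0.1]
  | succ n ih =>
    have hn : 0 ≤ n * τ := by positivity
    have h1 := ih (h.hasGen_apply hx hτ.le) (h.hasGen_apply hy hτ.le) fun u hu => by
      rw [← h.add_apply hu hτ.le]; exact hc _ (by positivity)
    have h2 := h.norm_euler_pow_apply_le hτ (h.norm_apply_sub_euler_le hτ hx hy hc) n
    have e : T (((n + 1 : ℕ) : ℝ) * τ) x - (h.euler τ hτ ^ (n + 1)) x =
        (T (n * τ) (T τ x) - (h.euler τ hτ ^ n) (T τ x)) +
          (h.euler τ hτ ^ n) (T τ x - h.euler τ hτ x) := by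
      rw [Nat.cast_succ, add_mul, one_mul, h.add_apply hn hτ.le, pow_succ,
        mul_apply_eq_comp, map_sub]
      abel
    rw [e]
    refine (norm_add_le _ _).trans ?_
    rw [Nat.cast_succ]
    linarith

/-- The exponential formula `T(t)x = lim (1 - (t/n)B)⁻ⁿ x`. -/
theorem tendsto_euler_pow (h : StableSemigroup T M ε) {t : ℝ} (ht : 0 < t) (x : K) :
    Tendsto (fun n : ℕ => (h.euler (t / (n + 1 : ℕ)) (by positivity) ^ (n + 1)) x) atTop
      (𝓝 (T t x)) := by
  have hd : Dense (range fun x => h.potential (h.potential x)) :=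
    h.denseRange_potential.comp h.denseRange_potential h.potential.continuous
  refine tendsto_apply_of_dense (c := M) (Eventually.of_forall fun n => h.norm_euler_pow_le _ _)
    hd ?_ x
  rintro _ ⟨x, rfl⟩
  have hx := h.hasGen_potential (h.potential x)
  have hy := h.hasGen_potential (-x)
  rw [map_neg, neg_neg] at hy
  rw [tendsto_iff_norm_sub_tendsto_zero]
  have hlim : Tendsto (fun n : ℕ => 2 * M * (M * ‖x‖) * t ^ 2 * (1 / ((n : ℝ) + 1))) atTop (𝓝 0) := by
    have := (tendsto_one_div_add_atTop_nhds_zero_nat (𝕜 := ℝ)).const_mul (2 * M * (M * ‖x‖) * t ^ 2)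
    rwa [mul_zero] at this
  refine squeeze_zero (fun _ => norm_nonneg _) (fun n => ?_) hlim
  have hn : (0 : ℝ) < n + 1 := by positivity
  have := h.norm_apply_mul_sub_euler_pow_le (τ := t / (n + 1 : ℕ)) (by positivity) (n + 1) hx hy
    fun u hu => h.norm_apply_le' hu x
  rw [mul_div_cancel₀ _ (by positivity)] at this
  rw [norm_sub_rev]
  refine this.trans (le_of_eq ?_)
  push_cast
  field_simp

theorem hasDerivAt_apply_potential (h : StableSemigroup T M ε) (x : K) {t : ℝ} (ht : 0 < t) :
    HasDerivAt (fun t => T t (h.potential x)) (-T t x) t := by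
  have hc : ContinuousAt (fun t => T t x) t := (h.c0.2.2 x).continuousAt (Ici_mem_nhds ht)
  have h1 : HasDerivAt (fun t => ∫ u in (0 : ℝ)..t, T u x) (T t x) t :=
    intervalIntegral.integral_hasDerivAt_right (h.intervalIntegrable x le_rfl ht.le)
      ⟨Ioi 0, Ioi_mem_nhds ht, h.aestronglyMeasurable x le_rfl⟩ hc
  refine (h1.neg.const_add (h.potential x)).congr_of_eventuallyEq ?_
  filter_upwards [Ioi_mem_nhds ht] with u hu
  rw [Pi.neg_apply, ← h.apply_potential_sub (le_of_lt hu), add_sub_cancel]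

theorem integral_smul_apply (h : StableSemigroup T M ε) (x : K) :
    ∫ t in Ioi (0 : ℝ), t • T t x = h.potential (h.potential x) := by
  set y := h.potential x
  have hintg : IntegrableOn (fun t => T t y - t • T t x) (Ioi 0) :=
    (h.integrableOn y le_rfl).sub (h.integrableOn_smul x)
  have hlim : Tendsto (fun t : ℝ => t • T t y) atTop (𝓝 0) := by
    have h0 : Tendsto (fun t : ℝ => M * ‖y‖ * (t ^ (1 : ℝ) * Real.exp (-ε * t))) atTop (𝓝 0) := by
      simpa using (tendsto_rpow_mul_exp_neg_mul_atTop_nhds_zero 1 ε h.pos).const_mul (M * ‖y‖)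
    refine squeeze_zero_norm' ?_ h0
    filter_upwards [eventually_ge_atTop 0] with t ht
    rw [norm_smul, Real.norm_of_nonneg ht, Real.rpow_one]
    have := mul_le_mul_of_nonneg_left (h.norm_apply_le ht y) ht
    linarith
  have := integral_Ioi_of_hasDerivAt_of_tendsto (f := fun t => t • T t y) (a := 0)
    ((continuousWithinAt_id).smul (h.c0.2.2 y 0 self_mem_Ici)) (fun t ht => by
      have := (hasDerivAt_id t).smul (h.hasDerivAt_apply_potential x ht)
      have e : id t • -T t x + (1 : ℝ) • T t y = T t y - t • T t x := by
        simp [sub_eq_add_neg, add_comm]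
      exact this.congr_deriv e) hintg hlim
  rw [integral_sub (h.integrableOn y le_rfl) (h.integrableOn_smul x), zero_smul, sub_zero,
    sub_eq_zero] at this
  rw [← this, potential_apply]

end StableSemigroup
end Semigroup2

section Plancherel

open scoped FourierTransform SchwartzMap ContDiff

theorem continuous_fourier_of_integrable {K : Type*} [NormedAddCommGroup K] [NormedSpace ℂ K]
    {f : ℝ → K} (hf : Integrable f) : Continuous (𝓕 f) :=
  VectorFourier.fourierIntegral_continuous Real.continuous_fourierChar
    (by exact (innerSL ℝ).continuous₂) hf

variable {K : Type*} [NormedAddCommGroup K] [InnerProductSpace ℂ K] [CompleteSpace K]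

theorem toLp_fourier_ae_eq {f : ℝ → K} (hf : Integrable f) (hf2 : MemLp f 2) :
    (𝓕 (hf2.toLp f) : Lp K 2 (volume : Measure ℝ)) =ᵐ[volume] 𝓕 f := by
  refine ae_eq_of_integral_contDiff_smul_eq ?_ ?_ ?_
  · exact (Lp.memLp _).locallyIntegrable (by norm_num)
  · exact (continuous_fourier_of_integrable hf).locallyIntegrable
  intro g hg hgc
  have hg' : ContDiff ℝ ∞ (fun x => (g x : ℂ)) := Complex.ofRealCLM.contDiff.comp hg
  have hgc' : HasCompactSupport (fun x => (g x : ℂ)) := hgc.comp_left (g := fun x : ℝ => (x : ℂ)) (by simp)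
  let φ : 𝓢(ℝ, ℂ) := hgc'.toSchwartzMap hg'
  have hφ : ∀ x, φ x = (g x : ℂ) := fun x => rfl
  have h1 := congrArg (fun D => D φ) (Lp.fourier_toTemperedDistribution_eq (hf2.toLp f))
  simp only [TemperedDistribution.fourier_apply, Lp.toTemperedDistribution_apply] at h1
  calc ∫ x, g x • (𝓕 (hf2.toLp f) : Lp K 2 (volume : Measure ℝ)) x
      = ∫ x, φ x • (𝓕 (hf2.toLp f) : Lp K 2 (volume : Measure ℝ)) x := by
        simp only [hφ, Complex.coe_smul]
    _ = ∫ x, (𝓕 φ) x • (hf2.toLp f) x := h1.symm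
    _ = ∫ x, (𝓕 φ) x • f x := by
        refine integral_congr_ae ?_
        filter_upwards [hf2.coeFn_toLp] with x hx
        rw [hx]
    _ = ∫ x, φ x • (𝓕 f) x := by
        rw [SchwartzMap.fourier_coe]
        have h2 := VectorFourier.integral_fourierIntegral_smul_eq_flip (L := innerₗ ℝ)
          Real.continuous_fourierChar (by exact (innerSL ℝ).continuous₂)
          (SchwartzMap.integrable (μ := volume) φ) hf
        rw [flip_innerₗ] at h2
        exact h2
    _ = _ := by simp only [hφ, Complex.coe_smul]

theorem eLpNorm_fourier_eq {f : ℝ → K} (hf : Integrable f) (hf2 : MemLp f 2) :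
    eLpNorm (𝓕 f) 2 = eLpNorm f 2 := by
  have h := Lp.norm_fourier_eq (hf2.toLp f)
  rw [Lp.norm_toLp, Lp.norm_def, ENNReal.toReal_eq_toReal_iff' (Lp.eLpNorm_ne_top _)
    hf2.eLpNorm_ne_top, eLpNorm_congr_ae (toLp_fourier_ae_eq hf hf2)] at h
  exact h

end Plancherel

open scoped FourierTransform in
theorem integrable_fourierChar_smul {E : Type*} [NormedAddCommGroup E] [NormedSpace ℂ E]
    {f : ℝ → E} (r : ℝ) (hf : Integrable f) : Integrable fun v => 𝐞 (-(v * r)) • f v := by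
  have := (Real.fourierIntegral_convergent_iff r).2 hf
  simpa [mul_comm] using this

namespace StableSemigroup

section Banach

variable {K : Type*} [NormedAddCommGroup K] [NormedSpace ℂ K] [CompleteSpace K]
  {T : ℝ → K →L[ℂ] K} {M ε : ℝ}

/-- The resolvent at the point `i r` of the imaginary axis. -/
def resI (h : StableSemigroup T M ε) (r : ℝ) : K →L[ℂ] K :=
  h.res ((r : ℂ) * Complex.I) (by simp)

theorem norm_res_le (h : StableSemigroup T M ε) {lam : ℂ} (hl : 0 ≤ lam.re) :
    ‖h.res lam hl‖ ≤ M / ε :=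
  norm_potential_le _

open scoped FourierTransform in
theorem fourier_orbit (h : StableSemigroup T M ε) (x : K) (r : ℝ) :
    𝓕 (indicator (Ioi 0) fun t => T t x) r = h.resI (2 * Real.pi * r) x := by
  rw [Real.fourier_real_eq_integral_exp_smul, resI, res, potential_apply,
    ← integral_indicator measurableSet_Ioi]
  congr 1
  ext t
  by_cases ht : t ∈ Ioi (0 : ℝ)
  · simp only [indicator_of_mem ht, _root_.damp, smul_apply]
    congr 2
    push_cast
    ring
  · simp [indicator_of_notMem ht]

open scoped FourierTransform in
theorem fourier_smul_orbit (h : StableSemigroup T M ε) (x : K) (r : ℝ) :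
    𝓕 (indicator (Ioi 0) fun t => t • T t x) r =
      h.resI (2 * Real.pi * r) (h.resI (2 * Real.pi * r) x) := by
  rw [Real.fourier_real_eq_integral_exp_smul, resI, res, ← integral_smul_apply,
    ← integral_indicator measurableSet_Ioi]
  congr 1
  ext t
  by_cases ht : t ∈ Ioi (0 : ℝ)
  · simp only [indicator_of_mem ht, _root_.damp, smul_apply]
    rw [smul_comm]
    congr 3
    push_cast
    ring
  · simp [indicator_of_notMem ht]

open scoped FourierTransform in
/-- Riemann-Lebesgue: the resolvent of an immediately norm continuous semigroup decays along the
imaginary axis. -/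
theorem exists_norm_resI_le (h : StableSemigroup T M ε) (hT : ContinuousOn T (Ioi 0)) {η : ℝ}
    (hη : 0 < η) : ∃ ρ : ℝ, 0 < ρ ∧ ∀ r : ℝ, ρ ≤ |r| → ‖h.resI r‖ ≤ η := by
  have hi : Integrable (indicator (Ioi 0) T) := by
    refine (integrable_indicator_iff (μ := volume) (f := T) (measurableSet_Ioi (a := (0 : ℝ)))).2 ?_
    refine Integrable.mono' ((integrableOn_exp h.pos 0).const_mul M)
      (hT.aestronglyMeasurable measurableSet_Ioi) ?_
    filter_upwards [ae_restrict_mem measurableSet_Ioi] with t ht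
    exact h.bound t (le_of_lt ht)
  have hF : ∀ r : ℝ, 𝓕 (indicator (Ioi 0) T) r = h.resI (2 * Real.pi * r) := by
    intro r
    ext x
    rw [← h.fourier_orbit x r, Real.fourier_real_eq, Real.fourier_real_eq,
      ContinuousLinearMap.integral_apply]
    · congr 1
      ext t
      by_cases ht : t ∈ Ioi (0 : ℝ)
      · simp [indicator_of_mem ht, Circle.smul_def]
      · simp [indicator_of_notMem ht]
    · exact integrable_fourierChar_smul r hi
  have hlim := (Real.tendsto_integral_exp_smul_cocompact (indicator (Ioi 0) T)).norm
  rw [norm_zero] at hlim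
  have hev := hlim.eventually (gt_mem_nhds hη)
  rw [← Metric.cobounded_eq_cocompact, (hasBasis_cobounded_norm).eventually_iff] at hev
  obtain ⟨B, -, hB⟩ := hev
  refine ⟨2 * Real.pi * max B 1, by positivity, fun r hr => ?_⟩
  have hr' : B ≤ ‖r / (2 * Real.pi)‖ := by
    rw [norm_div, Real.norm_eq_abs, Real.norm_of_nonneg (by positivity),
      le_div_iff₀ (by positivity)]
    nlinarith [le_max_left B 1, Real.pi_pos]
  have h1 := hB hr'
  rw [← Real.fourier_real_eq, hF] at h1
  rw [mul_div_cancel₀ _ (by positivity)] at h1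
  exact h1.le

theorem exists_norm_exp_mul_resI_le (h : StableSemigroup T M ε)
    (hR : ∀ η : ℝ, 0 < η → ∃ ρ : ℝ, 0 < ρ ∧ ∀ r : ℝ, ρ ≤ |r| → ‖h.resI r‖ ≤ η) {δ : ℝ}
    (hδ : 0 < δ) : ∀ᶠ τ in 𝓝[>] (0 : ℝ), ∀ r : ℝ,
      ‖Complex.exp (Complex.I * ↑(r * τ)) - 1‖ * ‖h.resI r‖ ≤ δ := by
  obtain ⟨ρ, hρ, hr⟩ := hR (δ / 2) (by positivity)
  have hM := zero_lt_one.trans_le h.one_le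
  have hε := h.pos
  have hpos : 0 < δ / (ρ * (M / ε)) := by positivity
  filter_upwards [Ioo_mem_nhdsGT hpos] with τ hτ r
  rcases le_total ρ |r| with hle | hle
  · have h1 : ‖Complex.exp (Complex.I * ↑(r * τ)) - 1‖ ≤ 2 := by
      refine (norm_sub_le _ _).trans ?_
      rw [mul_comm, Complex.norm_exp_ofReal_mul_I]
      norm_num
    calc _ ≤ 2 * (δ / 2) := by gcongr; exact hr r hle
      _ = δ := by ring
  · have h1 : ‖Complex.exp (Complex.I * ↑(r * τ)) - 1‖ ≤ ρ * τ := by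
      refine Real.norm_exp_I_mul_ofReal_sub_one_le.trans ?_
      rw [norm_mul, Real.norm_eq_abs, Real.norm_of_nonneg hτ.1.le]
      exact mul_le_mul_of_nonneg_right hle hτ.1.le
    calc _ ≤ (ρ * τ) * (M / ε) := by
            gcongr
            · exact mul_nonneg hρ.le hτ.1.le
            · exact h.norm_res_le _
      _ ≤ δ := by
        have := (lt_div_iff₀ (by positivity)).1 hτ.2
        linarith

end Banach

section Hilbert

variable {K : Type*} [NormedAddCommGroup K] [InnerProductSpace ℂ K] [CompleteSpace K]
  {T : ℝ → K →L[ℂ] K} {M ε : ℝ}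

theorem memLp_exp (hε : 0 < ε) :
    MemLp (fun t : ℝ => Real.exp (-ε * t)) 2 (volume.restrict (Ioi 0)) := by
  rw [memLp_two_iff_integrable_sq (by fun_prop)]
  refine (integrableOn_exp (ε := 2 * ε) (by positivity) 0).congr (.of_forall fun t => ?_)
  simp only
  rw [← Real.exp_nat_mul]
  congr 1
  push_cast
  ring

theorem memLp_id_mul_exp (hε : 0 < ε) :
    MemLp (fun t : ℝ => t * Real.exp (-ε * t)) 2 (volume.restrict (Ioi 0)) := by
  rw [memLp_two_iff_integrable_sq (by fun_prop)]
  have hi : IntegrableOn (fun t : ℝ => t ^ (2 : ℝ) * Real.exp (-(2 * ε) * t ^ (1 : ℝ))) (Ioi 0) :=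
    integrableOn_rpow_mul_exp_neg_mul_rpow (p := 1) (by norm_num) one_pos (by positivity)
  refine hi.congr (.of_forall fun t => ?_)
  simp only [mul_pow]
  rw [← Real.exp_nat_mul, Real.rpow_one, Real.rpow_two]
  congr 2
  push_cast
  ring

theorem memLp_smul_orbit (h : StableSemigroup T M ε) (x : K) :
    MemLp (indicator (Ioi 0) fun t => t • T t x) 2 (volume : Measure ℝ) := by
  rw [memLp_indicator_iff_restrict measurableSet_Ioi]
  refine ((memLp_id_mul_exp h.pos).const_mul (M * ‖x‖)).mono
    (aestronglyMeasurable_id.smul (h.aestronglyMeasurable x le_rfl)) ?_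
  filter_upwards [ae_restrict_mem measurableSet_Ioi] with t ht
  have ht' : (0 : ℝ) < t := ht
  have hM := h.M_nonneg
  have := mul_le_mul_of_nonneg_left (h.norm_apply_le ht'.le x) ht'.le
  rw [norm_smul, Real.norm_of_nonneg ht'.le, Real.norm_of_nonneg (by positivity)]
  linarith

theorem memLp_orbit (h : StableSemigroup T M ε) (x : K) :
    MemLp (indicator (Ioi 0) fun t => T t x) 2 (volume : Measure ℝ) := by
  rw [memLp_indicator_iff_restrict measurableSet_Ioi]
  refine ((memLp_exp h.pos).const_mul (M * ‖x‖)).mono (h.aestronglyMeasurable x le_rfl) ?_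
  filter_upwards [ae_restrict_mem measurableSet_Ioi] with t ht
  have ht' : (0 : ℝ) < t := ht
  have hM := h.M_nonneg
  rw [Real.norm_of_nonneg (by positivity)]
  exact h.norm_apply_le ht'.le x

theorem eLpNorm_orbit_le (h : StableSemigroup T M ε) (x : K) :
    eLpNorm (indicator (Ioi 0) fun t => T t x) 2 (volume : Measure ℝ) ≤
      ENNReal.ofReal (M * ‖x‖) *
        eLpNorm (fun t : ℝ => Real.exp (-ε * t)) 2 (volume.restrict (Ioi 0)) := by
  rw [eLpNorm_indicator_eq_eLpNorm_restrict measurableSet_Ioi]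
  refine eLpNorm_le_mul_eLpNorm_of_ae_le_mul ?_ 2
  filter_upwards [ae_restrict_mem measurableSet_Ioi] with t ht
  rw [Real.norm_of_nonneg (by positivity)]
  exact h.norm_apply_le (le_of_lt ht) x

open scoped FourierTransform in
theorem eLpNorm_translate_sub_le (h : StableSemigroup T M ε) {δ τ : ℝ}
    (hδ : ∀ r : ℝ, ‖Complex.exp (Complex.I * ↑(r * τ)) - 1‖ * ‖h.resI r‖ ≤ δ) (x : K) :
    let g : ℝ → K := indicator (Ioi 0) fun t => t • T t x
    eLpNorm (fun t => g (t + τ) - g t) 2 (volume : Measure ℝ) ≤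
      ENNReal.ofReal δ * eLpNorm (indicator (Ioi 0) fun t => T t x) 2 (volume : Measure ℝ) := by
  intro g
  have hg : Integrable g := (integrable_indicator_iff measurableSet_Ioi).2 (h.integrableOn_smul x)
  have hf : Integrable (indicator (Ioi 0) fun t => T t x) :=
    (integrable_indicator_iff measurableSet_Ioi).2 (h.integrableOn x le_rfl)
  have hg2 : MemLp g 2 := h.memLp_smul_orbit x
  have hgτ : Integrable fun t => g (t + τ) := hg.comp_add_right τ
  have hgτ2 : MemLp (fun t => g (t + τ)) 2 :=
    hg2.comp_measurePreserving (measurePreserving_add_right volume τ)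
  rw [show (fun t => g (t + τ) - g t) = (fun t => g (t + τ)) - g from rfl,
    ← eLpNorm_fourier_eq (hgτ.sub hg) (hgτ2.sub hg2), ← eLpNorm_fourier_eq hf (h.memLp_orbit x)]
  refine eLpNorm_le_mul_eLpNorm_of_ae_le_mul (.of_forall fun r => ?_) 2
  have h1 : 𝓕 (fun t => g (t + τ)) r = Complex.exp (Complex.I * ↑(2 * Real.pi * r * τ)) • 𝓕 g r := by
    have := congrFun (VectorFourier.fourierIntegral_comp_add_right Real.fourierChar volume
      (innerₗ ℝ) g τ) r
    refine this.trans ?_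
    rw [Circle.smul_def, Real.fourierChar_apply]
    congr 2
    simp
    ring
  have h2 : 𝓕 ((fun t => g (t + τ)) - g) r = 𝓕 (fun t => g (t + τ)) r - 𝓕 g r := by
    simp only [Real.fourier_real_eq, Pi.sub_apply, smul_sub]
    exact integral_sub (integrable_fourierChar_smul r hgτ)
      (integrable_fourierChar_smul r hg)
  have h3 : 𝓕 g r = h.resI (2 * Real.pi * r) (h.resI (2 * Real.pi * r) x) :=
    h.fourier_smul_orbit x r
  rw [h2, h1, h3, h.fourier_orbit]
  nth_rewrite 2 [← one_smul ℂ (h.resI (2 * Real.pi * r) (h.resI (2 * Real.pi * r) x))]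
  rw [← sub_smul, norm_smul]
  calc _ ≤ ‖Complex.exp (Complex.I * ↑(2 * Real.pi * r * τ)) - 1‖ *
        (‖h.resI (2 * Real.pi * r)‖ * ‖h.resI (2 * Real.pi * r) x‖) := by
        gcongr; exact ContinuousLinearMap.le_opNorm _ _
    _ ≤ _ := by
        rw [← mul_assoc]
        gcongr
        exact hδ _

theorem norm_apply_sub_mul_le (h : StableSemigroup T M ε) {δ τ a : ℝ} (hδ0 : 0 ≤ δ) (hτ : 0 ≤ τ)
    (ha : 0 < a)
    (hδ : ∀ r : ℝ, ‖Complex.exp (Complex.I * ↑(r * τ)) - 1‖ * ‖h.resI r‖ ≤ δ) (x : K) :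
    ‖T (a + τ) x - T a x‖ ≤ 2 / a * (M ^ 2 * τ + M ^ 2 * δ *
      (eLpNorm (fun t : ℝ => Real.exp (-ε * t)) 2 (volume.restrict (Ioi 0))).toReal *
        (a / 2) ^ (-(1 / 2) : ℝ)) * ‖x‖ := by
  set e := eLpNorm (fun t : ℝ => Real.exp (-ε * t)) 2 (volume.restrict (Ioi 0)) with he
  have hetop : e ≠ ⊤ := (memLp_exp h.pos).eLpNorm_ne_top
  have hM := zero_lt_one.trans_le h.one_le
  set g : ℝ → K := indicator (Ioi 0) fun t => t • T t x with hg
  set c : ℝ := a / 2 * ‖T (a + τ) x - T a x‖ - M ^ 2 * τ * ‖x‖ with hc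
  have hpt : ∀ t ∈ Ioc (a / 2) a, c ≤ M * ‖g (t + τ) - g t‖ := by
    intro t ht
    have ht0 : 0 < t := (half_pos ha).trans ht.1
    have h1 : g (t + τ) - g t = t • (T (t + τ) x - T t x) + τ • T (t + τ) x := by
      rw [hg, indicator_of_mem (show t ∈ Ioi (0 : ℝ) from ht0),
        indicator_of_mem (show t + τ ∈ Ioi (0 : ℝ) from add_pos_of_pos_of_nonneg ht0 hτ)]
      module
    have h2 : T (a + τ) x - T a x = T (a - t) (T (t + τ) x - T t x) := by
      rw [map_sub, ← h.add_apply (sub_nonneg.2 ht.2) (add_nonneg ht0.le hτ),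
        ← h.add_apply (sub_nonneg.2 ht.2) ht0.le]
      congr 3 <;> ring
    have h3 := h.norm_apply_le' (sub_nonneg.2 ht.2) (T (t + τ) x - T t x)
    have h4 := h.norm_apply_le' (add_nonneg ht0.le hτ) x
    have h5 : t * ‖T (t + τ) x - T t x‖ ≤ ‖g (t + τ) - g t‖ + τ * (M * ‖x‖) := by
      have : t • (T (t + τ) x - T t x) = (g (t + τ) - g t) - τ • T (t + τ) x := by
        rw [h1]; abel
      rw [← Real.norm_of_nonneg ht0.le, ← norm_smul, Real.norm_of_nonneg ht0.le, this]
      refine (norm_sub_le _ _).trans ?_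
      rw [norm_smul, Real.norm_of_nonneg hτ]
      gcongr
    rw [← h2] at h3
    have h6 : a / 2 * ‖T (a + τ) x - T a x‖ ≤ M * (t * ‖T (t + τ) x - T t x‖) := by
      calc _ ≤ t * (M * ‖T (t + τ) x - T t x‖) := by
            gcongr
            exact ht.1.le
        _ = _ := by ring
    have h7 := mul_le_mul_of_nonneg_left h5 hM.le
    rw [hc]
    nlinarith
  have hmain : c ≤ M ^ 2 * δ * e.toReal * (a / 2) ^ (-(1 / 2) : ℝ) * ‖x‖ := by
    rcases le_total c 0 with hc0 | hc0
    · exact hc0.trans (by positivity)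
    have h1 : eLpNorm (indicator (Ioc (a / 2) a) fun _ => c) 2 (volume : Measure ℝ) ≤
        ENNReal.ofReal M * eLpNorm (fun t => g (t + τ) - g t) 2 (volume : Measure ℝ) := by
      refine eLpNorm_le_mul_eLpNorm_of_ae_le_mul (.of_forall fun t => ?_) 2
      by_cases ht : t ∈ Ioc (a / 2) a
      · rw [indicator_of_mem ht, Real.norm_of_nonneg hc0]
        exact hpt t ht
      · rw [indicator_of_notMem ht, norm_zero]
        positivity
    have h2 := h1.trans (mul_le_mul_right ((h.eLpNorm_translate_sub_le hδ x).trans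
      (mul_le_mul_right (h.eLpNorm_orbit_le x) _)) _)
    rw [eLpNorm_indicator_const measurableSet_Ioc (by norm_num) (by norm_num), Real.volume_Ioc,
      ← he] at h2
    have h3 := ENNReal.toReal_mono (by finiteness) h2
    simp only [ENNReal.toReal_mul, ENNReal.toReal_ofReal hδ0, ENNReal.toReal_ofReal hM.le,
      ENNReal.toReal_ofReal (show 0 ≤ M * ‖x‖ by positivity), toReal_enorm,
      Real.norm_of_nonneg hc0, ← ENNReal.toReal_rpow,
      ENNReal.toReal_ofReal (half_pos ha).le, sub_half] at h3
    rw [Real.rpow_neg (by positivity), ← div_eq_mul_inv, div_mul_eq_mul_div,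
      le_div_iff₀ (by positivity)]
    norm_num at h3 ⊢
    linarith
  rw [hc, sub_le_iff_le_add] at hmain
  rw [← le_div_iff₀' (by positivity)] at hmain
  refine hmain.trans (le_of_eq ?_)
  field_simp
  ring

/-- On a Hilbert space, decay of the resolvent along the imaginary axis implies immediate norm
continuity. -/
theorem continuousOn_of_norm_resI_le (h : StableSemigroup T M ε)
    (hR : ∀ η : ℝ, 0 < η → ∃ ρ : ℝ, 0 < ρ ∧ ∀ r : ℝ, ρ ≤ |r| → ‖h.resI r‖ ≤ η) :
    ContinuousOn T (Ioi 0) := by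
  have hM := zero_lt_one.trans_le h.one_le
  have key : ∀ a : ℝ, 0 < a → ∀ η : ℝ, 0 < η → ∃ σ : ℝ, 0 < σ ∧ ∀ τ, 0 ≤ τ → τ < σ → 
      ‖T (a + τ) - T a‖ ≤ η := by
    intro a ha η hη
    set e := (eLpNorm (fun t : ℝ => Real.exp (-ε * t)) 2 (volume.restrict (Ioi 0))).toReal *
        (a / 2) ^ (-(1 / 2) : ℝ) with he
    have he0 : 0 ≤ e := by positivity
    set δ : ℝ := a * η / (4 * M ^ 2 * (e + 1)) with hδ
    have hδ0 : 0 < δ := by positivity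
    obtain ⟨σ, hσ, hσ'⟩ := (mem_nhdsGT_iff_exists_Ioo_subset).1
      (h.exists_norm_exp_mul_resI_le hR hδ0)
    refine ⟨min σ (a * η / (4 * M ^ 2)), lt_min hσ (by positivity), fun τ hτ0 hτ => ?_⟩
    rcases hτ0.eq_or_lt with rfl | hτ0
    · simpa using hη.le
    refine ContinuousLinearMap.opNorm_le_bound _ hη.le fun x => ?_
    refine (h.norm_apply_sub_mul_le hδ0.le hτ0.le ha
      (hσ' ⟨hτ0, hτ.trans_le (min_le_left _ _)⟩) x).trans ?_
    gcongr
    rw [mul_assoc (M ^ 2 * δ), ← he]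
    have h1 : M ^ 2 * τ ≤ a * η / 4 := by
      have := (hτ.trans_le (min_le_right _ _)).le
      rw [le_div_iff₀ (by positivity)] at this
      linarith
    have h2 : M ^ 2 * δ * e ≤ a * η / 4 := by
      calc M ^ 2 * δ * e ≤ M ^ 2 * δ * (e + 1) := by gcongr; linarith
        _ = a * η / 4 := by rw [hδ]; field_simp
    calc _ ≤ 2 / a * (a * η / 4 + a * η / 4) := by gcongr
      _ = η := by field_simp; ring
  intro t₀ ht₀
  have ht₀' : (0 : ℝ) < t₀ := ht₀
  refine ContinuousAt.continuousWithinAt (Metric.continuousAt_iff.2 fun η hη => ?_)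
  obtain ⟨σ, hσ, hk⟩ := key (t₀ / 2) (by positivity) (η / (2 * M)) (by positivity)
  have hk' : ∀ t τ, t₀ / 2 ≤ t → 0 ≤ τ → τ < σ → ‖T (t + τ) - T t‖ < η := by
    intro t τ ht hτ hτσ
    have hcomp : T (t + τ) - T t = T (t - t₀ / 2) ∘L (T (t₀ / 2 + τ) - T (t₀ / 2)) := by
      ext x
      simp only [sub_apply, ContinuousLinearMap.comp_apply, map_sub]
      rw [← h.add_apply (sub_nonneg.2 ht) (by positivity),
        ← h.add_apply (sub_nonneg.2 ht) (by positivity)]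
      congr 3 <;> ring
    rw [hcomp]
    calc _ ≤ M * (η / (2 * M)) := (ContinuousLinearMap.opNorm_comp_le _ _).trans
            (mul_le_mul (h.norm_le (sub_nonneg.2 ht)) (hk τ hτ hτσ) (norm_nonneg _) hM.le)
      _ = η / 2 := by field_simp
      _ < η := half_lt_self hη
  refine ⟨min σ (t₀ / 2), by positivity, fun {t} ht => ?_⟩
  rw [Real.dist_eq] at ht
  have h1 := ht.trans_le (min_le_left _ _)
  have h2 := abs_lt.1 (ht.trans_le (min_le_right _ _))
  rcases le_total t t₀ with hle | hle
  · rw [dist_comm, dist_eq_norm]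
    have := hk' t (t₀ - t) (by linarith) (by linarith) (by rw [abs_lt] at h1; linarith)
    rwa [add_sub_cancel] at this
  · rw [dist_eq_norm]
    have := hk' t₀ (t - t₀) (by linarith) (by linarith) (by rw [abs_lt] at h1; linarith)
    rwa [add_sub_cancel] at this

end Hilbert
end StableSemigroup

section Decomposable

variable {Ω : Type*} [MeasurableSpace Ω] {μ : Measure Ω}
  {E : Type*} [NormedAddCommGroup E] [NormedSpace ℂ E]

/-- `𝒮` acts fibrewise through the operators `S s`. -/
def Decomposes (μ : Measure Ω) (𝒮 : Lp E 2 μ →L[ℂ] Lp E 2 μ) (S : Ω → E →L[ℂ] E) : Prop :=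
  ∀ f : Lp E 2 μ, ∀ᵐ s ∂μ, 𝒮 f s = S s (f s)

/-- `𝒮` commutes with multiplication by indicator functions. -/
def IsLocalOp (μ : Measure Ω) (𝒮 : Lp E 2 μ →L[ℂ] Lp E 2 μ) : Prop :=
  ∀ U : Set Ω, MeasurableSet U → ∀ f g : Lp E 2 μ, g =ᵐ[μ] U.indicator f →
    𝒮 g =ᵐ[μ] U.indicator (𝒮 f)

namespace Decomposes

variable {𝒮 𝒮' : Lp E 2 μ →L[ℂ] Lp E 2 μ} {S S' : Ω → E →L[ℂ] E}

theorem one : Decomposes μ (1 : Lp E 2 μ →L[ℂ] Lp E 2 μ) fun _ => 1 := fun f => by simp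

theorem mul (h : Decomposes μ 𝒮 S) (h' : Decomposes μ 𝒮' S') :
    Decomposes μ (𝒮 * 𝒮') fun s => S s * S' s := fun f => by
  filter_upwards [h (𝒮' f), h' f] with s h1 h2
  rw [mul_apply_eq_comp, mul_apply_eq_comp, h1, h2]

theorem add (h : Decomposes μ 𝒮 S) (h' : Decomposes μ 𝒮' S') :
    Decomposes μ (𝒮 + 𝒮') fun s => S s + S' s := fun f => by
  filter_upwards [h f, h' f, Lp.coeFn_add (𝒮 f) (𝒮' f)] with s h1 h2 h3
  rw [add_apply, h3, Pi.add_apply, h1, h2, add_apply]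

theorem sub (h : Decomposes μ 𝒮 S) (h' : Decomposes μ 𝒮' S') :
    Decomposes μ (𝒮 - 𝒮') fun s => S s - S' s := fun f => by
  filter_upwards [h f, h' f, Lp.coeFn_sub (𝒮 f) (𝒮' f)] with s h1 h2 h3
  rw [sub_apply, h3, Pi.sub_apply, h1, h2, sub_apply]

theorem smul (h : Decomposes μ 𝒮 S) (c : ℂ) : Decomposes μ (c • 𝒮) fun s => c • S s := fun f => by
  filter_upwards [h f, Lp.coeFn_smul c (𝒮 f)] with s h1 h3
  rw [smul_apply, h3, Pi.smul_apply, h1, smul_apply]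

theorem eq_of_ae_eq (h : Decomposes μ 𝒮 S) (h' : Decomposes μ 𝒮' S') (hS : ∀ᵐ s ∂μ, S s = S' s) :
    𝒮 = 𝒮' := by
  ext1 f
  refine Lp.ext ?_
  filter_upwards [h f, h' f, hS] with s h1 h2 h3
  rw [h1, h2, h3]

theorem isLocalOp (h : Decomposes μ 𝒮 S) : IsLocalOp μ 𝒮 := by
  intro U hU f g hg
  filter_upwards [h f, h g, hg] with s h1 h2 h3
  rw [h2, h3]
  by_cases hs : s ∈ U
  · rw [indicator_of_mem hs, indicator_of_mem hs, h1]
  · rw [indicator_of_notMem hs, indicator_of_notMem hs, map_zero]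

end Decomposes

theorem aestronglyMeasurable_apply {S : Ω → E →L[ℂ] E}
    (hS : ∀ x, AEStronglyMeasurable (fun s => S s x) μ) {f : Ω → E}
    (hf : AEStronglyMeasurable f μ) : AEStronglyMeasurable (fun s => S s (f s)) μ := by
  have key : ∀ φ : SimpleFunc Ω E, AEStronglyMeasurable (fun s => S s (φ s)) μ := by
    intro φ
    induction φ using SimpleFunc.induction with
    | const c hs =>
      refine ((hS c).indicator hs).congr (.of_forall fun s => ?_)
      simp only [SimpleFunc.coe_piecewise, SimpleFunc.coe_const, Set.piecewise, Function.const,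
        indicator]
      split_ifs <;> simp
    | add _ h1 h2 =>
      refine (h1.add h2).congr (.of_forall fun s => ?_)
      simp
  refine aestronglyMeasurable_of_tendsto_ae atTop
    (fun n => key (hf.stronglyMeasurable_mk.approx n)) ?_
  filter_upwards [hf.ae_eq_mk] with s hs
  rw [hs]
  exact ((S s).continuous.tendsto _).comp (hf.stronglyMeasurable_mk.tendsto_approx s)

theorem exists_decomposes {S : Ω → E →L[ℂ] E}
    (hS : ∀ x, AEStronglyMeasurable (fun s => S s x) μ) {C : ℝ} (hC : 0 ≤ C)
    (hb : ∀ᵐ s ∂μ, ‖S s‖ ≤ C) :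
    ∃ 𝒮 : Lp E 2 μ →L[ℂ] Lp E 2 μ, Decomposes μ 𝒮 S ∧ ‖𝒮‖ ≤ C := by
  have hle : ∀ f : Lp E 2 μ, ∀ᵐ s ∂μ, ‖S s (f s)‖ ≤ C * ‖f s‖ := fun f => by
    filter_upwards [hb] with s hs using (S s).le_of_opNorm_le hs _
  have hmem : ∀ f : Lp E 2 μ, MemLp (fun s => S s (f s)) 2 μ := fun f =>
    (Lp.memLp f).of_le_mul (aestronglyMeasurable_apply hS (Lp.aestronglyMeasurable f)) (hle f)
  let L : Lp E 2 μ →ₗ[ℂ] Lp E 2 μ :=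
    { toFun := fun f => (hmem f).toLp _
      map_add' := fun f g => by
        refine Lp.ext ?_
        filter_upwards [(hmem (f + g)).coeFn_toLp, (hmem f).coeFn_toLp, (hmem g).coeFn_toLp,
          Lp.coeFn_add f g, Lp.coeFn_add ((hmem f).toLp _) ((hmem g).toLp _)] with s h1 h2 h3 h4 h5
        rw [h1, h5, Pi.add_apply, h2, h3, h4, Pi.add_apply, map_add]
      map_smul' := fun c f => by
        refine Lp.ext ?_
        filter_upwards [(hmem (c • f)).coeFn_toLp, (hmem f).coeFn_toLp,
          Lp.coeFn_smul c f, Lp.coeFn_smul c ((hmem f).toLp _)] with s h1 h2 h4 h5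
        rw [h1, RingHom.id_apply, h5, Pi.smul_apply, h2, h4, Pi.smul_apply, map_smul] }
  have hL : ∀ f, ‖L f‖ ≤ C * ‖f‖ := fun f => by
    refine Lp.norm_le_mul_norm_of_ae_le_mul ?_
    filter_upwards [(hmem f).coeFn_toLp, hle f] with s h1 h2
    exact (congrArg norm h1).trans_le h2
  exact ⟨L.mkContinuous C hL, fun f => (hmem f).coeFn_toLp, L.mkContinuous_norm_le hC hL⟩

namespace IsLocalOp

variable {𝒮 𝒮' : Lp E 2 μ →L[ℂ] Lp E 2 μ}

theorem one : IsLocalOp μ (1 : Lp E 2 μ →L[ℂ] Lp E 2 μ) := Decomposes.one.isLocalOp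

theorem mul (h : IsLocalOp μ 𝒮) (h' : IsLocalOp μ 𝒮') : IsLocalOp μ (𝒮 * 𝒮') :=
  fun U hU f g hg => h U hU (𝒮' f) (𝒮' g) (h' U hU f g hg)

theorem pow (h : IsLocalOp μ 𝒮) (n : ℕ) : IsLocalOp μ (𝒮 ^ n) := by
  induction n with
  | zero => exact one
  | succ n ih => rw [pow_succ]; exact ih.mul h

theorem smul (h : IsLocalOp μ 𝒮) (c : ℂ) : IsLocalOp μ (c • 𝒮) := by
  intro U hU f g hg
  filter_upwards [h U hU f g hg, Lp.coeFn_smul c (𝒮 f), Lp.coeFn_smul c (𝒮 g)] with s h1 h2 h3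
  rw [smul_apply, h3, Pi.smul_apply, h1]
  by_cases hs : s ∈ U
  · rw [indicator_of_mem hs, indicator_of_mem hs, smul_apply, h2, Pi.smul_apply]
  · rw [indicator_of_notMem hs, indicator_of_notMem hs, smul_zero]

theorem of_tendsto {𝒮n : ℕ → Lp E 2 μ →L[ℂ] Lp E 2 μ} (h : ∀ n, IsLocalOp μ (𝒮n n))
    (hlim : ∀ f, Tendsto (fun n => 𝒮n n f) atTop (𝓝 (𝒮 f))) : IsLocalOp μ 𝒮 := by
  classical
  intro U hU f g hg
  have hm : ∀ x : E, AEStronglyMeasurable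
      (fun s => (U.indicator (fun _ => (1 : E →L[ℂ] E)) s) x) μ := fun x => by
    refine ((aestronglyMeasurable_const (b := x)).indicator hU).congr (.of_forall fun s => ?_)
    by_cases hs : s ∈ U <;> simp [hs]
  obtain ⟨P, hP, -⟩ := exists_decomposes hm zero_le_one (.of_forall fun s => by
    by_cases hs : s ∈ U
    · rw [indicator_of_mem hs]; exact ContinuousLinearMap.norm_id_le
    · rw [indicator_of_notMem hs, norm_zero]; exact zero_le_one)
  have hP' : ∀ f : Lp E 2 μ, P f =ᵐ[μ] U.indicator f := fun f => by
    filter_upwards [hP f] with s hs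
    rw [hs]
    by_cases hs : s ∈ U <;> simp [hs]
  have hn : ∀ n, 𝒮n n g = P (𝒮n n f) := fun n =>
    Lp.ext ((h n U hU f g hg).trans (hP' _).symm)
  have : 𝒮 g = P (𝒮 f) := by
    refine tendsto_nhds_unique (hlim g) ?_
    simp only [hn]
    exact (P.continuous.tendsto _).comp (hlim f)
  rw [this]
  exact hP' _

theorem ae_norm_le [SigmaFinite μ] (h : IsLocalOp μ 𝒮) (f : Lp E 2 μ) :
    ∀ᵐ s ∂μ, ‖𝒮 f s‖ ≤ ‖𝒮‖ * ‖f s‖ := by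
  have hpow : ∀ (u : Lp E 2 μ) (U : Set Ω), ∫⁻ s in U, ‖u s‖ₑ ^ (2 : ℝ) ∂μ =
      eLpNorm u 2 (μ.restrict U) ^ (2 : ℝ) := fun u U =>
    (eLpNorm_nnreal_pow_eq_lintegral (p := 2) (by norm_num)).symm
  have key : (fun s => ‖𝒮 f s‖ₑ ^ (2 : ℝ)) ≤ᵐ[μ] fun s => ‖((‖𝒮‖ : ℂ) • f) s‖ₑ ^ (2 : ℝ) := by
    refine ae_le_of_forall_setLIntegral_le_of_sigmaFinite₀
      ((Lp.aestronglyMeasurable _).enorm.pow_const _) fun U hU _ => ?_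
    have hg := (Lp.memLp f).indicator hU
    have h1 := h U hU f (hg.toLp _) hg.coeFn_toLp
    rw [hpow, hpow]
    refine ENNReal.rpow_le_rpow ?_ zero_le_two
    rw [← eLpNorm_indicator_eq_eLpNorm_restrict hU, ← eLpNorm_indicator_eq_eLpNorm_restrict hU,
      ← eLpNorm_congr_ae h1]
    have h2 : U.indicator ((‖𝒮‖ : ℂ) • f : Lp E 2 μ) =ᵐ[μ] ((‖𝒮‖ : ℂ) • hg.toLp _ : Lp E 2 μ) := by
      filter_upwards [Lp.coeFn_smul (‖𝒮‖ : ℂ) f, Lp.coeFn_smul (‖𝒮‖ : ℂ) (hg.toLp _),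
        hg.coeFn_toLp] with s h1 h2 h3
      rw [h2, Pi.smul_apply, h3]
      by_cases hs : s ∈ U
      · rw [indicator_of_mem hs, indicator_of_mem hs, h1, Pi.smul_apply]
      · rw [indicator_of_notMem hs, indicator_of_notMem hs, smul_zero]
    rw [eLpNorm_congr_ae h2]
    have h3 : ‖𝒮 (hg.toLp _)‖ ≤ ‖((‖𝒮‖ : ℂ) • hg.toLp _ : Lp E 2 μ)‖ := by
      rw [norm_smul, Complex.norm_real, norm_norm]
      exact 𝒮.le_opNorm _
    rw [Lp.norm_def, Lp.norm_def] at h3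
    exact (ENNReal.toReal_le_toReal (Lp.eLpNorm_ne_top _) (Lp.eLpNorm_ne_top _)).1 h3
  filter_upwards [key, Lp.coeFn_smul (‖𝒮‖ : ℂ) f] with s hs h1
  rw [ENNReal.rpow_le_rpow_iff two_pos, ← ofReal_norm, ← ofReal_norm,
    ENNReal.ofReal_le_ofReal_iff (norm_nonneg _), h1, Pi.smul_apply, norm_smul,
    Complex.norm_real, norm_norm] at hs
  exact hs

end IsLocalOp

variable (μ E) in
theorem exists_weighted_const [SigmaFinite μ] : ∃ (w : Ω → ℝ) (J : E → Lp E 2 μ),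
    (∀ s, 0 < w s) ∧ Measurable w ∧ ∀ x, ∀ᵐ s ∂μ, J x s = w s • x := by
  obtain ⟨g, hg0, hgm, hgi⟩ := exists_pos_lintegral_lt_of_sigmaFinite μ one_ne_zero
  have hm : Measurable fun s => Real.sqrt (g s) := by fun_prop
  have hw : MemLp (fun s => Real.sqrt (g s)) 2 μ := by
    rw [memLp_two_iff_integrable_sq hm.aestronglyMeasurable]
    refine ⟨by fun_prop, ?_⟩
    rw [HasFiniteIntegral]
    refine lt_of_le_of_lt (lintegral_mono fun s => ?_) (hgi.trans ENNReal.one_lt_top)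
    rw [Real.sq_sqrt (by positivity)]
    simp [enorm_eq_nnnorm]
  have hJ : ∀ x : E, MemLp (fun s => Real.sqrt (g s) • x) 2 μ := fun x =>
    hw.of_le_mul (c := ‖x‖) (hm.aestronglyMeasurable.smul_const x)
      (.of_forall fun s => by rw [norm_smul, mul_comm])
  exact ⟨fun s => Real.sqrt (g s), fun x => (hJ x).toLp _,
    fun s => Real.sqrt_pos.2 (by exact_mod_cast hg0 s), hm, fun x => (hJ x).coeFn_toLp⟩

namespace Decomposes

variable [SigmaFinite μ] [TopologicalSpace.SeparableSpace E]
  {𝒮 : Lp E 2 μ →L[ℂ] Lp E 2 μ} {S S' : Ω → E →L[ℂ] E}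

theorem ae_norm_le (h : Decomposes μ 𝒮 S) : ∀ᵐ s ∂μ, ‖S s‖ ≤ ‖𝒮‖ := by
  obtain ⟨w, J, hw, -, hJ⟩ := exists_weighted_const μ E
  have h1 : ∀ᵐ s ∂μ, ∀ k, ‖S s (TopologicalSpace.denseSeq E k)‖ ≤
      ‖𝒮‖ * ‖TopologicalSpace.denseSeq E k‖ := by
    refine ae_all_iff.2 fun k => ?_
    filter_upwards [h.isLocalOp.ae_norm_le (J (TopologicalSpace.denseSeq E k)),
      h (J (TopologicalSpace.denseSeq E k)), hJ (TopologicalSpace.denseSeq E k)] with s h1 h2 h3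
    rw [h2, h3, ContinuousLinearMap.map_smul_of_tower, norm_smul, norm_smul,
      mul_left_comm] at h1
    exact le_of_mul_le_mul_left h1 (norm_pos_iff.2 (hw s).ne')
  filter_upwards [h1] with s hs
  refine ContinuousLinearMap.opNorm_le_bound _ (norm_nonneg _) fun x => ?_
  refine (TopologicalSpace.denseRange_denseSeq E).induction_on
    (p := fun x => ‖S s x‖ ≤ ‖𝒮‖ * ‖x‖) x ?_ hs
  exact isClosed_le (by fun_prop) (by fun_prop)

theorem ae_eq (h : Decomposes μ 𝒮 S) (h' : Decomposes μ 𝒮 S') : ∀ᵐ s ∂μ, S s = S' s := by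
  have h0 := (h.sub h').ae_norm_le
  filter_upwards [h0] with s hs
  simpa [sub_eq_zero] using hs

end Decomposes

end Decomposable

section Extension

variable {E : Type*} [NormedAddCommGroup E] [NormedSpace ℂ E] [CompleteSpace E]

/-- A map on a dense sequence which is approximately linear extends to a bounded operator. -/
theorem exists_clm_of_denseRange {d : ℕ → E} (hd : DenseRange d) {e : ℕ → ℂ} (he : DenseRange e)
    {F : ℕ → E} {C : ℝ} (hC : 0 ≤ C) (hsub : ∀ k l, ‖F k - F l‖ ≤ C * ‖d k - d l‖)
    (hlin : ∀ i k j l, ‖F k + e i • F j - F l‖ ≤ C * ‖d k + e i • d j - d l‖) :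
    ∃ S : E →L[ℂ] E, (∀ k, S (d k) = F k) ∧ ‖S‖ ≤ C := by
  have hlin' : ∀ (c : ℂ) k j l, ‖F k + c • F j - F l‖ ≤ C * ‖d k + c • d j - d l‖ := by
    intro c k j l
    refine he.induction_on
      (p := fun c => ‖F k + c • F j - F l‖ ≤ C * ‖d k + c • d j - d l‖) c ?_
      fun i => hlin i k j l
    exact isClosed_le (by fun_prop) (by fun_prop)
  have happ : ∀ (y : E) (n : ℕ), ∃ k, dist y (d k) < 1 / ((n : ℝ) + 1) := fun y n =>
    hd.exists_dist_lt y (by positivity)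
  choose κ hκ using happ
  have hdlim : ∀ y, Tendsto (fun n => d (κ y n)) atTop (𝓝 y) := fun y => by
    rw [tendsto_iff_dist_tendsto_zero]
    refine squeeze_zero (fun _ => dist_nonneg) (fun n => ?_) tendsto_one_div_add_atTop_nhds_zero_nat
    rw [dist_comm]
    exact (hκ y n).le
  have hFlim : ∀ y, ∃ z, Tendsto (fun n => F (κ y n)) atTop (𝓝 z) := fun y => by
    refine cauchySeq_tendsto_of_complete ?_
    have hcd := (hdlim y).cauchySeq
    rw [Metric.cauchySeq_iff] at hcd ⊢
    intro η hη
    obtain ⟨N, hN⟩ := hcd (η / (C + 1)) (by positivity)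
    refine ⟨N, fun m hm n hn => ?_⟩
    have h1 := hN m hm n hn
    rw [dist_eq_norm] at h1 ⊢
    rw [lt_div_iff₀ (by positivity)] at h1
    refine (hsub _ _).trans_lt ?_
    nlinarith [norm_nonneg (d (κ y m) - d (κ y n))]
  choose S hS using hFlim
  have hSlin : ∀ (c : ℂ) (x y z : E), ‖S x + c • S y - S z‖ ≤ C * ‖x + c • y - z‖ := by
    intro c x y z
    exact le_of_tendsto_of_tendsto
      (((hS x).add ((hS y).const_smul c)).sub (hS z)).norm
      ((((hdlim x).add ((hdlim y).const_smul c)).sub (hdlim z)).norm.const_mul C)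
      (.of_forall fun n => hlin' c _ _ _)
  have hadd : ∀ (c : ℂ) (x y : E), S (x + c • y) = S x + c • S y := fun c x y => by
    have := hSlin c x y (x + c • y)
    rw [sub_self, norm_zero, mul_zero] at this
    exact (sub_eq_zero.1 (norm_le_zero_iff.1 this)).symm
  have hzero : S 0 = 0 := by
    have := hadd 1 0 0
    simpa using this
  let L : E →ₗ[ℂ] E :=
    { toFun := S
      map_add' := fun x y => by simpa using hadd 1 x y
      map_smul' := fun c x => by simpa [hzero] using hadd c 0 x }
  have hL : ∀ x, ‖L x‖ ≤ C * ‖x‖ := fun x => by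
    show ‖S x‖ ≤ C * ‖x‖
    simpa [hzero] using hSlin 0 x 0 0
  refine ⟨L.mkContinuous C hL, fun k => ?_, L.mkContinuous_norm_le hC hL⟩
  refine tendsto_nhds_unique (hS (d k)) ?_
  rw [tendsto_iff_norm_sub_tendsto_zero]
  have h0 : Tendsto (fun n => C * ‖d (κ (d k) n) - d k‖) atTop (𝓝 0) := by
    have := (tendsto_iff_norm_sub_tendsto_zero.1 (hdlim (d k))).const_mul C
    rwa [mul_zero] at this
  exact squeeze_zero (fun _ => norm_nonneg _) (fun n => hsub _ _) h0

end Extension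

section Decomposable

variable {Ω : Type*} [MeasurableSpace Ω] {μ : Measure Ω} [SigmaFinite μ]
  {E : Type*} [NormedAddCommGroup E] [NormedSpace ℂ E] [TopologicalSpace.SeparableSpace E]

open TopologicalSpace (denseSeq denseRange_denseSeq)

theorem IsLocalOp.exists_decomposes [CompleteSpace E] {𝒮 : Lp E 2 μ →L[ℂ] Lp E 2 μ}
    (h : IsLocalOp μ 𝒮) : ∃ S : Ω → E →L[ℂ] E, Decomposes μ 𝒮 S := by
  obtain ⟨w, J, hw, -, hJ⟩ := exists_weighted_const μ E
  set d := denseSeq E with hd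
  set F : ℕ → Ω → E := fun k s => (w s)⁻¹ • 𝒮 (J (d k)) s with hF
  have hcancel : ∀ s (x : E), (w s)⁻¹ • w s • x = x := fun s x => inv_smul_smul₀ (hw s).ne' x
  have hsub : ∀ᵐ s ∂μ, ∀ k l, ‖F k s - F l s‖ ≤ ‖𝒮‖ * ‖d k - d l‖ := by
    refine ae_all_iff.2 fun k => ae_all_iff.2 fun l => ?_
    filter_upwards [h.ae_norm_le (J (d k) - J (d l)), Lp.coeFn_sub (J (d k)) (J (d l)),
      hJ (d k), hJ (d l), Lp.coeFn_sub (𝒮 (J (d k))) (𝒮 (J (d l)))] with s h1 h2 h3 h4 h5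
    rw [map_sub, h5, h2, Pi.sub_apply, Pi.sub_apply, h3, h4, ← smul_sub, norm_smul,
      mul_left_comm] at h1
    simp only [hF]
    rw [← smul_sub, norm_smul, norm_inv]
    rwa [inv_mul_le_iff₀ (norm_pos_iff.2 (hw s).ne')]
  have hlin : ∀ᵐ s ∂μ, ∀ i k j l, ‖F k s + denseSeq ℂ i • F j s - F l s‖ ≤
      ‖𝒮‖ * ‖d k + denseSeq ℂ i • d j - d l‖ := by
    refine ae_all_iff.2 fun i => ae_all_iff.2 fun k => ae_all_iff.2 fun j => ae_all_iff.2 fun l => ?_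
    set c := denseSeq ℂ i
    filter_upwards [h.ae_norm_le (J (d k) + c • J (d j) - J (d l)),
      Lp.coeFn_sub (J (d k) + c • J (d j)) (J (d l)), Lp.coeFn_add (J (d k)) (c • J (d j)),
      Lp.coeFn_smul c (J (d j)), hJ (d k), hJ (d l), hJ (d j),
      Lp.coeFn_sub (𝒮 (J (d k)) + c • 𝒮 (J (d j))) (𝒮 (J (d l))),
      Lp.coeFn_add (𝒮 (J (d k))) (c • 𝒮 (J (d j))), Lp.coeFn_smul c (𝒮 (J (d j)))]
      with s h1 h2 h3 h4 h5 h6 h7 h8 h9 h10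
    rw [map_sub, map_add, map_smul, h8, h2, Pi.sub_apply, Pi.sub_apply, h9, h3, Pi.add_apply,
      Pi.add_apply, h10, h4, Pi.smul_apply, Pi.smul_apply, h5, h6, h7, smul_comm c (w s),
      ← smul_add, ← smul_sub, norm_smul (w s), mul_left_comm] at h1
    simp only [hF]
    rw [smul_comm c (w s)⁻¹, ← smul_add, ← smul_sub, norm_smul (w s)⁻¹, norm_inv]
    rwa [inv_mul_le_iff₀ (norm_pos_iff.2 (hw s).ne')]
  have hex : ∀ᵐ s ∂μ, ∃ S : E →L[ℂ] E, (∀ k, S (d k) = F k s) ∧ ‖S‖ ≤ ‖𝒮‖ := by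
    filter_upwards [hsub, hlin] with s h1 h2
    exact exists_clm_of_denseRange (denseRange_denseSeq E) (denseRange_denseSeq ℂ)
      (norm_nonneg _) h1 h2
  obtain ⟨S, hS⟩ : ∃ S : Ω → E →L[ℂ] E, ∀ᵐ s ∂μ, (∀ k, S s (d k) = F k s) ∧ ‖S s‖ ≤ ‖𝒮‖ := by
    classical
    refine ⟨fun s => if hs : ∃ S : E →L[ℂ] E, (∀ k, S (d k) = F k s) ∧ ‖S‖ ≤ ‖𝒮‖
      then hs.choose else 0, ?_⟩
    filter_upwards [hex] with s hs
    rw [dif_pos hs]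
    exact hs.choose_spec
  refine ⟨S, fun f => ?_⟩
  have happ : ∀ᵐ s ∂μ, ∀ k, ‖𝒮 f s - w s • F k s‖ ≤ ‖𝒮‖ * ‖f s - w s • d k‖ := by
    refine ae_all_iff.2 fun k => ?_
    filter_upwards [h.ae_norm_le (f - J (d k)), Lp.coeFn_sub f (J (d k)),
      hJ (d k), Lp.coeFn_sub (𝒮 f) (𝒮 (J (d k)))] with s h1 h2 h3 h5
    rw [map_sub, h5, h2, Pi.sub_apply, Pi.sub_apply, h3] at h1
    simp only [hF]
    rwa [smul_inv_smul₀ (hw s).ne']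
  filter_upwards [happ, hS] with s h1 h2
  have h3 : ‖𝒮 f s - w s • S s ((w s)⁻¹ • f s)‖ ≤
      ‖𝒮‖ * ‖f s - w s • ((w s)⁻¹ • f s)‖ := by
    refine (denseRange_denseSeq E).induction_on
      (p := fun x => ‖𝒮 f s - w s • S s x‖ ≤ ‖𝒮‖ * ‖f s - w s • x‖) _ ?_ fun k => ?_
    · exact isClosed_le (by fun_prop) (by fun_prop)
    · have := h1 k
      rwa [← h2.1 k] at this
  rw [ContinuousLinearMap.map_smul_of_tower, smul_inv_smul₀ (hw s).ne', smul_inv_smul₀ (hw s).ne',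
    sub_self, norm_zero, mul_zero] at h3
  exact sub_eq_zero.1 (norm_le_zero_iff.1 h3)

theorem Decomposes.ae_denseRange {𝒱 : Lp E 2 μ →L[ℂ] Lp E 2 μ} {V : Ω → E →L[ℂ] E}
    (h : Decomposes μ 𝒱 V) (hd : DenseRange 𝒱) : ∀ᵐ s ∂μ, DenseRange (V s) := by
  obtain ⟨w, J, hw, -, hJ⟩ := exists_weighted_const μ E
  have key : ∀ᵐ s ∂μ, ∀ k, denseSeq E k ∈ closure (range (V s)) := by
    refine ae_all_iff.2 fun k => ?_
    obtain ⟨v, hv, hlim⟩ := mem_closure_iff_seq_limit.1 (hd (J (denseSeq E k)))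
    choose u hu using hv
    obtain ⟨ns, -, hns⟩ := (tendstoInMeasure_of_tendsto_Lp hlim).exists_seq_tendsto_ae
    filter_upwards [hns, hJ (denseSeq E k), ae_all_iff.2 fun n => h (u n)] with s h1 h2 h3
    rw [h2] at h1
    have h4 := h1.const_smul (w s)⁻¹
    rw [inv_smul_smul₀ (hw s).ne'] at h4
    refine mem_closure_of_tendsto h4 (.of_forall fun i => ?_)
    rw [← hu, h3, ← ContinuousLinearMap.map_smul_of_tower]
    exact mem_range_self _
  filter_upwards [key] with s hs
  refine dense_closure.1 ((denseRange_denseSeq E).mono ?_)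
  rintro _ ⟨k, rfl⟩
  exact hs k

end Decomposable

section RationalExtension

variable {K : Type*} [NormedAddCommGroup K] [NormedSpace ℂ K] {M ε : ℝ}

/-- A semigroup indexed by the nonnegative rationals, together with a candidate `V` for the
resolvent at `1` of its generator. -/
structure RatSemigroup (T : ℚ → K →L[ℂ] K) (V : K →L[ℂ] K) (M ε C : ℝ) : Prop where
  zero : T 0 = 1
  add : ∀ p q : ℚ, 0 ≤ p → 0 ≤ q → T (p + q) = T p * T q
  one_le : 1 ≤ M
  pos : 0 < ε
  nonneg : 0 ≤ C
  bound : ∀ q : ℚ, 0 ≤ q → ‖T q‖ ≤ M * Real.exp (-ε * q)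
  dense : DenseRange V
  sub_le : ∀ q : ℚ, 0 ≤ q → ‖(T q - 1) * V‖ ≤ C * q
  sub_sub_le : ∀ q : ℚ, 0 ≤ q →
    ‖(T q - 1) * (V * V) - (q : ℂ) • (V * V - V)‖ ≤ C * (q : ℝ) ^ 2

namespace RatSemigroup

variable {T : ℚ → K →L[ℂ] K} {V : K →L[ℂ] K} {C : ℝ}

theorem norm_le (h : RatSemigroup T V M ε C) {q : ℚ} (hq : 0 ≤ q) : ‖T q‖ ≤ M := by
  have hM := zero_lt_one.trans_le h.one_le
  refine (h.bound q hq).trans (mul_le_of_le_one_right hM.le (Real.exp_le_one_iff.2 ?_))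
  have : (0 : ℝ) ≤ q := by exact_mod_cast hq
  nlinarith [h.pos]

theorem norm_apply_sub_range_le (h : RatSemigroup T V M ε C) {p q : ℚ} (hp : 0 ≤ p) (hq : 0 ≤ q)
    (y : K) : ‖T p (V y) - T q (V y)‖ ≤ M * (C * |(p : ℝ) - q| * ‖y‖) := by
  wlog hpq : q ≤ p generalizing p q
  · rw [norm_sub_rev, abs_sub_comm]
    exact this hq hp (le_of_not_ge hpq)
  have h1 : T p (V y) - T q (V y) = T q (((T (p - q) - 1) * V) y) := by
    have := h.add q (p - q) hq (sub_nonneg.2 hpq)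
    rw [add_sub_cancel] at this
    rw [this]
    simp [mul_apply_eq_comp]
  have h2 : |(p : ℝ) - q| = ((p - q : ℚ) : ℝ) := by
    push_cast
    exact abs_of_nonneg (sub_nonneg.2 (by exact_mod_cast hpq))
  rw [h1, h2]
  have hM := zero_lt_one.trans_le h.one_le
  refine ((T q).le_of_opNorm_le (h.norm_le hq) _).trans ?_
  gcongr
  exact ContinuousLinearMap.le_of_opNorm_le _ (h.sub_le _ (sub_nonneg.2 hpq)) _

theorem exists_norm_apply_sub_le (h : RatSemigroup T V M ε C) (x : K) {η : ℝ} (hη : 0 < η) :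
    ∃ δ : ℝ, 0 < δ ∧ ∀ p q : ℚ, 0 ≤ p → 0 ≤ q → |(p : ℝ) - q| < δ → ‖T p x - T q x‖ ≤ η := by
  have hM := zero_lt_one.trans_le h.one_le
  have hC := h.nonneg
  obtain ⟨y, hy⟩ := h.dense.exists_dist_lt x (show 0 < η / (4 * M) by positivity)
  rw [dist_eq_norm, lt_div_iff₀ (by positivity)] at hy
  refine ⟨η / (2 * M * (C * ‖y‖ + 1)), by positivity, fun p q hp hq hpq => ?_⟩
  rw [lt_div_iff₀ (by positivity)] at hpq
  have h1 := h.norm_apply_sub_range_le hp hq y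
  have h2 := (T p).le_of_opNorm_le (h.norm_le hp) (x - V y)
  have h3 := (T q).le_of_opNorm_le (h.norm_le hq) (x - V y)
  have h4 : T p x - T q x = T p (x - V y) + (T p (V y) - T q (V y)) - T q (x - V y) := by
    simp only [map_sub]; abel
  rw [h4]
  have h5 := (norm_sub_le (T p (x - V y) + (T p (V y) - T q (V y))) (T q (x - V y))).trans
    (add_le_add_left (norm_add_le _ _) _)
  have h6 : M * (C * |(p : ℝ) - q| * ‖y‖) ≤ η / 2 := by
    have := mul_nonneg hM.le (abs_nonneg ((p : ℝ) - q))
    nlinarith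
  linarith

theorem exists_ratSeq {t : ℝ} (ht : 0 ≤ t) :
    ∃ r : ℕ → ℚ, (∀ n, 0 ≤ r n) ∧ Tendsto (fun n => (r n : ℝ)) atTop (𝓝 t) := by
  have : ∀ n : ℕ, ∃ q : ℚ, t < q ∧ (q : ℝ) < t + 1 / ((n : ℝ) + 1) := fun n =>
    exists_rat_btwn (lt_add_of_pos_right _ (by positivity))
  choose r h1 h2 using this
  refine ⟨r, fun n => by exact_mod_cast (ht.trans_lt (h1 n)).le,
    tendsto_of_tendsto_of_tendsto_of_le_of_le tendsto_const_nhds ?_ (fun n => (h1 n).le)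
      fun n => (h2 n).le⟩
  simpa using tendsto_one_div_add_atTop_nhds_zero_nat.const_add t

variable [CompleteSpace K]

theorem exists_limit (h : RatSemigroup T V M ε C) :
    ∃ S : ℝ → K →L[ℂ] K, ∀ (t : ℝ) (r : ℕ → ℚ), 0 ≤ t → (∀ n, 0 ≤ r n) →
      Tendsto (fun n => (r n : ℝ)) atTop (𝓝 t) → ∀ x, Tendsto (fun n => T (r n) x) atTop
        (𝓝 (S t x)) := by
  have key : ∀ t : ℝ, ∃ S : K →L[ℂ] K, 0 ≤ t → ∀ r : ℕ → ℚ, (∀ n, 0 ≤ r n) →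
      Tendsto (fun n => (r n : ℝ)) atTop (𝓝 t) → ∀ x, Tendsto (fun n => T (r n) x) atTop
        (𝓝 (S x)) := by
    intro t
    by_cases ht : 0 ≤ t
    swap
    · exact ⟨0, fun h => absurd h ht⟩
    obtain ⟨r, hr0, hr⟩ := exists_ratSeq ht
    have hlim : ∀ x, ∃ z, Tendsto (fun n => T (r n) x) atTop (𝓝 z) := fun x => by
      refine cauchySeq_tendsto_of_complete (Metric.cauchySeq_iff.2 fun η hη => ?_)
      obtain ⟨δ, hδ, hx⟩ := h.exists_norm_apply_sub_le x (half_pos hη)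
      obtain ⟨N, hN⟩ := Metric.cauchySeq_iff.1 hr.cauchySeq δ hδ
      refine ⟨N, fun m hm n hn => ?_⟩
      rw [dist_eq_norm]
      exact (hx _ _ (hr0 m) (hr0 n) (hN m hm n hn)).trans_lt (half_lt_self hη)
    choose z hz using hlim
    refine ⟨continuousLinearMapOfTendsto (fun n => T (r n)) (tendsto_pi_nhds.2 hz),
      fun _ r' hr0' hr' x => ?_⟩
    have h1 : Tendsto (fun n => T (r' n) x - T (r n) x) atTop (𝓝 0) := by
      rw [Metric.tendsto_atTop]
      intro η hη
      obtain ⟨δ, hδ, hx⟩ := h.exists_norm_apply_sub_le x (half_pos hη)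
      have h2 : Tendsto (fun n => (r' n : ℝ) - r n) atTop (𝓝 0) := by simpa using hr'.sub hr
      obtain ⟨N, hN⟩ := Metric.tendsto_atTop.1 h2 δ hδ
      refine ⟨N, fun n hn => ?_⟩
      have h3 := hN n hn
      rw [Real.dist_0_eq_abs] at h3
      rw [dist_zero_right]
      exact (hx _ _ (hr0' n) (hr0 n) h3).trans_lt (half_lt_self hη)
    have h4 := h1.add (hz x)
    simp only [sub_add_cancel, zero_add] at h4
    exact h4
  choose S hS using key
  exact ⟨S, fun t r ht hr0 hr x => hS t ht r hr0 hr x⟩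

/-- A rational semigroup extends to a `C₀`-semigroup, whose resolvent at `1` is `V`. -/
theorem exists_stableSemigroup (h : RatSemigroup T V M ε C) :
    ∃ (S : ℝ → K →L[ℂ] K) (hS : StableSemigroup S M ε), hS.res 1 zero_le_one = V := by
  obtain ⟨S, hlim⟩ := h.exists_limit
  have hM := zero_lt_one.trans_le h.one_le
  have hrat : ∀ q : ℚ, 0 ≤ q → S q = T q := fun q hq => by
    ext x
    exact tendsto_nhds_unique (hlim q (fun _ => q) (by exact_mod_cast hq) (fun _ => hq)
      tendsto_const_nhds x) tendsto_const_nhds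
  have hb : ∀ t : ℝ, 0 ≤ t → ‖S t‖ ≤ M * Real.exp (-ε * t) := fun t ht => by
    obtain ⟨r, hr0, hr⟩ := exists_ratSeq ht
    refine ContinuousLinearMap.opNorm_le_bound _ (by positivity) fun x => ?_
    refine le_of_tendsto_of_tendsto (hlim t r ht hr0 hr x).norm
      ((((Real.continuous_exp.tendsto _).comp (hr.const_mul (-ε))).const_mul M).mul_const ‖x‖)
      (.of_forall fun n => (T (r n)).le_of_opNorm_le (h.bound _ (hr0 n)) x)
  have hadd : ∀ t u : ℝ, 0 ≤ t → 0 ≤ u → S (t + u) = (S t).comp (S u) := fun t u ht hu => by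
    obtain ⟨r, hr0, hr⟩ := exists_ratSeq ht
    obtain ⟨p, hp0, hp⟩ := exists_ratSeq hu
    ext x
    refine tendsto_nhds_unique (hlim (t + u) (fun n => r n + p n) (add_nonneg ht hu)
      (fun n => add_nonneg (hr0 n) (hp0 n)) (by simpa using hr.add hp) x) ?_
    have h1 := hlim u p hu hp0 hp x
    have h2 : Tendsto (fun n => T (r n) (T (p n) x - S u x)) atTop (𝓝 0) := by
      rw [tendsto_iff_norm_sub_tendsto_zero] at h1
      have h1' := h1.const_mul M
      rw [mul_zero] at h1'
      exact squeeze_zero_norm (fun n => (T (r n)).le_of_opNorm_le (h.norm_le (hr0 n)) _) h1'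
    have h3 := h2.add (hlim t r ht hr0 hr (S u x))
    rw [zero_add] at h3
    refine h3.congr fun n => ?_
    rw [h.add _ _ (hr0 n) (hp0 n), map_sub, sub_add_cancel, mul_apply_eq_comp]
  have hcont : ∀ x, ContinuousOn (fun t => S t x) (Ici 0) := fun x => by
    refine Metric.continuousOn_iff.2 fun t ht η hη => ?_
    obtain ⟨δ, hδ, hx⟩ := h.exists_norm_apply_sub_le x (half_pos hη)
    refine ⟨δ, hδ, fun u hu hut => ?_⟩
    obtain ⟨r, hr0, hr⟩ := exists_ratSeq (mem_Ici.1 ht)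
    obtain ⟨p, hp0, hp⟩ := exists_ratSeq (mem_Ici.1 hu)
    have h1 : ∀ᶠ n in atTop, |(p n : ℝ) - r n| < δ := (hp.sub hr).abs.eventually (gt_mem_nhds hut)
    rw [dist_eq_norm]
    refine (le_of_tendsto ((hlim u p hu hp0 hp x).sub (hlim t r ht hr0 hr x)).norm ?_).trans_lt
      (half_lt_self hη)
    filter_upwards [h1] with n hn using hx _ _ (hp0 n) (hr0 n) hn
  have hS : StableSemigroup S M ε :=
    { c0 := ⟨by simpa [h.zero] using hrat 0 le_rfl, hadd, hcont⟩
      one_le := h.one_le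
      pos := h.pos
      bound := hb }
  refine ⟨S, hS, ?_⟩
  have hgen : ∀ y, HasGen S (V (V y)) (V (V y) - V y) := fun y => by
    have hest : ∀ t : ℝ, 0 < t →
        ‖t⁻¹ • (S t (V (V y)) - V (V y)) - (V (V y) - V y)‖ ≤ C * t * ‖y‖ := by
      intro t ht
      obtain ⟨r, hr0, hr⟩ := exists_ratSeq ht.le
      have h1 : ‖S t (V (V y)) - V (V y) - t • (V (V y) - V y)‖ ≤ C * t ^ 2 * ‖y‖ := by
        refine le_of_tendsto_of_tendsto (((hlim t r ht.le hr0 hr (V (V y))).sub_const _).sub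
          (hr.smul_const _)).norm (((hr.pow 2).const_mul C).mul_const ‖y‖)
          (.of_forall fun n => ?_)
        have := ContinuousLinearMap.le_of_opNorm_le _ (h.sub_sub_le _ (hr0 n)) y
        simp only [sub_apply, mul_apply_eq_comp, smul_apply, one_apply_eq_self] at this
        rw [← Complex.ofReal_ratCast, Complex.coe_smul] at this
        exact this
      have h2 : t⁻¹ • (S t (V (V y)) - V (V y)) - (V (V y) - V y) =
          t⁻¹ • (S t (V (V y)) - V (V y) - t • (V (V y) - V y)) := by
        rw [smul_sub t⁻¹ (S t (V (V y)) - V (V y)), inv_smul_smul₀ ht.ne']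
      rw [h2, norm_smul, norm_inv, Real.norm_of_nonneg ht.le, inv_mul_le_iff₀ ht]
      refine h1.trans (le_of_eq (by ring))
    rw [HasGen, tendsto_iff_norm_sub_tendsto_zero]
    have h0 : Tendsto (fun t : ℝ => C * t * ‖y‖) (𝓝[>] 0) (𝓝 0) := by
      have : Continuous fun t : ℝ => C * t * ‖y‖ := by fun_prop
      have := this.tendsto 0
      simp only [mul_zero, zero_mul] at this
      exact this.mono_left nhdsWithin_le_nhds
    refine tendsto_of_tendsto_of_tendsto_of_le_of_le' tendsto_const_nhds h0
      (.of_forall fun _ => norm_nonneg _) ?_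
    filter_upwards [self_mem_nhdsWithin] with t ht using hest t ht
  refine ContinuousLinearMap.coeFn_injective (Continuous.ext_on h.dense (hS.res 1 _).continuous
    V.continuous ?_)
  rintro _ ⟨y, rfl⟩
  have := (hS.hasGen_iff_res (lam := 1) zero_le_one).1 (hgen y)
  rwa [one_smul, sub_sub_cancel] at this

end RatSemigroup

end RationalExtension

section Fibres

namespace StableSemigroup

variable {K : Type*} [NormedAddCommGroup K] [NormedSpace ℂ K] [CompleteSpace K]
  {T : ℝ → K →L[ℂ] K} {M ε : ℝ}

theorem norm_res_one_sub_le (h : StableSemigroup T M ε) (x : K) :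
    ‖h.res 1 zero_le_one x - x‖ ≤ (‖h.res 1 zero_le_one‖ + 1) * ‖x‖ := by
  refine (norm_sub_le _ _).trans ?_
  rw [add_mul, one_mul]
  gcongr
  exact (h.res 1 zero_le_one).le_opNorm x

theorem norm_sub_one_mul_res_le (h : StableSemigroup T M ε) {t : ℝ} (ht : 0 ≤ t) :
    ‖(T t - 1) * h.res 1 zero_le_one‖ ≤ M * (‖h.res 1 zero_le_one‖ + 1) ^ 2 * t := by
  have hM := h.M_nonneg
  set W := h.res 1 zero_le_one with hW
  refine ContinuousLinearMap.opNorm_le_bound _ (by positivity) fun x => ?_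
  have h1 : HasGen T (W x) (W x - x) := by simpa using h.hasGen_res (lam := 1) zero_le_one x
  have h2 := h.norm_apply_sub_le h1 (c := M * ((‖W‖ + 1) ^ 2 * ‖x‖)) (fun u hu => by
    refine (h.norm_apply_le' hu _).trans ?_
    gcongr
    refine (h.norm_res_one_sub_le x).trans ?_
    gcongr
    nlinarith [norm_nonneg W]) ht
  calc ‖((T t - 1) * W) x‖ = ‖T t (W x) - W x‖ := by simp
    _ ≤ _ := h2
    _ = _ := by ring

theorem norm_sub_one_mul_res_mul_res_le (h : StableSemigroup T M ε) {t : ℝ} (ht : 0 ≤ t) :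
    ‖(T t - 1) * (h.res 1 zero_le_one * h.res 1 zero_le_one) -
      (t : ℂ) • (h.res 1 zero_le_one * h.res 1 zero_le_one - h.res 1 zero_le_one)‖ ≤
      M * (‖h.res 1 zero_le_one‖ + 1) ^ 2 * t ^ 2 := by
  have hM := h.M_nonneg
  set W := h.res 1 zero_le_one with hW
  refine ContinuousLinearMap.opNorm_le_bound _ (by positivity) fun x => ?_
  have h0 : ∀ x, HasGen T (W x) (W x - x) := fun x => by
    simpa using h.hasGen_res (lam := 1) zero_le_one x
  have h1 : HasGen T (W (W x)) (W (W x - x)) := by simpa using h0 (W x)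
  have h2 := h.norm_apply_sub_sub_le h1 (h0 (W x - x)) (c := M * ((‖W‖ + 1) ^ 2 * ‖x‖))
    (fun u hu => by
      refine (h.norm_apply_le' hu _).trans ?_
      gcongr
      refine (h.norm_res_one_sub_le _).trans ?_
      rw [pow_two, mul_assoc]
      gcongr
      exact h.norm_res_one_sub_le x) ht
  calc ‖((T t - 1) * (W * W) - (t : ℂ) • (W * W - W)) x‖
      = ‖T t (W (W x)) - W (W x) - t • W (W x - x)‖ := by simp
    _ ≤ _ := h2
    _ = _ := by ring

theorem denseRange_res (h : StableSemigroup T M ε) {lam : ℂ} (hl : 0 ≤ lam.re) :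
    DenseRange (h.res lam hl) := (h.damp hl).denseRange_potential

theorem continuous_resI_apply (h : StableSemigroup T M ε) (x : K) :
    Continuous fun r => h.resI r x := by
  have h1 := continuous_fourier_of_integrable
    ((integrable_indicator_iff measurableSet_Ioi).2 (h.integrableOn x le_rfl))
  have h2 : (fun r => h.resI r x) = fun r : ℝ =>
      FourierTransform.fourier (indicator (Ioi 0) fun t => T t x) (r / (2 * Real.pi)) := by
    ext r
    rw [h.fourier_orbit, mul_div_cancel₀ _ (by positivity)]
  rw [h2]
  exact h1.comp (by fun_prop)

end StableSemigroup

variable {Ω : Type*} [MeasurableSpace Ω] {μ : Measure Ω}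
  {E : Type*} [NormedAddCommGroup E] [NormedSpace ℂ E] [CompleteSpace E]
  {𝒯 : ℝ → Lp E 2 μ →L[ℂ] Lp E 2 μ} {ℛ : Lp E 2 μ →L[ℂ] Lp E 2 μ} {R : Ω → E →L[ℂ] E} {ν : ℂ}
  {M ε : ℝ}

/-- `R` is the resolvent at `ν` of the generator of `T`. -/
def GenResolvent {K : Type*} [NormedAddCommGroup K] [NormedSpace ℂ K]
    (T : ℝ → K →L[ℂ] K) (ν : ℂ) (R : K →L[ℂ] K) : Prop :=
  ∀ x y, HasGen T x y ↔ R (ν • x - y) = x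

theorem GenResolvent.isLocalOp_res (hG : GenResolvent 𝒯 ν ℛ) (h : StableSemigroup 𝒯 M ε)
    (hℛ : IsLocalOp μ ℛ) {lam : ℂ} (hl : 0 ≤ lam.re) : IsLocalOp μ (h.res lam hl) := by
  intro U hU f g hg
  have hu := (hG _ _).1 (h.hasGen_res hl f)
  set u := h.res lam hl f with hudef
  set u' : Lp E 2 μ := ((Lp.memLp u).indicator hU).toLp with hu'
  have hu'e : u' =ᵐ[μ] U.indicator u := MemLp.coeFn_toLp _
  have h1 : h.res lam hl g = u' := by
    have h2 : HasGen 𝒯 u' (lam • u' - g) := by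
      rw [hG]
      refine Lp.ext ?_
      have h3 := hℛ U hU (ν • u - (lam • u - f)) (ν • u' - (lam • u' - g)) (by
        filter_upwards [hg, hu'e, Lp.coeFn_sub (ν • u) (lam • u - f), Lp.coeFn_sub (lam • u) f,
          Lp.coeFn_smul ν u, Lp.coeFn_smul lam u, Lp.coeFn_sub (ν • u') (lam • u' - g),
          Lp.coeFn_sub (lam • u') g, Lp.coeFn_smul ν u', Lp.coeFn_smul lam u']
          with s e1 e2 e3 e4 e5 e6 e7 e8 e9 e10
        rw [e7, Pi.sub_apply, e8, Pi.sub_apply, e9, e10, Pi.smul_apply, Pi.smul_apply, e1, e2]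
        by_cases hs : s ∈ U
        · rw [indicator_of_mem hs, indicator_of_mem hs, indicator_of_mem hs, e3, Pi.sub_apply, e4,
            Pi.sub_apply, e5, e6, Pi.smul_apply, Pi.smul_apply]
        · simp [hs])
      filter_upwards [h3, hu'e] with s e1 e2
      rw [e1, hu, e2]
    have := (h.hasGen_iff_res hl).1 h2
    rwa [sub_sub_cancel] at this
  rw [h1]
  exact hu'e

theorem GenResolvent.isLocalOp (hG : GenResolvent 𝒯 ν ℛ) (h : StableSemigroup 𝒯 M ε)
    (hℛ : IsLocalOp μ ℛ) {t : ℝ} (ht : 0 ≤ t) : IsLocalOp μ (𝒯 t) := by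
  rcases ht.eq_or_lt with rfl | ht
  · rw [h.c0.1]
    exact IsLocalOp.one
  · exact IsLocalOp.of_tendsto
      (fun n => ((hG.isLocalOp_res h hℛ _).smul _).pow _) fun f => h.tendsto_euler_pow ht f

/-- Two-sided form of the resolvent equation. -/
theorem genResolvent_iff_of_res {K : Type*} [NormedAddCommGroup K] [NormedSpace ℂ K]
    [CompleteSpace K] {T : ℝ → K →L[ℂ] K} (h : StableSemigroup T M ε) {R : K →L[ℂ] K} :
    GenResolvent T ν R ↔
      R * (ν • h.res 1 zero_le_one - h.res 1 zero_le_one + 1) = h.res 1 zero_le_one ∧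
      h.res 1 zero_le_one * (R - ν • R + 1) = R := by
  set W := h.res 1 zero_le_one with hW
  have hgen : ∀ x y, HasGen T x y ↔ W (x - y) = x := fun x y => by
    simpa using h.hasGen_iff_res (lam := 1) zero_le_one (x := x) (y := y)
  constructor
  · intro hG
    constructor
    · ext x
      have := (hG (W x) (W x - x)).1 (by rw [hgen]; simp)
      rw [mul_apply_eq_comp]
      convert this using 2
      simp [sub_add]
    · ext x
      have := (hgen (R x) (ν • R x - x)).1 (by rw [hG]; simp)
      rw [mul_apply_eq_comp]
      convert this using 2
      simp [sub_add]
  · rintro ⟨h1, h2⟩ x y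
    rw [hgen]
    constructor
    · intro e
      have := congrArg (fun A : K →L[ℂ] K => A (x - y)) h1
      simp only [mul_apply_eq_comp, add_apply, sub_apply, smul_apply, one_apply_eq_self, e] at this
      rw [← this]
      congr 1
      rw [this]
      abel
    · intro e
      have := congrArg (fun A : K →L[ℂ] K => A (ν • x - y)) h2
      simp only [mul_apply_eq_comp, add_apply, sub_apply, smul_apply, one_apply_eq_self, e] at this
      rw [← this]
      congr 1
      rw [this]
      abel

variable [SigmaFinite μ] [TopologicalSpace.SeparableSpace E]

theorem GenResolvent.ae_exists_stableSemigroup (hG : GenResolvent 𝒯 ν ℛ)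
    (h : StableSemigroup 𝒯 M ε) (hℛ : Decomposes μ ℛ R) :
    ∀ᵐ s ∂μ, ∃ S : ℝ → E →L[ℂ] E, StableSemigroup S M ε ∧ GenResolvent S ν (R s) := by
  obtain ⟨V, hV⟩ := (hG.isLocalOp_res h hℛ.isLocalOp (lam := 1) zero_le_one).exists_decomposes
  have hex : ∀ q : ℚ, ∃ S : Ω → E →L[ℂ] E, 0 ≤ q → Decomposes μ (𝒯 q) S := fun q => by
    by_cases hq : 0 ≤ q
    · obtain ⟨S, hS⟩ :=
        (hG.isLocalOp h hℛ.isLocalOp (t := q) (by exact_mod_cast hq)).exists_decomposes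
      exact ⟨S, fun _ => hS⟩
    · exact ⟨fun _ => 1, fun h => absurd h hq⟩
  choose T hT using hex
  have hcast : ∀ {q : ℚ}, 0 ≤ q → (0 : ℝ) ≤ q := fun hq => by exact_mod_cast hq
  set W := h.res 1 zero_le_one with hW
  set C := M * (‖W‖ + 1) ^ 2 with hC
  have a0 : ∀ᵐ s ∂μ, T 0 s = 1 :=
    (hT 0 le_rfl).ae_eq (by rw [Rat.cast_zero, h.c0.1]; exact Decomposes.one)
  have a1 : ∀ᵐ s ∂μ, ∀ p q : ℚ, 0 ≤ p → 0 ≤ q → T (p + q) s = T p s * T q s := by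
    simp only [ae_all_iff]
    intro p q hp hq
    refine (hT _ (add_nonneg hp hq)).ae_eq ?_
    rw [Rat.cast_add, h.c0.2.1 _ _ (hcast hp) (hcast hq)]
    exact (hT p hp).mul (hT q hq)
  have a2 : ∀ᵐ s ∂μ, ∀ q : ℚ, 0 ≤ q → ‖T q s‖ ≤ M * Real.exp (-ε * q) := by
    simp only [ae_all_iff]
    intro q hq
    filter_upwards [(hT q hq).ae_norm_le] with s hs using hs.trans (h.bound q (hcast hq))
  have a3 : ∀ᵐ s ∂μ, ∀ q : ℚ, 0 ≤ q → ‖(T q s - 1) * V s‖ ≤ C * q := by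
    simp only [ae_all_iff]
    intro q hq
    filter_upwards [(((hT q hq).sub Decomposes.one).mul hV).ae_norm_le] with s hs
      using hs.trans (h.norm_sub_one_mul_res_le (hcast hq))
  have a4 : ∀ᵐ s ∂μ, ∀ q : ℚ, 0 ≤ q →
      ‖(T q s - 1) * (V s * V s) - (q : ℂ) • (V s * V s - V s)‖ ≤ C * (q : ℝ) ^ 2 := by
    simp only [ae_all_iff]
    intro q hq
    filter_upwards [((((hT q hq).sub Decomposes.one).mul (hV.mul hV)).sub
      (((hV.mul hV).sub hV).smul (q : ℂ))).ae_norm_le] with s hs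
    refine hs.trans ?_
    have := h.norm_sub_one_mul_res_mul_res_le (hcast hq)
    rwa [Complex.ofReal_ratCast] at this
  have a5 := hV.ae_denseRange (h.denseRange_res zero_le_one)
  obtain ⟨e1, e2⟩ := (genResolvent_iff_of_res h).1 hG
  have a6 : ∀ᵐ s ∂μ, R s * (ν • V s - V s + 1) = V s :=
    (hℛ.mul (((hV.smul ν).sub hV).add Decomposes.one)).ae_eq (by rw [e1]; exact hV)
  have a7 : ∀ᵐ s ∂μ, V s * (R s - ν • R s + 1) = R s :=
    (hV.mul ((hℛ.sub (hℛ.smul ν)).add Decomposes.one)).ae_eq (by rw [e2]; exact hℛ)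
  filter_upwards [a0, a1, a2, a3, a4, a5, a6, a7] with s b0 b1 b2 b3 b4 b5 b6 b7
  have hM := h.M_nonneg
  obtain ⟨S, hS, hSV⟩ := RatSemigroup.exists_stableSemigroup (T := fun q => T q s) (V := V s)
    (M := M) (ε := ε) (C := C) ⟨b0, b1, h.one_le, h.pos, by positivity, b2, b5, b3, b4⟩
  exact ⟨S, hS, (genResolvent_iff_of_res hS).2 (by rw [hSV]; exact ⟨b6, b7⟩)⟩

/-- Decay of the resolvent along the imaginary axis passes to the fibres. -/
theorem GenResolvent.ae_norm_resI_le (hG : GenResolvent 𝒯 ν ℛ)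
    (h : StableSemigroup 𝒯 M ε) (hℛ : Decomposes μ ℛ R) {ρ η : ℝ}
    (hρ : ∀ r : ℝ, ρ ≤ |r| → ‖h.resI r‖ ≤ η) :
    ∀ᵐ s ∂μ, ∀ (S : ℝ → E →L[ℂ] E) (hS : StableSemigroup S M ε), GenResolvent S ν (R s) →
      ∀ r : ℝ, ρ ≤ |r| → ‖hS.resI r‖ ≤ η := by
  have hex : ∀ q : ℚ, ∃ G : Ω → E →L[ℂ] E, Decomposes μ (h.resI q) G := fun q =>
    (hG.isLocalOp_res h hℛ.isLocalOp _).exists_decomposes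
  choose G hdec using hex
  have a1 : ∀ᵐ s ∂μ, ∀ q : ℚ, ρ ≤ |(q : ℝ)| → ‖G q s‖ ≤ η := by
    simp only [ae_all_iff]
    intro q hq
    filter_upwards [(hdec q).ae_norm_le] with s hs using hs.trans (hρ q hq)
  have a2 : ∀ᵐ s ∂μ, ∀ q : ℚ,
      R s * (ν • G q s - (((q : ℝ) : ℂ) * Complex.I) • G q s + 1) = G q s := by
    simp only [ae_all_iff]
    intro q
    refine (hℛ.mul ((((hdec q).smul ν).sub ((hdec q).smul _)).add Decomposes.one)).ae_eq ?_
    convert hdec q using 1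
    ext1 f
    have := (hG _ _).1 (h.hasGen_res (lam := ((q : ℝ) : ℂ) * Complex.I) (by simp) f)
    rw [mul_apply_eq_comp]
    refine (congrArg ℛ ?_).trans this
    simp [StableSemigroup.resI, sub_add]
  filter_upwards [a1, a2] with s b1 b2 S hS hGS r hr
  have hq : ∀ q : ℚ, ρ ≤ |(q : ℝ)| → ‖hS.resI q‖ ≤ η := by
    intro q hq
    convert b1 q hq using 2
    ext1 x
    have h1 : HasGen S (G q s x) ((((q : ℝ) : ℂ) * Complex.I) • G q s x - x) := by
      rw [hGS]
      conv_rhs => rw [← b2 q]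
      rw [mul_apply_eq_comp]
      congr 1
      simp [sub_add]
    have h2 := (hS.hasGen_iff_res (lam := ((q : ℝ) : ℂ) * Complex.I) (by simp)).1 h1
    rwa [sub_sub_cancel] at h2
  have hη : 0 ≤ η := (norm_nonneg _).trans (hρ _ hr)
  refine ContinuousLinearMap.opNorm_le_bound _ hη fun x => ?_
  have hseq : ∃ u : ℕ → ℚ, (∀ n, ρ ≤ |(u n : ℝ)|) ∧ Tendsto (fun n => (u n : ℝ)) atTop (𝓝 r) := by
    rcases le_total 0 r with h0 | h0
    · obtain ⟨u, -, hu, hlim⟩ := Real.exists_seq_rat_strictAnti_tendsto r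
      refine ⟨u, fun n => hr.trans ?_, hlim⟩
      rw [abs_of_nonneg h0, abs_of_nonneg (h0.trans (hu n).le)]
      exact (hu n).le
    · obtain ⟨u, -, hu, hlim⟩ := Real.exists_seq_rat_strictMono_tendsto r
      refine ⟨u, fun n => hr.trans ?_, hlim⟩
      rw [abs_of_nonpos h0, abs_of_nonpos ((hu n).le.trans h0)]
      exact neg_le_neg (hu n).le
  obtain ⟨u, hu, hlim⟩ := hseq
  refine le_of_tendsto (((hS.continuous_resI_apply x).tendsto r).comp hlim).norm
    (.of_forall fun n => ?_)
  exact (hS.resI _).le_of_opNorm_le (hq _ (hu n)) x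

end Fibres

section DirectIntegral

variable {Ω : Type*} [MeasurableSpace Ω] {μ : Measure Ω}
  {E : Type*} [NormedAddCommGroup E]

/-- Dominated convergence in `L²`. -/
theorem tendsto_Lp_two_of_dominated [NormedSpace ℂ E] {F : ℕ → Lp E 2 μ} {G b : Lp E 2 μ}
    (hb : ∀ᶠ n in atTop, ∀ᵐ s ∂μ, ‖F n s‖ ≤ ‖b s‖)
    (hlim : ∀ᵐ s ∂μ, Tendsto (fun n => F n s) atTop (𝓝 (G s))) : Tendsto F atTop (𝓝 G) := by
  rw [Lp.tendsto_Lp_iff_tendsto_eLpNorm']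
  have hG : ∀ᵐ s ∂μ, ‖G s‖ ≤ ‖b s‖ := by
    obtain ⟨N, hN⟩ := eventually_atTop.1 hb
    have hb' : ∀ᵐ s ∂μ, ∀ n, N ≤ n → ‖F n s‖ ≤ ‖b s‖ := by
      simpa only [ae_all_iff] using hN
    filter_upwards [hb', hlim] with s h1 h2
    exact le_of_tendsto h2.norm (eventually_atTop.2 ⟨N, h1⟩)
  have key : Tendsto (fun n => ∫⁻ s, ‖(⇑(F n) - ⇑G) s‖ₑ ^ (2 : ℝ) ∂μ) atTop
      (𝓝 (∫⁻ _, 0 ∂μ)) := by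
    refine tendsto_lintegral_filter_of_dominated_convergence
      (fun s => ‖((2 : ℂ) • ⇑b) s‖ₑ ^ (2 : ℝ)) (.of_forall fun n => ?_) ?_ ?_ ?_
    · exact ((Lp.stronglyMeasurable (F n)).sub (Lp.stronglyMeasurable G)).enorm.pow_const _
    · filter_upwards [hb] with n hn
      filter_upwards [hn, hG] with s h1 h2
      refine ENNReal.rpow_le_rpow ?_ (by norm_num)
      refine enorm_le_iff_norm_le.2 ?_
      rw [Pi.smul_apply, norm_smul, Complex.norm_ofNat, Pi.sub_apply]
      exact (norm_sub_le _ _).trans (by linarith)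
    · have := ((Lp.memLp b).const_smul (2 : ℂ)).2
      exact (lintegral_rpow_enorm_lt_top_of_eLpNorm_lt_top (p := 2) (by norm_num) (by norm_num)
        this).ne
    · filter_upwards [hlim] with s hs
      have h1 : Tendsto (fun n => ‖(⇑(F n) - ⇑G) s‖ₑ) atTop (𝓝 0) := by
        have := (hs.sub_const (G s)).enorm
        simpa using this
      have := (ENNReal.continuous_rpow_const (y := 2)).tendsto 0 |>.comp h1
      simpa [Function.comp_def] using this
  simp only [lintegral_zero] at key
  have := (ENNReal.continuous_rpow_const (y := 1 / 2)).tendsto 0 |>.comp key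
  simp only [eLpNorm_eq_lintegral_rpow_enorm_toReal (p := 2) (by norm_num) (by norm_num)]
  simpa [Function.comp_def] using this

variable [NormedSpace ℂ E]

open TopologicalSpace (denseSeq denseRange_denseSeq) in
/-- The pointwise inverse of a strongly measurable operator function is strongly measurable. -/
theorem aestronglyMeasurable_inverse_apply [TopologicalSpace.SeparableSpace E]
    {F G : Ω → E →L[ℂ] E} (hF : ∀ x, StronglyMeasurable fun s => F s x)
    (hFG : ∀ᵐ s ∂μ, F s * G s = 1) (hGF : ∀ᵐ s ∂μ, G s * F s = 1) (y : E) :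
    AEStronglyMeasurable (fun s => G s y) μ := by
  classical
  set d := denseSeq E
  let p : ℕ → Ω → ℕ → Prop := fun k s n =>
    ‖F s (d n) - y‖ < 1 / ((k : ℝ) + 1) ∨ ∀ m, ¬ ‖F s (d m) - y‖ < 1 / ((k : ℝ) + 1)
  have hp : ∀ k s, ∃ n, p k s n := fun k s => by
    by_cases h : ∃ m, ‖F s (d m) - y‖ < 1 / ((k : ℝ) + 1)
    · exact h.imp fun m hm => Or.inl hm
    · exact ⟨0, Or.inr (not_exists.1 h)⟩
  have hm : ∀ k n, MeasurableSet {s | ‖F s (d n) - y‖ < 1 / ((k : ℝ) + 1)} := fun k n =>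
    measurableSet_lt ((hF _).sub stronglyMeasurable_const).norm.measurable measurable_const
  have hm' : ∀ k : ℕ, MeasurableSet {s | ∀ m, ¬ ‖F s (d m) - y‖ < 1 / ((k : ℝ) + 1)} := fun k => by
    have e : {s | ∀ m, ¬ ‖F s (d m) - y‖ < 1 / ((k : ℝ) + 1)} =
        ⋂ m, {s | ‖F s (d m) - y‖ < 1 / ((k : ℝ) + 1)}ᶜ := by ext; simp
    rw [e]
    exact MeasurableSet.iInter fun m => (hm k m).compl
  have hN : ∀ k, Measurable fun s => Nat.find (hp k s) := fun k =>
    measurable_find (hp k) fun n =>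
      (hm k n).union (hm' k)
  have hd : ∀ k, AEStronglyMeasurable (fun s => d (Nat.find (hp k s))) μ := fun k =>
    ((StronglyMeasurable.of_discrete (f := d)).comp_measurable (hN k)).aestronglyMeasurable
  refine aestronglyMeasurable_of_tendsto_ae atTop hd ?_
  filter_upwards [hFG, hGF] with s h1 h2
  have happ1 : F s (G s y) = y := by simpa using congrArg (fun A : E →L[ℂ] E => A y) h1
  have happ2 : ∀ x, G s (F s x) = x := fun x => by
    simpa using congrArg (fun A : E →L[ℂ] E => A x) h2
  have hlt : ∀ k : ℕ, ‖F s (d (Nat.find (hp k s))) - y‖ < 1 / ((k : ℝ) + 1) := fun k => by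
    rcases Nat.find_spec (hp k s) with h | h
    · exact h
    · exfalso
      have hc : ContinuousAt (fun x => ‖F s x - y‖) (G s y) := by fun_prop
      have hpos : (0 : ℝ) < 1 / ((k : ℝ) + 1) := by positivity
      have hev : ∀ᶠ x in 𝓝 (G s y), ‖F s x - y‖ < 1 / ((k : ℝ) + 1) :=
        hc.eventually_lt_const (by simpa [happ1] using hpos)
      obtain ⟨m, hm⟩ := (denseRange_denseSeq E).exists_mem_open isOpen_interior
        ⟨_, mem_interior_iff_mem_nhds.2 hev⟩
      have hm' := interior_subset hm
      exact h m hm'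
  have hlim : Tendsto (fun k => F s (d (Nat.find (hp k s)))) atTop (𝓝 y) :=
    tendsto_iff_norm_sub_tendsto_zero.2 (squeeze_zero (fun _ => norm_nonneg _)
      (fun k => (hlt k).le) tendsto_one_div_add_atTop_nhds_zero_nat)
  exact (((G s).continuous.tendsto y).comp hlim).congr fun k => happ2 _

end DirectIntegral

section ReverseDirection

section

variable {K : Type*} [NormedAddCommGroup K] [NormedSpace ℂ K] {T : ℝ → K →L[ℂ] K}
  {ν lam : ℂ} {R W : K →L[ℂ] K}

/-- The resolvent identity. -/
theorem GenResolvent.mul_eq (hR : GenResolvent T ν R) (hW : GenResolvent T lam W) :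
    R * (1 + (ν - lam) • W) = W := by
  ext x
  have := (hR (W x) (lam • W x - x)).1 (by rw [hW, sub_sub_cancel])
  rw [mul_apply_eq_comp]
  refine (congrArg R ?_).trans this
  simp [sub_smul]
  abel

theorem GenResolvent.inverse (hR : GenResolvent T ν R) (hW : GenResolvent T lam W) :
    (1 + (lam - ν) • R) * (1 + (ν - lam) • W) = 1 := by
  rw [add_mul, one_mul, smul_mul_assoc, hR.mul_eq hW, add_assoc, ← add_smul]
  simp

theorem StableSemigroup.genResolvent_res [CompleteSpace K] {M ε : ℝ} (h : StableSemigroup T M ε)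
    (hl : 0 ≤ lam.re) : GenResolvent T lam (h.res lam hl) := fun _ _ => h.hasGen_iff_res hl

end

variable {Ω : Type*} [MeasurableSpace Ω] {μ : Measure Ω}
  {E : Type*} [NormedAddCommGroup E] [NormedSpace ℂ E] [CompleteSpace E]
  {T : Ω → ℝ → E →L[ℂ] E} {ℛ : Lp E 2 μ →L[ℂ] Lp E 2 μ} {R : Ω → E →L[ℂ] E} {ν : ℂ} {M ε : ℝ}

open Classical in
/-- The resolvents of the generators of a family of semigroups. -/
def fibreRes (T : Ω → ℝ → E →L[ℂ] E) (M ε : ℝ) (lam : ℂ) (hl : 0 ≤ lam.re) (s : Ω) : E →L[ℂ] E :=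
  if h : StableSemigroup (T s) M ε then h.res lam hl else 0

theorem fibreRes_eq {s : Ω} (h : StableSemigroup (T s) M ε) {lam : ℂ} (hl : 0 ≤ lam.re) :
    fibreRes T M ε lam hl s = h.res lam hl := dif_pos h

theorem aestronglyMeasurable_pow_apply {S : Ω → E →L[ℂ] E}
    (hS : ∀ x, AEStronglyMeasurable (fun s => S s x) μ) (n : ℕ) (x : E) :
    AEStronglyMeasurable (fun s => (S s ^ n) x) μ := by
  induction n with
  | zero => simpa using aestronglyMeasurable_const
  | succ n ih =>
    simp only [pow_succ', mul_apply_eq_comp]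
    exact aestronglyMeasurable_apply hS ih

variable [TopologicalSpace.SeparableSpace E]

theorem aestronglyMeasurable_fibreRes (hR : ∀ x, StronglyMeasurable fun s => R s x)
    (hT : ∀ᵐ s ∂μ, StableSemigroup (T s) M ε) (hG : ∀ᵐ s ∂μ, GenResolvent (T s) ν (R s))
    {lam : ℂ} (hl : 0 ≤ lam.re) (x : E) :
    AEStronglyMeasurable (fun s => fibreRes T M ε lam hl s x) μ := by
  have hG' : ∀ᵐ s ∂μ, GenResolvent (T s) lam (fibreRes T M ε lam hl s) := by
    filter_upwards [hT] with s hs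
    rw [fibreRes_eq hs]
    exact hs.genResolvent_res hl
  have h1 : AEStronglyMeasurable (fun s => (1 + (ν - lam) • fibreRes T M ε lam hl s) x) μ := by
    refine aestronglyMeasurable_inverse_apply (F := fun s => 1 + (lam - ν) • R s) (fun y => ?_)
      ?_ ?_ x
    · simp only [add_apply, smul_apply, one_apply_eq_self]
      exact stronglyMeasurable_const.add ((hR y).const_smul _)
    · filter_upwards [hG, hG'] with s b1 b2 using b1.inverse b2
    · filter_upwards [hG, hG'] with s b1 b2 using b2.inverse b1
  refine (aestronglyMeasurable_apply (fun y => (hR y).aestronglyMeasurable) h1).congr ?_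
  filter_upwards [hG, hG'] with s b1 b2
  rw [← mul_apply_eq_comp, b1.mul_eq b2]

theorem aestronglyMeasurable_semigroup_apply (hR : ∀ x, StronglyMeasurable fun s => R s x)
    (hT : ∀ᵐ s ∂μ, StableSemigroup (T s) M ε) (hG : ∀ᵐ s ∂μ, GenResolvent (T s) ν (R s))
    {t : ℝ} (ht : 0 ≤ t) (x : E) : AEStronglyMeasurable (fun s => T s t x) μ := by
  rcases ht.eq_or_lt with rfl | ht
  · refine (aestronglyMeasurable_const (b := x)).congr ?_
    filter_upwards [hT] with s hs
    rw [hs.c0.1, one_apply_eq_self]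
  have hpos : ∀ n : ℕ, 0 ≤ ((((t / (n + 1 : ℕ))⁻¹ : ℝ)) : ℂ).re := fun n => by
    rw [Complex.ofReal_re]
    positivity
  refine aestronglyMeasurable_of_tendsto_ae atTop (f := fun (n : ℕ) s =>
    ((((((t / (n + 1 : ℕ))⁻¹ : ℝ)) : ℂ) • fibreRes T M ε _ (hpos n) s) ^ (n + 1)) x)
    (fun n => aestronglyMeasurable_pow_apply (fun y =>
      (aestronglyMeasurable_fibreRes hR hT hG (hpos n) y).const_smul _) _ x) ?_
  filter_upwards [hT] with s hs
  simp only [fibreRes_eq hs]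
  exact hs.tendsto_euler_pow ht x

theorem exists_directIntegral (hε : 0 < ε) (hM : 1 ≤ M)
    (hR : ∀ x, StronglyMeasurable fun s => R s x) (hℛ : Decomposes μ ℛ R)
    (hT : ∀ᵐ s ∂μ, StableSemigroup (T s) M ε) (hG : ∀ᵐ s ∂μ, GenResolvent (T s) ν (R s)) :
    ∃ 𝒯 : ℝ → Lp E 2 μ →L[ℂ] Lp E 2 μ, StableSemigroup 𝒯 M ε ∧ GenResolvent 𝒯 ν ℛ := by
  have hM0 : 0 ≤ M := zero_le_one.trans hM
  have hex : ∀ t : ℝ, ∃ S : Lp E 2 μ →L[ℂ] Lp E 2 μ, 0 ≤ t → Decomposes μ S (fun s => T s t) ∧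
      ‖S‖ ≤ M * Real.exp (-ε * t) := fun t => by
    by_cases ht : 0 ≤ t
    · obtain ⟨S, hS⟩ := exists_decomposes (S := fun s => T s t)
        (C := M * Real.exp (-ε * t))
        (aestronglyMeasurable_semigroup_apply hR hT hG ht) (by positivity)
        (by filter_upwards [hT] with s hs using hs.bound t ht)
      exact ⟨S, fun _ => hS⟩
    · exact ⟨0, fun h => absurd h ht⟩
  choose 𝒯 h𝒯 using hex
  have hseq : ∀ (u : ℕ → ℝ) (f : Lp E 2 μ), ∀ᵐ s ∂μ, ∀ n, 0 ≤ u n → 𝒯 (u n) f s = T s (u n) (f s) := by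
    intro u f
    simp only [ae_all_iff]
    exact fun n hn => (h𝒯 _ hn).1 f
  have hst : StableSemigroup 𝒯 M ε := by
    refine ⟨⟨?_, fun t u ht hu => ?_, fun f => ?_⟩, hM, hε, fun t ht => (h𝒯 t ht).2⟩
    · refine (h𝒯 0 le_rfl).1.eq_of_ae_eq Decomposes.one ?_
      filter_upwards [hT] with s hs using hs.c0.1
    · refine (h𝒯 _ (add_nonneg ht hu)).1.eq_of_ae_eq ((h𝒯 t ht).1.mul (h𝒯 u hu).1) ?_
      filter_upwards [hT] with s hs using hs.c0.2.1 t u ht hu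
    · intro t ht
      refine tendsto_of_seq_tendsto fun u hu => ?_
      obtain ⟨hu1, hu2⟩ := tendsto_nhdsWithin_iff.1 hu
      refine tendsto_Lp_two_of_dominated (b := (M : ℂ) • f) ?_ ?_
      · filter_upwards [hu2] with n hn
        filter_upwards [hT, (h𝒯 _ hn).1 f, Lp.coeFn_smul (M : ℂ) f] with s b1 b2 b3
        rw [Function.comp_apply, b2, b3, Pi.smul_apply, norm_smul, Complex.norm_real,
          Real.norm_of_nonneg hM0]
        exact b1.norm_apply_le' hn _
      · filter_upwards [hT, hseq u f, (h𝒯 t ht).1 f] with s b1 b2 b3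
        rw [b3]
        refine ((b1.c0.2.2 (f s) t ht).tendsto.comp hu).congr' ?_
        filter_upwards [hu2] with n hn
        exact (b2 n hn).symm
  refine ⟨𝒯, hst, ?_⟩
  obtain ⟨𝒱, h𝒱, -⟩ := exists_decomposes (μ := μ) (C := M / ε)
    (aestronglyMeasurable_fibreRes hR hT hG (lam := 1) zero_le_one) (by positivity)
    (by
      filter_upwards [hT] with s hs
      rw [fibreRes_eq hs]
      exact hs.norm_res_le _)
  have hgen : ∀ f : Lp E 2 μ, HasGen 𝒯 (𝒱 f) (𝒱 f - f) := by
    intro f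
    have hfib : ∀ᵐ s ∂μ, StableSemigroup (T s) M ε ∧ HasGen (T s) (𝒱 f s) ((𝒱 f - f) s) := by
      filter_upwards [hT, h𝒱 f, Lp.coeFn_sub (𝒱 f) f] with s b1 b2 b3
      refine ⟨b1, ?_⟩
      rw [b3, Pi.sub_apply, b2, fibreRes_eq b1]
      simpa using b1.hasGen_res (lam := 1) zero_le_one (f s)
    have hval : ∀ t, 0 ≤ t → ∀ᵐ s ∂μ, (((t⁻¹ : ℝ) : ℂ) • (𝒯 t (𝒱 f) - 𝒱 f)) s =
        t⁻¹ • (T s t (𝒱 f s) - 𝒱 f s) := by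
      intro t ht
      filter_upwards [(h𝒯 t ht).1 (𝒱 f), Lp.coeFn_sub (𝒯 t (𝒱 f)) (𝒱 f),
        Lp.coeFn_smul ((t⁻¹ : ℝ) : ℂ) (𝒯 t (𝒱 f) - 𝒱 f)] with s b1 b2 b3
      rw [b3, Pi.smul_apply, b2, Pi.sub_apply, b1, Complex.coe_smul]
    unfold HasGen
    simp only [← Complex.coe_smul (E := Lp E 2 μ)]
    refine tendsto_of_seq_tendsto fun u hu => ?_
    obtain ⟨hu1, hu2⟩ := tendsto_nhdsWithin_iff.1 hu
    refine tendsto_Lp_two_of_dominated (b := (M : ℂ) • (𝒱 f - f)) ?_ ?_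
    · filter_upwards [hu2] with n hn
      filter_upwards [hfib, hval _ (le_of_lt hn), Lp.coeFn_smul (M : ℂ) (𝒱 f - f)] with s b1 b2 b3
      have hn' : 0 < u n := hn
      rw [Function.comp_apply, b2, b3, Pi.smul_apply, norm_smul, norm_smul, Complex.norm_real,
        Real.norm_of_nonneg hM0, Real.norm_of_nonneg (inv_pos.2 hn').le, inv_mul_le_iff₀ hn',
        mul_comm (u n)]
      exact b1.1.norm_apply_sub_le b1.2 (fun t ht => b1.1.norm_apply_le' ht _) hn'.le
    · have hval' : ∀ᵐ s ∂μ, ∀ n, 0 ≤ u n → ((((u n)⁻¹ : ℝ) : ℂ) • (𝒯 (u n) (𝒱 f) - 𝒱 f)) s =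
          (u n)⁻¹ • (T s (u n) (𝒱 f s) - 𝒱 f s) := by
        simp only [ae_all_iff]
        exact fun n hn => hval _ hn
      filter_upwards [hfib, hval'] with s b1 b2
      refine (b1.2.comp hu).congr' ?_
      filter_upwards [hu2] with n hn
      exact (b2 n (le_of_lt hn)).symm
  have hW : hst.res 1 zero_le_one = 𝒱 := by
    ext1 f
    have := (hst.hasGen_iff_res (lam := 1) zero_le_one).1 (hgen f)
    rwa [one_smul, sub_sub_cancel] at this
  rw [genResolvent_iff_of_res hst, hW]
  have hfib : ∀ᵐ s ∂μ, R s * (ν • fibreRes T M ε 1 zero_le_one s -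
      fibreRes T M ε 1 zero_le_one s + 1) = fibreRes T M ε 1 zero_le_one s ∧
      fibreRes T M ε 1 zero_le_one s * (R s - ν • R s + 1) = R s := by
    filter_upwards [hT, hG] with s b1 b2
    have := (genResolvent_iff_of_res b1).1 b2
    rwa [← fibreRes_eq b1] at this
  constructor
  · refine (hℛ.mul (((h𝒱.smul ν).sub h𝒱).add Decomposes.one)).eq_of_ae_eq h𝒱 ?_
    filter_upwards [hfib] with s hs using hs.1
  · refine (h𝒱.mul ((hℛ.sub (hℛ.smul ν)).add Decomposes.one)).eq_of_ae_eq hℛ ?_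
    filter_upwards [hfib] with s hs using hs.2

theorem GenResolvent.norm_resI_le {𝒯 : ℝ → Lp E 2 μ →L[ℂ] Lp E 2 μ} (hG : GenResolvent 𝒯 ν ℛ)
    (h : StableSemigroup 𝒯 M ε) (hℛ : Decomposes μ ℛ R) {r η : ℝ} (hη : 0 ≤ η)
    (hfib : ∀ᵐ s ∂μ, ∃ Rs : E →L[ℂ] E, ‖Rs‖ ≤ η ∧
      ∀ x y, R s (ν • x - y) = x → Rs (((r : ℂ) * Complex.I) • x - y) = x) : ‖h.resI r‖ ≤ η := by
  refine ContinuousLinearMap.opNorm_le_bound _ hη fun f => ?_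
  refine Lp.norm_le_mul_norm_of_ae_le_mul ?_
  have hl : 0 ≤ ((r : ℂ) * Complex.I).re := by simp
  have h1 := (hG _ _).1 (h.hasGen_res hl f)
  change ℛ (ν • h.resI r f - (((r : ℂ) * Complex.I) • h.resI r f - f)) = h.resI r f at h1
  set u := h.resI r f
  set lam := (r : ℂ) * Complex.I
  have h2 := hℛ (ν • u - (lam • u - f))
  rw [h1] at h2
  filter_upwards [hfib, h2, Lp.coeFn_sub (ν • u) (lam • u - f), Lp.coeFn_sub (lam • u) f,
    Lp.coeFn_smul ν u, Lp.coeFn_smul lam u] with s b1 b2 b3 b4 b5 b6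
  obtain ⟨Rs, hRs, hval⟩ := b1
  rw [b3, Pi.sub_apply, b4, Pi.sub_apply, b5, b6, Pi.smul_apply, Pi.smul_apply] at b2
  have := hval _ _ b2.symm
  rw [sub_sub_cancel] at this
  rw [← this]
  exact Rs.le_of_opNorm_le hRs _

end ReverseDirection

section Main

section

variable {K : Type*} [NormedAddCommGroup K] [NormedSpace ℂ K] {T : ℝ → K →L[ℂ] K}
  {B : K →ₗ.[ℂ] K} {ν : ℂ} {R : K →L[ℂ] K}

theorem IsGenerator.resolventAt_iff (h : IsGenerator T B) :
    ResolventAt B ν R ↔ GenResolvent T ν R := by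
  rw [isGenerator_iff] at h
  rw [_root_.resolventAt_iff]
  simp only [h, GenResolvent]

theorem GenResolvent.isGenerator (h : GenResolvent T ν R) (hB : ResolventAt B ν R) :
    IsGenerator T B := by
  rw [isGenerator_iff]
  rw [resolventAt_iff] at hB
  exact fun x y => (hB x y).trans (h x y).symm

end

theorem resolventAt_of_decomposes {Ω : Type*} [MeasurableSpace Ω] {μ : Measure Ω}
    {E : Type*} [NormedAddCommGroup E] [NormedSpace ℂ E] {ν : ℂ} {R : Ω → E →L[ℂ] E}
    {ℛ : Lp E 2 μ →L[ℂ] Lp E 2 μ} (hℛ : Decomposes μ ℛ R) {As : Ω → E →ₗ.[ℂ] E}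
    (hres : ∀ᵐ s ∂μ, ResolventAt (As s) ν (R s)) {𝒜 : Lp E 2 μ →ₗ.[ℂ] Lp E 2 μ}
    (hdom : ∀ x : Lp E 2 μ,
      x ∈ 𝒜.domain ↔ ∃ g : Lp E 2 μ, ∀ᵐ s ∂μ, (x s, g s) ∈ (As s).graph)
    (hval : ∀ x : 𝒜.domain, ∀ᵐ s ∂μ, ((x : Lp E 2 μ) s, (𝒜 x) s) ∈ (As s).graph) :
    ResolventAt 𝒜 ν ℛ := by
  rw [resolventAt_iff]
  intro f g
  have hgraph : (f, g) ∈ 𝒜.graph ↔ ∀ᵐ s ∂μ, (f s, g s) ∈ (As s).graph := by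
    rw [LinearPMap.mem_graph_iff]
    constructor
    · rintro ⟨x, hx, hy⟩
      have := hval x
      rwa [hx, hy] at this
    · intro h
      have hf : f ∈ 𝒜.domain := (hdom f).2 ⟨g, h⟩
      refine ⟨⟨f, hf⟩, rfl, Lp.ext ?_⟩
      filter_upwards [h, hval ⟨f, hf⟩] with s h1 h2
      exact (As s).mem_graph_snd_inj h2 h1 rfl
  have hfib : (∀ᵐ s ∂μ, (f s, g s) ∈ (As s).graph) ↔ ∀ᵐ s ∂μ, ℛ (ν • f - g) s = f s := by
    refine eventually_congr ?_
    filter_upwards [hres, hℛ (ν • f - g), Lp.coeFn_sub (ν • f) g, Lp.coeFn_smul ν f]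
      with s h1 h2 h3 h4
    rw [resolventAt_iff.1 h1, h2, h3, Pi.sub_apply, h4, Pi.smul_apply]
  rw [hgraph, hfib]
  exact ⟨fun h => Lp.ext h, fun h => by rw [h]; exact .of_forall fun _ => rfl⟩

end Main

variable {Ω : Type*} [MeasurableSpace Ω] {μ : Measure Ω} [SigmaFinite μ]
variable {H : Type*} [NormedAddCommGroup H] [InnerProductSpace ℂ H] [CompleteSpace H]
  [TopologicalSpace.SeparableSpace H]

/-- The decomposable operator `𝒜` generates an immediately norm-continuous
`C₀`-semigroup bounded by `M e^{-ε t}` iff a.e. fibre `A s` generates a `C₀`-semigroup with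
the same bound and `‖R(i r, A s)‖ → 0` as `r → ±∞` uniformly a.e. in `s`. -/
theorem decomposable_immediately_norm_continuous_iff
    (ν : ℂ) (R : Ω → H →L[ℂ] H)
    (hmeasR : ∀ x : H, StronglyMeasurable fun s => R s x)
    (hbddR : ∃ C : ℝ, ∀ᵐ s ∂μ, ‖R s‖ ≤ C)
    (hinj : ∀ᵐ s ∂μ, Function.Injective (R s))
    (As : Ω → H →ₗ.[ℂ] H)
    (hres : ∀ᵐ s ∂μ, ResolventAt (As s) ν (R s))
    (𝒜 : Lp H 2 μ →ₗ.[ℂ] Lp H 2 μ)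
    (h𝒜dom : ∀ x : Lp H 2 μ,
      x ∈ 𝒜.domain ↔ ∃ g : Lp H 2 μ, ∀ᵐ s ∂μ, (x s, g s) ∈ (As s).graph)
    (h𝒜val : ∀ x : 𝒜.domain, ∀ᵐ s ∂μ, ((x : Lp H 2 μ) s, (𝒜 x) s) ∈ (As s).graph)
    (M ε : ℝ) (hM : 1 ≤ M) (hε : 0 < ε) :
    (∃ 𝒯 : ℝ → Lp H 2 μ →L[ℂ] Lp H 2 μ, IsC0Semigroup 𝒯 ∧ IsGenerator 𝒯 𝒜 ∧
        ContinuousOn 𝒯 (Set.Ioi (0 : ℝ)) ∧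
        ∀ t : ℝ, 0 ≤ t → ‖𝒯 t‖ ≤ M * Real.exp (-ε * t)) ↔
      ((∃ T : Ω → ℝ → H →L[ℂ] H, ∀ᵐ s ∂μ, IsC0Semigroup (T s) ∧
          IsGenerator (T s) (As s) ∧
          ∀ t : ℝ, 0 ≤ t → ‖T s t‖ ≤ M * Real.exp (-ε * t)) ∧
       ∀ η : ℝ, 0 < η → ∃ ρ : ℝ, 0 < ρ ∧ ∀ᵐ s ∂μ, ∀ r : ℝ, ρ ≤ |r| →
         ∃ Rs : H →L[ℂ] H, ResolventAt (As s) ((r : ℂ) * Complex.I) Rs ∧ ‖Rs‖ ≤ η) := by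
  obtain ⟨C, hC⟩ := hbddR
  obtain ⟨ℛ, hℛ, -⟩ := exists_decomposes (μ := μ) (C := max C 0)
    (fun x => (hmeasR x).aestronglyMeasurable) (le_max_right _ _)
    (by filter_upwards [hC] with s hs using hs.trans (le_max_left _ _))
  have h𝒜 : ResolventAt 𝒜 ν ℛ := resolventAt_of_decomposes hℛ hres h𝒜dom h𝒜val
  constructor
  · rintro ⟨𝒯, h0, hgen, hcont, hbound⟩
    have h : StableSemigroup 𝒯 M ε := ⟨h0, hM, hε, hbound⟩
    have hG : GenResolvent 𝒯 ν ℛ := hgen.resolventAt_iff.1 h𝒜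
    have hex := hG.ae_exists_stableSemigroup h hℛ
    constructor
    · classical
      refine ⟨fun s => Classical.epsilon fun S => StableSemigroup S M ε ∧ GenResolvent S ν (R s), ?_⟩
      filter_upwards [hex, hres] with s h1 h2
      have h3 := Classical.epsilon_spec h1
      exact ⟨h3.1.c0, h3.2.isGenerator h2, h3.1.bound⟩
    · intro η hη
      obtain ⟨ρ, hρ, hr⟩ := h.exists_norm_resI_le hcont hη
      refine ⟨ρ, hρ, ?_⟩
      filter_upwards [hex, hres, hG.ae_norm_resI_le h hℛ hr] with s h1 h2 h3 r hr
      obtain ⟨S, hS, hGS⟩ := h1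
      exact ⟨hS.resI r, (hGS.isGenerator h2).resolventAt_iff.2 (hS.genResolvent_res _),
        h3 S hS hGS r hr⟩
  · rintro ⟨⟨T, hT⟩, hdecay⟩
    have hst : ∀ᵐ s ∂μ, StableSemigroup (T s) M ε := by
      filter_upwards [hT] with s hs using ⟨hs.1, hM, hε, hs.2.2⟩
    have hG : ∀ᵐ s ∂μ, GenResolvent (T s) ν (R s) := by
      filter_upwards [hT, hres] with s h1 h2 using h1.2.1.resolventAt_iff.1 h2
    obtain ⟨𝒯, h, hG𝒯⟩ := exists_directIntegral hε hM hmeasR hℛ hst hG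
    refine ⟨𝒯, h.c0, hG𝒯.isGenerator h𝒜, h.continuousOn_of_norm_resI_le fun η hη => ?_, h.bound⟩
    obtain ⟨ρ, hρ, hr⟩ := hdecay η hη
    refine ⟨ρ, hρ, fun r hrρ => hG𝒯.norm_resI_le h hℛ hη.le ?_⟩
    filter_upwards [hr, hres] with s h1 h2
    obtain ⟨Rs, hRs, hle⟩ := h1 r hrρ
    exact ⟨Rs, hle, fun x y hxy =>
      (resolventAt_iff.1 hRs x y).1 ((resolventAt_iff.1 h2 x y).2 hxy)⟩
end
end

section
/- For a.e. s ∈ Ω let A(s) be the generator of (T(s,t))_{t≥0}. Assume esssup_{s∈Ω} sup_{t≥0} ‖T(s,t)‖ < ∞; that iℝ ⊆ ρ(A(s)) for a.e. s ∈ Ω; and that for every r ∈ ℝ, esssup_{s∈Ω} ‖R(ir, A(s))‖ < ∞. Fix α > 0. Then the following are equivalent: (i) esssup_{s∈Ω} sup_{|r|≥1} |r|^{−α} ‖R(ir, A(s))‖ < ∞; (ii) esssup_{s∈Ω} sup_{t≥0} t^{1/α} ‖T(s,t) A(s)⁻¹‖ < ∞, where A(s)⁻¹ = −R(0, A(s))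 is a bounded operator since 0 ∈ ρ(A(s)). -/
open MeasureTheory Filter Topology Set

noncomputable section

variable {Ω : Type*} [MeasurableSpace Ω] {μ : Measure Ω} [SigmaFinite μ]
variable {H : Type*} [NormedAddCommGroup H] [InnerProductSpace ℂ H] [CompleteSpace H]
  [TopologicalSpace.SeparableSpace H]

open scoped FourierTransform SchwartzMap

/-- Plancherel's theorem for the classical Fourier integral of an `L¹ ∩ L²` function. -/
theorem eLpNorm_fourier_eq_eLpNorm {F : Type*} [NormedAddCommGroup F] [InnerProductSpace ℂ F]
    [CompleteSpace F] {f : ℝ → F} (hf : Integrable f) (hf2 : MemLp f 2) :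
    eLpNorm (𝓕 f) 2 volume = eLpNorm f 2 volume := by
  set G : Lp F 2 (volume : Measure ℝ) := hf2.toLp f with hG
  have hcont : Continuous (𝓕 f) :=
    VectorFourier.fourierIntegral_continuous Real.continuous_fourierChar
      (by exact continuous_inner) hf
  have hae : ∀ᵐ ξ, 𝓕 f ξ = (𝓕 G : Lp F 2 (volume : Measure ℝ)) ξ := by
    refine ae_eq_of_integral_contDiff_smul_eq hcont.locallyIntegrable
      ((Lp.memLp (𝓕 G)).locallyIntegrable (by norm_num)) fun g hg hgs => ?_
    have hs : HasCompactSupport fun x => (g x : ℂ) := hgs.comp_left Complex.ofReal_zero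
    let φ : 𝓢(ℝ, ℂ) := hs.toSchwartzMap (Complex.ofRealCLM.contDiff.comp hg)
    have hφ : ∀ x, φ x = (g x : ℂ) := fun x => rfl
    have key := congrArg (fun D => D φ) (Lp.fourier_toTemperedDistribution_eq G)
    simp only [TemperedDistribution.fourier_apply, Lp.toTemperedDistribution_apply] at key
    have h1 : ∫ x, (𝓕 φ) x • G x = ∫ x, φ x • 𝓕 f x := by
      rw [integral_congr_ae (g := fun x => (𝓕 φ) x • f x)]
      · rw [SchwartzMap.fourier_coe]
        have h := VectorFourier.integral_fourierIntegral_smul_eq_flip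
          (L := innerₗ ℝ) Real.continuous_fourierChar continuous_inner
          (φ.integrable (μ := volume)) hf
        rw [flip_innerₗ] at h
        exact h
      · filter_upwards [hf2.coeFn_toLp] with x hx
        rw [hG, hx]
    rw [h1] at key
    simpa only [hφ, Complex.coe_smul] using key
  rw [eLpNorm_congr_ae hae, ← Lp.enorm_def, ← ofReal_norm, Lp.norm_fourier_eq, ofReal_norm,
    Lp.enorm_def, hG, eLpNorm_congr_ae hf2.coeFn_toLp]

section Semigroup

variable {K : Type*} [NormedAddCommGroup K] [NormedSpace ℂ K]
  {T : ℝ → K →L[ℂ] K} {B : K →ₗ.[ℂ] K} {M : ℝ} {lam lam₀ : ℂ} {R R' : K →L[ℂ] K}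

theorem ResolventAt.unique (h : ResolventAt B lam R) (h' : ResolventAt B lam R') : R = R' := by
  ext y
  obtain ⟨hy, hy'⟩ := h.1 y
  have := h'.2 ⟨R y, hy⟩
  simp only [hy'] at this
  exact this.symm

/-- The resolvent equation, with the resolvent whose norm is to be estimated on the left. -/
theorem ResolventAt.resolvent_eq (h : ResolventAt B lam R) (h₀ : ResolventAt B lam₀ R') (y : K) :
    R y = R' y + (lam₀ - lam) • R' (R y) := by
  obtain ⟨hy, hy'⟩ := h.1 y
  have h' : R' (lam₀ • R y - B ⟨R y, hy⟩) = R y := h₀.2 ⟨R y, hy⟩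
  have hsplit : lam₀ • R y - B ⟨R y, hy⟩ = y + (lam₀ - lam) • R y := by
    nth_rw 3 [← hy']
    module
  rw [hsplit, map_add, map_smul] at h'
  exact h'.symm

/-- A resolvent with `‖R(lam₀)‖ ≤ C` is bounded by `2C` at every `lam` with
`|lam - lam₀| C ≤ 1/2`. -/
theorem ResolventAt.norm_le_two_mul (h : ResolventAt B lam R) (h₀ : ResolventAt B lam₀ R')
    {C : ℝ} (hC : ‖R'‖ ≤ C) (hlam : ‖lam₀ - lam‖ * C ≤ 1 / 2) : ‖R‖ ≤ 2 * C := by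
  have hC0 : 0 ≤ C := (norm_nonneg _).trans hC
  have hle : ‖R‖ ≤ C + ‖lam₀ - lam‖ * C * ‖R‖ := by
    refine R.opNorm_le_bound (by positivity) fun y => ?_
    rw [h.resolvent_eq h₀ y]
    calc _ ≤ ‖R' y‖ + ‖lam₀ - lam‖ * ‖R' (R y)‖ := by
          rw [← norm_smul]; exact norm_add_le _ _
      _ ≤ C * ‖y‖ + ‖lam₀ - lam‖ * (C * (‖R‖ * ‖y‖)) := by
          gcongr
          · exact R'.le_of_opNorm_le hC y
          · exact (R'.le_of_opNorm_le hC _).trans (by gcongr; exact R.le_opNorm y)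
      _ = _ := by ring
  nlinarith [mul_le_mul_of_nonneg_right hlam (norm_nonneg R)]

theorem IsC0Semigroup.nonneg_of_bound (hM : ∀ t, 0 ≤ t → ‖T t‖ ≤ M) : 0 ≤ M :=
  (norm_nonneg _).trans (hM 0 le_rfl)

theorem IsC0Semigroup.apply_add (hT : IsC0Semigroup T) {t u : ℝ} (ht : 0 ≤ t) (hu : 0 ≤ u)
    (x : K) : T (t + u) x = T t (T u x) := by
  rw [hT.2.1 t u ht hu]; rfl

/-- The semigroup leaves the domain of the generator invariant and commutes with it there. -/
theorem IsGenerator.apply_mem (hT : IsC0Semigroup T) (hB : IsGenerator T B) {t : ℝ} (ht : 0 ≤ t)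
    (x : B.domain) : ∃ h : T t x ∈ B.domain, B ⟨T t x, h⟩ = T t (B x) := by
  have key : Tendsto (fun u : ℝ => u⁻¹ • (T u (T t x) - T t x)) (𝓝[>] 0) (𝓝 (T t (B x))) := by
    refine (((T t).continuous.tendsto _).comp (hB.2 x)).congr' ?_
    filter_upwards [self_mem_nhdsWithin] with u hu
    have hu0 : 0 ≤ u := le_of_lt hu
    simp only [Function.comp_apply, ContinuousLinearMap.map_smul_of_tower, map_sub]
    rw [← hT.apply_add ht hu0, ← hT.apply_add hu0 ht, add_comm]
  have h : T t x ∈ B.domain := (hB.1 _).2 ⟨_, key⟩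
  exact ⟨h, tendsto_nhds_unique (hB.2 ⟨T t x, h⟩) key⟩

theorem IsGenerator.resolvent_commute (hT : IsC0Semigroup T) (hB : IsGenerator T B)
    (hR : ResolventAt B lam R) {t : ℝ} (ht : 0 ≤ t) (y : K) : R (T t y) = T t (R y) := by
  obtain ⟨hy, hy'⟩ := hR.1 y
  obtain ⟨h1, h2⟩ := hB.apply_mem hT ht ⟨R y, hy⟩
  have := hR.2 ⟨T t (R y), h1⟩
  simp only [h2] at this
  rw [← this, ← map_smul, ← map_sub, hy']

/-- The right derivative of an orbit starting in the domain of the generator. -/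
theorem IsGenerator.hasDerivWithinAt_orbit (hT : IsC0Semigroup T) (hB : IsGenerator T B)
    (x : B.domain) {t : ℝ} (ht : 0 ≤ t) :
    HasDerivWithinAt (fun s => T s x) (T t (B x)) (Ioi t) t := by
  rw [hasDerivWithinAt_iff_tendsto_slope' (by simp)]
  have hmap : Tendsto (fun s : ℝ => s - t) (𝓝[>] t) (𝓝[>] 0) := by
    refine tendsto_nhdsWithin_iff.2 ⟨?_, ?_⟩
    · have : Tendsto (fun s : ℝ => s - t) (𝓝 t) (𝓝 (t - t)) :=
        (continuous_id.sub continuous_const).tendsto t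
      rw [sub_self] at this
      exact this.mono_left nhdsWithin_le_nhds
    · filter_upwards [self_mem_nhdsWithin] with s hs
      exact sub_pos.2 (mem_Ioi.1 hs)
  refine ((((T t).continuous.tendsto _).comp (hB.2 x)).comp hmap).congr' ?_
  filter_upwards [self_mem_nhdsWithin] with s hs
  have hs0 : 0 ≤ s - t := (sub_pos.2 (mem_Ioi.1 hs)).le
  simp only [Function.comp_apply, ContinuousLinearMap.map_smul_of_tower, map_sub, slope_def_module]
  rw [← hT.apply_add ht hs0, add_sub_cancel]

/-- The weighted orbit `s ↦ sⁿ e^{-lam s} T(s) x`. -/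
def weightedOrbit (T : ℝ → K →L[ℂ] K) (n : ℕ) (lam : ℂ) (x : K) (s : ℝ) : K :=
  ((s : ℂ) ^ n * Complex.exp (-lam * s)) • T s x

theorem norm_weightedOrbit (T : ℝ → K →L[ℂ] K) (n : ℕ) (lam : ℂ) (x : K) {s : ℝ} (hs : 0 ≤ s) :
    ‖weightedOrbit T n lam x s‖ = s ^ n * Real.exp (-lam.re * s) * ‖T s x‖ := by
  simp [weightedOrbit, norm_smul, Complex.norm_exp, abs_of_nonneg hs]

theorem norm_weightedOrbit_le (hM : ∀ t, 0 ≤ t → ‖T t‖ ≤ M) (n : ℕ) (lam : ℂ) (x : K) {s : ℝ}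
    (hs : 0 ≤ s) :
    ‖weightedOrbit T n lam x s‖ ≤ s ^ n * Real.exp (-lam.re * s) * (M * ‖x‖) := by
  rw [norm_weightedOrbit T n lam x hs]
  gcongr
  exact (T s).le_of_opNorm_le (hM s hs) x

theorem continuousOn_weightedOrbit (hT : IsC0Semigroup T) (n : ℕ) (lam : ℂ) (x : K) :
    ContinuousOn (weightedOrbit T n lam x) (Ici 0) :=
  ContinuousOn.smul (by fun_prop) (hT.2.2 x)

theorem integrableOn_pow_mul_exp (n : ℕ) {a : ℝ} (ha : 0 < a) :
    IntegrableOn (fun s : ℝ => s ^ n * Real.exp (-a * s)) (Ioi 0) := by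
  have := integrableOn_rpow_mul_exp_neg_mul_rpow (p := 1) (s := n)
    (lt_of_lt_of_le (by norm_num) n.cast_nonneg) one_pos ha
  simpa using this

theorem integrableOn_weightedOrbit (hT : IsC0Semigroup T) (hM : ∀ t, 0 ≤ t → ‖T t‖ ≤ M)
    (n : ℕ) (hlam : 0 < lam.re) (x : K) : IntegrableOn (weightedOrbit T n lam x) (Ioi 0) := by
  refine Integrable.mono' ((integrableOn_pow_mul_exp n hlam).mul_const (M * ‖x‖))
    (((continuousOn_weightedOrbit hT n lam x).mono Ioi_subset_Ici_self).aestronglyMeasurable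
      measurableSet_Ioi) ?_
  filter_upwards [ae_restrict_mem measurableSet_Ioi] with s hs
  exact norm_weightedOrbit_le hM n lam x (le_of_lt hs)

theorem tendsto_weightedOrbit (hM : ∀ t, 0 ≤ t → ‖T t‖ ≤ M)
    (n : ℕ) (hlam : 0 < lam.re) (x : K) : Tendsto (weightedOrbit T n lam x) atTop (𝓝 0) := by
  have h := (tendsto_rpow_mul_exp_neg_mul_atTop_nhds_zero n lam.re hlam).mul_const (M * ‖x‖)
  rw [zero_mul] at h
  refine squeeze_zero_norm' ?_ h
  filter_upwards [eventually_ge_atTop 0] with s hs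
  simpa using norm_weightedOrbit_le hM n lam x hs

/-- The Laplace-type integral `∫₀^∞ sⁿ e^{-lam s} T(s) x ds`. -/
def laplaceMoment (T : ℝ → K →L[ℂ] K) (n : ℕ) (lam : ℂ) (x : K) : K :=
  ∫ s in Ioi (0 : ℝ), weightedOrbit T n lam x s

theorem hasDerivWithinAt_weightedOrbit (hT : IsC0Semigroup T) (hB : IsGenerator T B) (n : ℕ)
    (lam : ℂ) (x : B.domain) {t : ℝ} (ht : 0 ≤ t) :
    HasDerivWithinAt (weightedOrbit T n lam x)
      ((n * (t : ℂ) ^ (n - 1) * Complex.exp (-lam * t)) • T t x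
        - weightedOrbit T n lam (lam • (x : K) - B x) t) (Ioi t) t := by
  have h1 : HasDerivAt (fun s : ℝ => (s : ℂ) ^ n * Complex.exp (-lam * s))
      (n * (t : ℂ) ^ (n - 1) * Complex.exp (-lam * t)
        + (t : ℂ) ^ n * (Complex.exp (-lam * t) * (-lam))) t := by
    refine HasDerivAt.comp_ofReal (e := fun z : ℂ => z ^ n * Complex.exp (-lam * z)) ?_
    refine (hasDerivAt_pow n (t : ℂ)).mul ?_
    simpa using ((hasDerivAt_id (t : ℂ)).const_mul (-lam)).cexp
  refine (h1.hasDerivWithinAt.smul (hB.hasDerivWithinAt_orbit hT x ht)).congr_deriv ?_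
  simp only [weightedOrbit, map_sub, map_smul]
  module

/-- The Laplace transform of a bounded semigroup, as a bounded operator. -/
theorem exists_laplace_clm (hT : IsC0Semigroup T) (hM : ∀ t, 0 ≤ t → ‖T t‖ ≤ M)
    (hlam : 0 < lam.re) :
    ∃ L : K →L[ℂ] K, (∀ x, L x = laplaceMoment T 0 lam x) ∧ ‖L‖ ≤ M / lam.re := by
  have hi := fun x => integrableOn_weightedOrbit hT hM 0 hlam x
  let L₀ : K →ₗ[ℂ] K :=
    { toFun := laplaceMoment T 0 lam
      map_add' := fun x y => by
        simp only [laplaceMoment]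
        rw [← integral_add (hi x) (hi y)]
        simp [weightedOrbit]
      map_smul' := fun c x => by
        simp only [laplaceMoment, RingHom.id_apply]
        rw [← integral_smul]
        simp [weightedOrbit, smul_comm c] }
  have hM0 : 0 ≤ M := IsC0Semigroup.nonneg_of_bound hM
  have hb : ∀ x, ‖L₀ x‖ ≤ M / lam.re * ‖x‖ := fun x => by
    have hexp : ∫ s in Ioi (0 : ℝ), Real.exp (-lam.re * s) = 1 / lam.re := by
      have := integral_exp_mul_Ioi (neg_lt_zero.2 hlam) 0
      simpa using this
    calc ‖L₀ x‖ ≤ ∫ s in Ioi (0 : ℝ), s ^ 0 * Real.exp (-lam.re * s) * (M * ‖x‖) := by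
          refine norm_integral_le_of_norm_le
            ((integrableOn_pow_mul_exp 0 hlam).mul_const (M * ‖x‖)) ?_
          filter_upwards [ae_restrict_mem measurableSet_Ioi] with s hs
          exact norm_weightedOrbit_le hM 0 lam x (le_of_lt hs)
      _ = _ := by
          simp only [pow_zero, one_mul]
          rw [integral_mul_const, hexp]
          ring
  exact ⟨L₀.mkContinuous _ hb, fun x => rfl, L₀.mkContinuous_norm_le (by positivity) hb⟩

theorem ResolventAt.norm_laplace_le {a : ℝ} (ha : 0 ≤ a) {L : K →L[ℂ] K}
    (hL : ResolventAt B (lam₀ + a) L) (hR : ResolventAt B lam₀ R) (hLM : a * ‖L‖ ≤ M) :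
    ‖L‖ ≤ (1 + M) * ‖R‖ := by
  have hM0 : 0 ≤ M := (by positivity : 0 ≤ a * ‖L‖).trans hLM
  refine L.opNorm_le_bound (by positivity) fun y => ?_
  rw [hL.resolvent_eq hR y]
  calc _ ≤ ‖R y‖ + ‖(lam₀ - (lam₀ + a)) • R (L y)‖ := norm_add_le _ _
    _ ≤ ‖R‖ * ‖y‖ + a * (‖R‖ * (‖L‖ * ‖y‖)) := by
        rw [norm_smul, sub_add_cancel_left, norm_neg, Complex.norm_real, Real.norm_of_nonneg ha]
        gcongr
        · exact R.le_opNorm y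
        · exact R.le_opNorm_of_le (L.le_opNorm y)
    _ = ‖R‖ * ‖y‖ + (a * ‖L‖) * (‖R‖ * ‖y‖) := by ring
    _ ≤ ‖R‖ * ‖y‖ + M * (‖R‖ * ‖y‖) := by gcongr
    _ = _ := by ring

theorem ResolventAt.smul_mul_pow_succ {L R₀ : K →L[ℂ] K} (hL : ResolventAt B lam L)
    (hR₀ : ResolventAt B 0 R₀) (k : ℕ) :
    lam • (R₀ * L ^ (k + 1)) = R₀ * L ^ k - L ^ (k + 1) := by
  ext y
  have h := hL.resolvent_eq hR₀ ((L ^ k) y)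
  rw [pow_succ' L k]
  simp only [smul_apply, sub_apply, mul_apply_eq_comp]
  rw [h]
  nth_rw 1 [← h]
  module

/-- Away from the origin, the product `R(0) R(lam)ᵏ` gains a factor `|lam|⁻¹` over `R(lam)ᵏ`. -/
theorem ResolventAt.norm_mul_pow_le {L R₀ : K →L[ℂ] K} (hL : ResolventAt B lam L)
    (hR₀ : ResolventAt B 0 R₀) {κ P : ℝ} (hκ : ‖R₀‖ ≤ κ) (hP : ‖L‖ ≤ P) (hP1 : 1 ≤ P)
    (hlam : 1 ≤ ‖lam‖) (k : ℕ) : ‖R₀ * L ^ (k + 1)‖ ≤ ‖lam‖⁻¹ * ((k + 1 + κ) * P ^ (k + 1)) := by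
  have hκ0 : 0 ≤ κ := (norm_nonneg _).trans hκ
  have hlam0 : 0 < ‖lam‖ := one_pos.trans_le hlam
  have hstep : ∀ k : ℕ, ‖R₀ * L ^ k‖ ≤ (k + κ) * P ^ k →
      ‖R₀ * L ^ (k + 1)‖ ≤ ‖lam‖⁻¹ * ((k + 1 + κ) * P ^ (k + 1)) := fun k hk => by
    rw [inv_mul_eq_div, le_div_iff₀ hlam0, mul_comm, ← norm_smul, hL.smul_mul_pow_succ hR₀ k]
    calc _ ≤ ‖R₀ * L ^ k‖ + ‖L ^ (k + 1)‖ := norm_sub_le _ _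
      _ ≤ (k + κ) * P ^ k + P ^ (k + 1) := by
          gcongr
          exact (norm_pow_le' L k.succ_pos).trans (by gcongr)
      _ ≤ (k + κ) * P ^ (k + 1) + P ^ (k + 1) := by
          gcongr
          exact k.le_succ
      _ = _ := by ring
  have hall : ∀ k : ℕ, ‖R₀ * L ^ k‖ ≤ (k + κ) * P ^ k := fun k => by
    induction k with
    | zero => simpa using hκ
    | succ k ih =>
      refine (hstep k ih).trans ?_
      push_cast
      exact mul_le_of_le_one_left (by positivity) (inv_le_one_of_one_le₀ hlam)
  exact hstep k (hall k)

theorem fourier_indicator_weightedOrbit (T : ℝ → K →L[ℂ] K) (n : ℕ) (a : ℝ) (x : K) (ξ : ℝ) :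
    𝓕 ((Ioi (0 : ℝ)).indicator (weightedOrbit T n a x)) ξ
      = laplaceMoment T n (((2 * Real.pi * ξ : ℝ) : ℂ) * Complex.I + a) x := by
  rw [Real.fourier_real_eq_integral_exp_smul, laplaceMoment, ← integral_indicator measurableSet_Ioi]
  congr 1 with s
  by_cases hs : s ∈ Ioi (0 : ℝ)
  · simp only [indicator_of_mem hs, weightedOrbit, smul_smul]
    congr 1
    rw [mul_left_comm, ← Complex.exp_add]
    congr 2
    push_cast
    ring
  · simp [indicator_of_notMem hs]

theorem integrable_indicator_sq_weightedOrbit_bound (n : ℕ) {a : ℝ} (ha : 0 < a) (c : ℝ) :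
    IntegrableOn (fun s : ℝ => (s ^ n * Real.exp (-a * s) * c) ^ 2) (Ioi 0) := by
  have h := (integrableOn_pow_mul_exp (2 * n) (a := 2 * a) (by positivity)).mul_const (c ^ 2)
  refine IntegrableOn.congr_fun h (fun s _ => ?_) measurableSet_Ioi
  have : Real.exp (-(2 * a) * s) = Real.exp (-a * s) ^ 2 := by
    rw [← Real.exp_nat_mul]; congr 1; push_cast; ring
  simp only [this]
  ring

theorem memLp_indicator_weightedOrbit (hT : IsC0Semigroup T) (hM : ∀ t, 0 ≤ t → ‖T t‖ ≤ M)
    (n : ℕ) {a : ℝ} (ha : 0 < a) (x : K) :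
    MemLp ((Ioi (0 : ℝ)).indicator (weightedOrbit T n a x)) 2 volume := by
  have h_int := integrableOn_weightedOrbit hT hM n (lam := (a : ℂ)) (by simpa using ha) x
  rw [memLp_indicator_iff_restrict measurableSet_Ioi, memLp_two_iff_integrable_sq_norm h_int.1]
  refine Integrable.mono' (integrable_indicator_sq_weightedOrbit_bound n ha (M * ‖x‖))
    (h_int.1.norm.pow 2) ?_
  filter_upwards [ae_restrict_mem measurableSet_Ioi] with s hs
  rw [Real.norm_of_nonneg (by positivity)]
  gcongr
  simpa using norm_weightedOrbit_le hM n (a : ℂ) x (le_of_lt hs)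

theorem eLpNorm_indicator_weightedOrbit_zero_le (hT : IsC0Semigroup T)
    (hM : ∀ t, 0 ≤ t → ‖T t‖ ≤ M) {a : ℝ} (ha : 0 < a) (x : K) :
    eLpNorm ((Ioi (0 : ℝ)).indicator (weightedOrbit T 0 a x)) 2 volume
      ≤ ENNReal.ofReal (M * ‖x‖ * (1 / (2 * a)) ^ (1 / 2 : ℝ)) := by
  have hmem := memLp_indicator_weightedOrbit hT hM 0 ha x
  rw [eLpNorm_indicator_eq_eLpNorm_restrict measurableSet_Ioi]
  rw [memLp_indicator_iff_restrict measurableSet_Ioi] at hmem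
  have hM0 : 0 ≤ M := IsC0Semigroup.nonneg_of_bound hM
  rw [hmem.eLpNorm_eq_integral_rpow_norm (by norm_num) (by norm_num)]
  have hle : ∫ s in Ioi (0 : ℝ), ‖weightedOrbit T 0 a x s‖ ^ (2 : ℝ)
      ≤ (M * ‖x‖) ^ 2 * (1 / (2 * a)) := by
    calc _ ≤ ∫ s in Ioi (0 : ℝ), Real.exp (-(2 * a) * s) * (M * ‖x‖) ^ 2 := by
          refine integral_mono_of_nonneg (ae_of_all _ fun s => by positivity) ?_ ?_
          · simpa using (integrableOn_pow_mul_exp 0 (a := 2 * a) (by positivity)).mul_const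
              ((M * ‖x‖) ^ 2)
          · filter_upwards [ae_restrict_mem measurableSet_Ioi] with s hs
            have h := norm_weightedOrbit_le hM 0 (a : ℂ) x (le_of_lt hs)
            have h2 : Real.exp (-(2 * a) * s) = Real.exp (-a * s) ^ 2 := by
              rw [← Real.exp_nat_mul]; congr 1; push_cast; ring
            rw [Real.rpow_two, h2, ← mul_pow]
            gcongr
            simpa using h
      _ = _ := by
          have hexp := integral_exp_mul_Ioi (a := -(2 * a)) (by linarith) 0
          rw [integral_mul_const, hexp]
          simp only [mul_zero, Real.exp_zero]
          field_simp
  refine ENNReal.ofReal_le_ofReal ?_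
  simp only [ENNReal.toReal_ofNat]
  calc _ ≤ ((M * ‖x‖) ^ 2 * (1 / (2 * a))) ^ (2⁻¹ : ℝ) := by
        refine Real.rpow_le_rpow (integral_nonneg fun s => by positivity) hle (by norm_num)
    _ = _ := by
        rw [← one_div, Real.mul_rpow (by positivity) (by positivity), ← Real.sqrt_eq_rpow,
          Real.sqrt_sq (by positivity)]

theorem le_eLpNorm_indicator_weightedOrbit (hT : IsC0Semigroup T)
    (hM : ∀ t, 0 ≤ t → ‖T t‖ ≤ M) (n : ℕ) {t : ℝ} (ht : 0 < t) (z : K) :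
    ENNReal.ofReal ((t / 2) ^ n * Real.exp (-1) * ‖T t z‖ * (t / 2) ^ (1 / 2 : ℝ))
      ≤ ENNReal.ofReal M
        * eLpNorm ((Ioi (0 : ℝ)).indicator (weightedOrbit T n (t⁻¹ : ℝ) z)) 2 volume := by
  set c : ℝ := (t / 2) ^ n * Real.exp (-1) * ‖T t z‖ with hc
  have hc0 : 0 ≤ c := by positivity
  have hconst : eLpNorm ((Icc (t / 2) t).indicator fun _ => c) 2 (volume : Measure ℝ)
      = ENNReal.ofReal (c * (t / 2) ^ (1 / 2 : ℝ)) := by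
    rw [eLpNorm_indicator_const measurableSet_Icc (by norm_num) (by norm_num), Real.volume_Icc,
      sub_half, Real.enorm_of_nonneg hc0, ENNReal.ofReal_mul hc0,
      ← ENNReal.ofReal_rpow_of_nonneg (by positivity) (by norm_num)]
    simp
  rw [← hconst]
  refine eLpNorm_le_mul_eLpNorm_of_ae_le_mul (ae_of_all _ fun s => ?_) 2
  have hM0 : 0 ≤ M := IsC0Semigroup.nonneg_of_bound hM
  by_cases hs : s ∈ Icc (t / 2) t
  · have hs0 : 0 < s := (half_pos ht).trans_le hs.1
    rw [indicator_of_mem hs, indicator_of_mem (mem_Ioi.2 hs0), Real.norm_of_nonneg hc0,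
      norm_weightedOrbit T n _ z hs0.le, hc]
    have h1 : ‖T t z‖ ≤ M * ‖T s z‖ := by
      have := hT.apply_add (sub_nonneg.2 hs.2) hs0.le z
      rw [sub_add_cancel] at this
      rw [this]
      exact (T (t - s)).le_of_opNorm_le (hM _ (sub_nonneg.2 hs.2)) _
    have h2 : Real.exp (-1) ≤ Real.exp (-((t⁻¹ : ℝ) : ℂ).re * s) := by
      rw [Complex.ofReal_re, Real.exp_le_exp, neg_mul, neg_le_neg_iff, inv_mul_le_iff₀ ht, mul_one]
      exact hs.2
    calc _ ≤ s ^ n * Real.exp (-((t⁻¹ : ℝ) : ℂ).re * s) * (M * ‖T s z‖) := by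
          gcongr
          exact hs.1
      _ = _ := by ring
  · rw [indicator_of_notMem hs, norm_zero]
    positivity

variable [CompleteSpace K]

/-- If `f` has an integrable right derivative `f'` on `(0, ∞)` which is continuous up to `0`, and
`f` vanishes at infinity, then `∫₀^∞ f' = -f 0`. -/
theorem integral_Ioi_eq_neg_of_hasDerivWithinAt {f f' : ℝ → K} (hf : ContinuousOn f (Ici 0))
    (hderiv : ∀ s ∈ Ioi (0 : ℝ), HasDerivWithinAt f (f' s) (Ioi s) s)
    (hf' : ContinuousOn f' (Ici 0)) (h_int : IntegrableOn f' (Ioi 0))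
    (hlim : Tendsto f atTop (𝓝 0)) : ∫ s in Ioi (0 : ℝ), f' s = -f 0 := by
  have h1 := intervalIntegral_tendsto_integral_Ioi 0 h_int tendsto_id
  have h2 : Tendsto (fun b => f b - f 0) atTop (𝓝 (0 - f 0)) := hlim.sub_const _
  rw [zero_sub] at h2
  refine tendsto_nhds_unique (h1.congr' ?_) h2
  filter_upwards [eventually_ge_atTop 0] with b hb
  refine intervalIntegral.integral_eq_sub_of_hasDeriv_right ?_ ?_ ?_
  · exact hf.mono (by rw [id, uIcc_of_le hb]; exact Icc_subset_Ici_self)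
  · intro s hs
    exact hderiv s (by simpa [hb] using hs.1)
  · exact (hf'.mono (by rw [id, uIcc_of_le hb]; exact Icc_subset_Ici_self)).intervalIntegrable

theorem laplaceMoment_zero_generator (hT : IsC0Semigroup T) (hB : IsGenerator T B)
    (hM : ∀ t, 0 ≤ t → ‖T t‖ ≤ M) (hlam : 0 < lam.re) (x : B.domain) :
    laplaceMoment T 0 lam (lam • (x : K) - B x) = x := by
  have h := integral_Ioi_eq_neg_of_hasDerivWithinAt (continuousOn_weightedOrbit hT 0 lam x)
    (f' := fun s => -weightedOrbit T 0 lam (lam • (x : K) - B x) s)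
    (fun s hs => (hasDerivWithinAt_weightedOrbit hT hB 0 lam x (le_of_lt hs)).congr_deriv
      (by simp)) (continuousOn_weightedOrbit hT 0 lam _).neg
    (integrableOn_weightedOrbit hT hM 0 hlam _).neg (tendsto_weightedOrbit hM 0 hlam _)
  rw [integral_neg, neg_inj] at h
  rw [laplaceMoment, h]
  simp [weightedOrbit, hT.1]

theorem laplaceMoment_succ_generator (hT : IsC0Semigroup T) (hB : IsGenerator T B)
    (hM : ∀ t, 0 ≤ t → ‖T t‖ ≤ M) (n : ℕ) (hlam : 0 < lam.re) (x : B.domain) :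
    laplaceMoment T (n + 1) lam (lam • (x : K) - B x)
      = ((n + 1 : ℕ) : ℂ) • laplaceMoment T n lam x := by
  have hi1 := integrableOn_weightedOrbit hT hM (n + 1) hlam (lam • (x : K) - B x)
  have hi2 := (integrableOn_weightedOrbit hT hM n hlam (x : K)).smul ((n + 1 : ℕ) : ℂ)
  have h := integral_Ioi_eq_neg_of_hasDerivWithinAt (continuousOn_weightedOrbit hT (n + 1) lam x)
    (f' := fun s => ((n + 1 : ℕ) : ℂ) • weightedOrbit T n lam x s
      - weightedOrbit T (n + 1) lam (lam • (x : K) - B x) s)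
    (fun s hs => (hasDerivWithinAt_weightedOrbit hT hB (n + 1) lam x (le_of_lt hs)).congr_deriv
      (by simp only [weightedOrbit, smul_smul, Nat.add_sub_cancel, mul_assoc]))
    (((continuousOn_weightedOrbit hT n lam _).const_smul _).sub
      (continuousOn_weightedOrbit hT (n + 1) lam _))
    (hi2.sub hi1) (tendsto_weightedOrbit hM (n + 1) hlam _)
  have hsub := integral_sub hi2 hi1
  simp only [Pi.smul_apply] at hsub
  rw [hsub, integral_smul] at h
  have h0 : weightedOrbit T (n + 1) lam (x : K) 0 = 0 := by simp [weightedOrbit]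
  rw [h0, neg_zero, sub_eq_zero] at h
  exact h.symm

/-- The Laplace transform of a bounded semigroup at `lam` in the open right half-plane is the
resolvent of the generator at `lam`, as soon as some point lies in the resolvent set. -/
theorem IsGenerator.resolventAt_laplace (hT : IsC0Semigroup T) (hB : IsGenerator T B)
    (hM : ∀ t, 0 ≤ t → ‖T t‖ ≤ M) (hlam : 0 < lam.re) {L : K →L[ℂ] K}
    (hL : ∀ x, L x = laplaceMoment T 0 lam x) (hR : ResolventAt B lam₀ R) :
    ResolventAt B lam L ∧ ∀ x, L (R x) = R (L x) := by
  have hcomm : ∀ x, L (R x) = R (L x) := fun x => by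
    rw [hL, hL, laplaceMoment, laplaceMoment,
      ← R.integral_comp_comm (integrableOn_weightedOrbit hT hM 0 hlam x)]
    refine setIntegral_congr_fun measurableSet_Ioi fun s hs => ?_
    simp only [weightedOrbit, map_smul]
    rw [hB.resolvent_commute hT hR (le_of_lt hs)]
  have hleft : ∀ x : B.domain, L (lam • (x : K) - B x) = x := fun x => by
    rw [hL, laplaceMoment_zero_generator hT hB hM hlam x]
  refine ⟨⟨fun w => ?_, hleft⟩, hcomm⟩
  have hLw : L w = R (w - (lam - lam₀) • L w) := by
    obtain ⟨hw, hw'⟩ := hR.1 w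
    have h := hleft ⟨R w, hw⟩
    have h' : lam • R w - B ⟨R w, hw⟩ = w + (lam - lam₀) • R w := by
      nth_rw 3 [← hw']
      module
    simp only [h', map_add, map_smul] at h
    rw [map_sub, map_smul, ← hcomm]
    exact eq_sub_of_add_eq h
  obtain ⟨h1, h2⟩ := hR.1 (w - (lam - lam₀) • L w)
  have h3 : L w ∈ B.domain := hLw ▸ h1
  refine ⟨h3, ?_⟩
  have h4 : B ⟨L w, h3⟩ = B ⟨R (w - (lam - lam₀) • L w), h1⟩ := by
    congr 1
    exact Subtype.ext hLw
  have h5 : lam₀ • L w - B ⟨L w, h3⟩ = w - (lam - lam₀) • L w := by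
    rwa [← h4, ← hLw] at h2
  have h6 : lam • L w - B ⟨L w, h3⟩
      = (lam₀ • L w - B ⟨L w, h3⟩) + (lam - lam₀) • L w := by module
  rw [h6, h5, sub_add_cancel]

theorem laplaceMoment_eq_iterate (hT : IsC0Semigroup T) (hB : IsGenerator T B)
    (hM : ∀ t, 0 ≤ t → ‖T t‖ ≤ M) (hlam : 0 < lam.re) {L : K →L[ℂ] K}
    (hL : ∀ x, L x = laplaceMoment T 0 lam x) (hR : ResolventAt B lam L) (n : ℕ) (w : K) :
    laplaceMoment T n lam w = (n.factorial : ℂ) • (L ^ (n + 1)) w := by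
  induction n generalizing w with
  | zero => simp [hL]
  | succ n ih =>
    obtain ⟨h1, h2⟩ := hR.1 w
    have h := laplaceMoment_succ_generator hT hB hM n hlam ⟨L w, h1⟩
    rw [h2, ih] at h
    rw [h, smul_smul, ← Nat.cast_mul, ← Nat.factorial_succ, pow_succ L (n + 1)]
    rfl

end Semigroup

section Decay

variable {K : Type*} [NormedAddCommGroup K] [InnerProductSpace ℂ K]
  {T : ℝ → K →L[ℂ] K} {B : K →ₗ.[ℂ] K} {M : ℝ}

theorem min_rpow_pow_mul_inv_le {α t ρ : ℝ} {n : ℕ} (hα : 0 < α) (ht : 1 ≤ t) (hρ : 1 ≤ ρ)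
    (hn : 1 / α ≤ n) : (min t (ρ ^ α)) ^ n * ρ⁻¹ ≤ t ^ (n - 1 / α : ℝ) := by
  have ht0 : 0 < t := one_pos.trans_le ht
  have hρ0 : 0 < ρ := one_pos.trans_le hρ
  rcases le_total (ρ ^ α) t with h | h
  · rw [min_eq_right h]
    calc _ = (ρ ^ α) ^ (n - 1 / α : ℝ) := by
          rw [← Real.rpow_natCast, ← Real.rpow_mul hρ0.le, ← Real.rpow_mul hρ0.le,
            ← Real.rpow_neg_one, ← Real.rpow_add hρ0]
          congr 1
          field_simp
          ring
      _ ≤ _ := Real.rpow_le_rpow (by positivity) h (sub_nonneg.2 hn)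
  · rw [min_eq_left h, Real.rpow_sub ht0, Real.rpow_natCast, div_eq_mul_inv]
    gcongr
    calc t ^ (1 / α) ≤ (ρ ^ α) ^ (1 / α) := Real.rpow_le_rpow ht0.le h (by positivity)
      _ = ρ := by rw [← Real.rpow_mul hρ0.le, mul_one_div_cancel hα.ne', Real.rpow_one]

/-- If the resolvent on the imaginary axis grows at most like `|r|^α`, then `R(0) R(lam)ⁿ` is
bounded by a multiple of `t ^ (n - 1/α)` on the line `Re lam = 1/t`. -/
theorem ResolventAt.norm_mul_pow_le_rpow {α κ C t r : ℝ} {n : ℕ} {R₀ L R : K →L[ℂ] K} (hα : 0 < α)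
    (hn : 1 / α ≤ n) (hM : 0 ≤ M) (hR₀ : ResolventAt B 0 R₀) (hκ : ‖R₀‖ ≤ κ)
    (hR : ResolventAt B ((r : ℂ) * Complex.I) R) (hRκ : |r| ≤ 1 → ‖R‖ ≤ κ)
    (hRC : 1 ≤ |r| → ‖R‖ ≤ C * |r| ^ α) (ht : 1 ≤ t)
    (hL : ResolventAt B ((r : ℂ) * Complex.I + (t⁻¹ : ℝ)) L) (hLM : t⁻¹ * ‖L‖ ≤ M) :
    ‖R₀ * L ^ n‖ ≤ (n + κ) * ((1 + M) * max 1 (max C κ)) ^ n * t ^ (n - 1 / α : ℝ) := by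
  have ht0 : 0 < t := one_pos.trans_le ht
  have hκ0 : 0 ≤ κ := (norm_nonneg _).trans hκ
  have hLR := hL.norm_laplace_le (inv_nonneg.2 ht0.le) hR hLM
  set D : ℝ := (1 + M) * max 1 (max C κ) with hD
  have hDC : (1 + M) * C ≤ D :=
    mul_le_mul_of_nonneg_left ((le_max_left _ _).trans (le_max_right _ _)) (by positivity)
  have hDκ : (1 + M) * κ ≤ D :=
    mul_le_mul_of_nonneg_left ((le_max_right _ _).trans (le_max_right _ _)) (by positivity)
  have hDM : 1 + M ≤ D := le_mul_of_one_le_right (by positivity) (le_max_left _ _)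
  have hD1 : 1 ≤ D := by linarith
  have hn1 : 1 ≤ n := by
    have : (0 : ℝ) < n := (by positivity : 0 < 1 / α).trans_le hn
    exact_mod_cast this
  obtain ⟨k, rfl⟩ : ∃ k, n = k + 1 := ⟨n - 1, by omega⟩
  rcases le_total |r| 1 with hr | hr
  · have hLD : ‖L‖ ≤ D := hLR.trans ((mul_le_mul_of_nonneg_left (hRκ hr) (by positivity)).trans hDκ)
    calc ‖R₀ * L ^ (k + 1)‖ ≤ κ * D ^ (k + 1) := by
          refine (norm_mul_le _ _).trans ?_
          gcongr
          exact (norm_pow_le' L k.succ_pos).trans (by gcongr)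
      _ ≤ ((k + 1 : ℕ) + κ) * D ^ (k + 1) * 1 := by
          rw [mul_one]; gcongr; simp; positivity
      _ ≤ _ := by
          gcongr
          exact Real.one_le_rpow ht (sub_nonneg.2 hn)
  · have hr0 : 0 < |r| := one_pos.trans_le hr
    have hlam : |r| ≤ ‖(r : ℂ) * Complex.I + (t⁻¹ : ℝ)‖ := by
      simpa using Complex.abs_im_le_norm ((r : ℂ) * Complex.I + (t⁻¹ : ℝ))
    have hP1 : 1 ≤ D * min t (|r| ^ α) :=
      one_le_mul_of_one_le_of_one_le hD1 (le_min ht (Real.one_le_rpow hr hα.le))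
    have hLP : ‖L‖ ≤ D * min t (|r| ^ α) := by
      rw [mul_min_of_nonneg _ _ (by positivity)]
      refine le_min ?_ ?_
      · rw [inv_mul_le_iff₀ ht0, mul_comm] at hLM
        exact hLM.trans (by gcongr; linarith)
      · calc ‖L‖ ≤ (1 + M) * (C * |r| ^ α) := hLR.trans (by gcongr; exact hRC hr)
          _ = (1 + M) * C * |r| ^ α := by ring
          _ ≤ _ := by gcongr
    calc ‖R₀ * L ^ (k + 1)‖ ≤ _ := hL.norm_mul_pow_le hR₀ hκ hLP hP1 (hr.trans hlam) k
      _ ≤ |r|⁻¹ * ((k + 1 + κ) * (D * min t (|r| ^ α)) ^ (k + 1)) := by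
          gcongr
      _ = ((k + 1 : ℕ) + κ) * D ^ (k + 1) * ((min t (|r| ^ α)) ^ (k + 1) * |r|⁻¹) := by
          rw [mul_pow]; push_cast; ring
      _ ≤ _ := by
          gcongr
          exact min_rpow_pow_mul_inv_le hα ht hr hn

/-- Polynomial decay of `T(t) R(0)` implies polynomial growth of the resolvent on the imaginary
axis. -/
theorem norm_resolvent_le_of_decay (hT : IsC0Semigroup T)
    (hB : IsGenerator T B) (hM : ∀ t, 0 ≤ t → ‖T t‖ ≤ M) {R₀ R : K →L[ℂ] K} {α C r : ℝ}
    (hα : 0 < α) (hC : 0 < C) (hR₀ : ResolventAt B 0 R₀)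
    (hdecay : ∀ t : ℝ, 0 ≤ t → t ^ (1 / α) * ‖(T t).comp (-R₀)‖ ≤ C) (hr : 1 ≤ |r|)
    (hR : ResolventAt B ((r : ℂ) * Complex.I) R) :
    ‖R‖ ≤ (1 + 2 * M * (2 * C) ^ α) * |r| ^ α := by
  have hM0 : 0 ≤ M := IsC0Semigroup.nonneg_of_bound hM
  have hr0 : 0 < |r| := one_pos.trans_le hr
  refine R.opNorm_le_bound (by positivity) fun y => ?_
  obtain ⟨hx, hy⟩ := hR.1 y
  set x : B.domain := ⟨R y, hx⟩ with hx_def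
  set t : ℝ := (2 * C * |r|) ^ α with ht_def
  have ht : 0 ≤ t := by positivity
  have horbit : ‖R y‖ ≤ ‖T t (R y)‖ + M * t * ‖y‖ := by
    have hy' : ((r : ℂ) * Complex.I) • (x : K) - B x = y := hy
    have h := norm_image_sub_le_of_norm_deriv_right_le_segment
      (f := weightedOrbit T 0 ((r : ℂ) * Complex.I) (R y)) (a := 0) (b := t) (C := M * ‖y‖)
      ((continuousOn_weightedOrbit hT 0 _ _).mono Icc_subset_Ici_self)
      (fun s hs => (hasDerivWithinAt_Ioi_iff_Ici).1
        (hasDerivWithinAt_weightedOrbit hT hB 0 ((r : ℂ) * Complex.I) x hs.1))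
      (fun s hs => by
        have h := norm_weightedOrbit_le hM 0 ((r : ℂ) * Complex.I) y hs.1
        rw [hy']
        simpa using h) t ⟨ht, le_rfl⟩
    have h1 := norm_weightedOrbit T 0 ((r : ℂ) * Complex.I) (R y) ht
    have h0 : weightedOrbit T 0 ((r : ℂ) * Complex.I) (R y) 0 = R y := by
      simp [weightedOrbit, hT.1]
    simp only [pow_zero, one_mul, Complex.mul_re, Complex.ofReal_re, Complex.I_re, mul_zero,
      Complex.ofReal_im, Complex.I_im, mul_one, sub_zero, neg_zero, zero_mul, Real.exp_zero] at h1
    rw [h0] at h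
    have h2 := norm_sub_norm_le (R y) (weightedOrbit T 0 ((r : ℂ) * Complex.I) (R y) t)
    rw [norm_sub_rev, h1] at h2
    linarith
  have hE : 2 * |r| * ‖(T t).comp (-R₀)‖ ≤ 1 := by
    have h := hdecay t ht
    rw [ht_def, ← Real.rpow_mul (by positivity), mul_one_div_cancel hα.ne', Real.rpow_one,
      ← ht_def] at h
    refine le_of_mul_le_mul_left (h.trans_eq' ?_ |>.trans_eq (mul_one C).symm) hC
    ring
  have hBx : ‖B x‖ ≤ |r| * ‖R y‖ + ‖y‖ := by
    have h : B x = ((r : ℂ) * Complex.I) • R y - y := by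
      nth_rw 2 [← hy]
      module
    rw [h]
    refine (norm_sub_le _ _).trans_eq ?_
    rw [norm_smul]
    simp
  have hTx : ‖T t (R y)‖ ≤ ‖(T t).comp (-R₀)‖ * (|r| * ‖R y‖ + ‖y‖) := by
    have h : ((T t).comp (-R₀)) (B x) = T t (R y) := by
      have h' := hR₀.2 x
      rw [zero_smul, zero_sub, map_neg] at h'
      exact congrArg (T t) h'
    rw [← h]
    exact ((T t).comp (-R₀)).le_opNorm_of_le hBx
  have hTx' : 2 * |r| * ‖T t (R y)‖ ≤ |r| * ‖R y‖ + ‖y‖ := by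
    calc _ ≤ 2 * |r| * (‖(T t).comp (-R₀)‖ * (|r| * ‖R y‖ + ‖y‖)) := by gcongr
      _ = (2 * |r| * ‖(T t).comp (-R₀)‖) * (|r| * ‖R y‖ + ‖y‖) := by ring
      _ ≤ _ := mul_le_of_le_one_left (by positivity) hE
  have hT2 : 2 * ‖T t (R y)‖ ≤ ‖R y‖ + ‖y‖ := by
    refine le_of_mul_le_mul_left ?_ hr0
    nlinarith [norm_nonneg y, mul_le_mul_of_nonneg_right hr (norm_nonneg y)]
  have hone : 1 ≤ |r| ^ α := Real.one_le_rpow hr hα.le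
  calc ‖R y‖ ≤ (1 + 2 * M * t) * ‖y‖ := by linarith
    _ ≤ (|r| ^ α + 2 * M * t) * ‖y‖ := by gcongr
    _ = _ := by rw [ht_def, Real.mul_rpow (by positivity) hr0.le]; ring

variable [CompleteSpace K]

/-- A uniform bound for `R(0) R(lam)ⁿ` on the line `Re lam = 1/t` yields a bound for `T(t) R(0)`. -/
theorem norm_apply_resolvent_le (hT : IsC0Semigroup T) (hB : IsGenerator T B)
    (hM : ∀ t, 0 ≤ t → ‖T t‖ ≤ M) {R₀ : K →L[ℂ] K} (hR₀ : ResolventAt B 0 R₀) (n : ℕ) {t S : ℝ}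
    (ht : 0 < t) (hS : ∀ (r : ℝ) (L : K →L[ℂ] K), t⁻¹ * ‖L‖ ≤ M →
      ResolventAt B ((r : ℂ) * Complex.I + (t⁻¹ : ℝ)) L → ‖R₀ * L ^ n‖ ≤ S) (x : K) :
    ‖T t (R₀ x)‖ ≤ n.factorial * 2 ^ n * Real.exp 1 * M ^ 2 * (S / t ^ n) * ‖x‖ := by
  have hM0 : 0 ≤ M := IsC0Semigroup.nonneg_of_bound hM
  have ha : 0 < t⁻¹ := inv_pos.2 ht
  have hre : ∀ r : ℝ, ((r : ℂ) * Complex.I + (t⁻¹ : ℝ)).re = t⁻¹ := fun r => by simp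
  have hfourier : ∀ ξ, ‖𝓕 ((Ioi (0 : ℝ)).indicator (weightedOrbit T n (t⁻¹ : ℝ) (R₀ x))) ξ‖
      ≤ n.factorial * S * ‖𝓕 ((Ioi (0 : ℝ)).indicator (weightedOrbit T 0 (t⁻¹ : ℝ) x)) ξ‖ := by
    intro ξ
    rw [fourier_indicator_weightedOrbit, fourier_indicator_weightedOrbit]
    have hpos := (hre (2 * Real.pi * ξ)).symm ▸ ha
    obtain ⟨L, hL, hLM⟩ := exists_laplace_clm hT hM hpos
    obtain ⟨hres, hcomm⟩ := hB.resolventAt_laplace hT hM hpos hL hR₀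
    rw [hre, le_div_iff₀ ha, mul_comm] at hLM
    rw [laplaceMoment_eq_iterate hT hB hM hpos hL hres, ← hL]
    have hc : Commute R₀ L := by
      ext y
      exact (hcomm y).symm
    have h1 : (L ^ (n + 1)) (R₀ x) = (R₀ * L ^ n) (L x) := by
      have h2 : L ^ (n + 1) * R₀ = R₀ * L ^ n * L := by
        rw [← (hc.pow_right (n + 1)).eq, pow_succ, mul_assoc]
      exact congrArg (fun A : K →L[ℂ] K => A x) h2
    rw [h1, norm_smul, Complex.norm_natCast, mul_assoc]
    gcongr
    exact (R₀ * L ^ n).le_of_opNorm_le (hS _ L hLM hres) _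
  have h_int : ∀ (k : ℕ) (y : K),
      Integrable ((Ioi (0 : ℝ)).indicator (weightedOrbit T k (t⁻¹ : ℝ) y)) := fun k y =>
    (integrableOn_weightedOrbit hT hM k (lam := ((t⁻¹ : ℝ) : ℂ))
      (by simpa using ht) y).integrable_indicator measurableSet_Ioi
  have hmain := eLpNorm_le_mul_eLpNorm_of_ae_le_mul (μ := (volume : Measure ℝ))
    (ae_of_all _ hfourier) 2
  rw [eLpNorm_fourier_eq_eLpNorm (h_int _ _) (memLp_indicator_weightedOrbit hT hM n ha _),
    eLpNorm_fourier_eq_eLpNorm (h_int _ _) (memLp_indicator_weightedOrbit hT hM 0 ha _)] at hmain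
  have hS0 : 0 ≤ S := by
    have hpos := (hre 0).symm ▸ ha
    obtain ⟨L, hL, hLM⟩ := exists_laplace_clm hT hM hpos
    rw [hre, le_div_iff₀ ha, mul_comm] at hLM
    exact (norm_nonneg _).trans (hS 0 L hLM (hB.resolventAt_laplace hT hM hpos hL hR₀).1)
  have hfin := (le_eLpNorm_indicator_weightedOrbit hT hM n ht (R₀ x)).trans
    (mul_le_mul_right (hmain.trans (mul_le_mul_right
      (eLpNorm_indicator_weightedOrbit_zero_le hT hM ha x) _)) _)
  rw [← ENNReal.ofReal_mul (by positivity), ← ENNReal.ofReal_mul hM0,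
    ENNReal.ofReal_le_ofReal_iff (by positivity)] at hfin
  have ht2 : 1 / (2 * t⁻¹) = t / 2 := by field_simp
  have hsq : 0 < (t / 2) ^ (1 / 2 : ℝ) := by positivity
  rw [ht2] at hfin
  have hfin' : (t / 2) ^ n * Real.exp (-1) * ‖T t (R₀ x)‖
      ≤ M * (n.factorial * S * (M * ‖x‖)) := by
    refine le_of_mul_le_mul_right (hfin.trans_eq ?_) hsq
    ring
  have hq : 0 < (t / 2) ^ n * Real.exp (-1) := by positivity
  refine le_of_mul_le_mul_left (hfin'.trans_eq ?_) hq
  rw [Real.exp_neg, div_pow]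
  field_simp

/-- Polynomial resolvent growth on the imaginary axis implies polynomial decay of `T(t) R(0)`, with
a constant depending only on the bounds for the semigroup and its resolvent. -/
theorem exists_polynomial_decay_bound (K : Type*) [NormedAddCommGroup K] [InnerProductSpace ℂ K]
    [CompleteSpace K] {α : ℝ} (hα : 0 < α) (M κ C : ℝ) :
    ∃ D : ℝ, ∀ (T : ℝ → K →L[ℂ] K) (B : K →ₗ.[ℂ] K) (R₀ : K →L[ℂ] K),
      IsC0Semigroup T → IsGenerator T B → (∀ t, 0 ≤ t → ‖T t‖ ≤ M) →
      (∀ r : ℝ, ∃ R, ResolventAt B ((r : ℂ) * Complex.I) R ∧ (|r| ≤ 1 → ‖R‖ ≤ κ) ∧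
        (1 ≤ |r| → ‖R‖ ≤ C * |r| ^ α)) →
      ResolventAt B 0 R₀ → ∀ t : ℝ, 0 ≤ t → t ^ (1 / α) * ‖(T t).comp (-R₀)‖ ≤ D := by
  obtain ⟨n, hn⟩ := exists_nat_ge (1 / α)
  set E : ℝ := (n + κ) * ((1 + M) * max 1 (max C κ)) ^ n with hE
  refine ⟨max (M * κ) (n.factorial * 2 ^ n * Real.exp 1 * M ^ 2 * E), ?_⟩
  intro T B R₀ hT hB hM hR hR₀ t ht
  have hM0 : 0 ≤ M := IsC0Semigroup.nonneg_of_bound hM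
  have hκ : ‖R₀‖ ≤ κ := by
    obtain ⟨R, hR, hRκ, -⟩ := hR 0
    have hR' : ResolventAt B 0 R := by simpa using hR
    rw [hR₀.unique hR']
    exact hRκ (by simp)
  have hκ0 : 0 ≤ κ := (norm_nonneg _).trans hκ
  have hE0 : 0 ≤ E := by positivity
  rw [ContinuousLinearMap.comp_neg, norm_neg]
  rcases le_total t 1 with ht1 | ht1
  · refine le_trans ?_ (le_max_left _ _)
    calc _ ≤ 1 * (M * κ) := by
          gcongr
          · exact Real.rpow_le_one ht ht1 (by positivity)
          · exact (ContinuousLinearMap.opNorm_comp_le _ _).trans (by gcongr; exact hM t ht)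
      _ = _ := one_mul _
  · refine le_trans ?_ (le_max_right _ _)
    have ht0 : 0 < t := one_pos.trans_le ht1
    have hbound : ‖(T t).comp R₀‖ ≤ n.factorial * 2 ^ n * Real.exp 1 * M ^ 2
        * (E * t ^ (n - 1 / α : ℝ) / t ^ n) := by
      refine ContinuousLinearMap.opNorm_le_bound _ (by positivity) fun x => ?_
      refine norm_apply_resolvent_le hT hB hM hR₀ n ht0 (fun r L hLM hL => ?_) x
      obtain ⟨R, hR, hRκ, hRC⟩ := hR r
      exact ResolventAt.norm_mul_pow_le_rpow hα hn hM0 hR₀ hκ hR hRκ hRC ht1 hL hLM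
    calc _ ≤ t ^ (1 / α) * _ := mul_le_mul_of_nonneg_left hbound (by positivity)
      _ = _ := by
        rw [Real.rpow_sub ht0, Real.rpow_natCast]
        have : 0 < t ^ (1 / α) := by positivity
        field_simp

end Decay

/-- Pointwise essential bounds for the resolvents along the imaginary axis are uniform on compact
sets. -/
theorem exists_ae_bound_resolvent_of_isCompact {Ω : Type*} [MeasurableSpace Ω] {μ : Measure Ω}
    {K : Type*} [NormedAddCommGroup K] [NormedSpace ℂ K] {As : Ω → K →ₗ.[ℂ] K}
    (hres : ∀ᵐ s ∂μ, ∀ r : ℝ, ∃ Rs : K →L[ℂ] K, ResolventAt (As s) ((r : ℂ) * Complex.I) Rs)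
    (hresbdd : ∀ r : ℝ, ∃ C : ℝ, ∀ᵐ s ∂μ, ∀ Rs : K →L[ℂ] K,
      ResolventAt (As s) ((r : ℂ) * Complex.I) Rs → ‖Rs‖ ≤ C) {S : Set ℝ} (hS : IsCompact S) :
    ∃ C : ℝ, ∀ᵐ s ∂μ, ∀ r ∈ S, ∀ Rs : K →L[ℂ] K,
      ResolventAt (As s) ((r : ℂ) * Complex.I) Rs → ‖Rs‖ ≤ C := by
  refine hS.induction_on (p := fun S : Set ℝ => ∃ C : ℝ, ∀ᵐ s ∂μ, ∀ r ∈ S, ∀ Rs : K →L[ℂ] K,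
      ResolventAt (As s) ((r : ℂ) * Complex.I) Rs → ‖Rs‖ ≤ C) ?_ ?_ ?_ ?_
  · exact ⟨0, by simp⟩
  · rintro S S' hSS' ⟨C, hC⟩
    exact ⟨C, hC.mono fun s hs r hr => hs r (hSS' hr)⟩
  · rintro S S' ⟨C, hC⟩ ⟨C', hC'⟩
    refine ⟨max C C', ?_⟩
    filter_upwards [hC, hC'] with s hs hs' r hr Rs hRs
    rcases hr with hr | hr
    · exact (hs r hr Rs hRs).trans (le_max_left _ _)
    · exact (hs' r hr Rs hRs).trans (le_max_right _ _)
  · intro r₀ _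
    obtain ⟨C₀, hC₀⟩ := hresbdd r₀
    set C : ℝ := max C₀ 1 with hC
    have hCpos : 0 < C := one_pos.trans_le (le_max_right _ _)
    refine ⟨Metric.closedBall r₀ (1 / (2 * C)),
      mem_nhdsWithin_of_mem_nhds (Metric.closedBall_mem_nhds _ (by positivity)), 2 * C, ?_⟩
    filter_upwards [hres, hC₀] with s hs hs₀ r hr Rs hRs
    obtain ⟨R', hR'⟩ := hs r₀
    refine hRs.norm_le_two_mul hR' ((hs₀ R' hR').trans (le_max_left _ _)) ?_
    have hdist : ‖(r₀ : ℂ) * Complex.I - (r : ℂ) * Complex.I‖ = dist r r₀ := by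
      rw [← sub_mul, norm_mul, Complex.norm_I, mul_one, ← Complex.ofReal_sub, Complex.norm_real,
        dist_comm, Real.dist_eq, Real.norm_eq_abs]
    rw [hdist]
    calc dist r r₀ * C ≤ 1 / (2 * C) * C := by gcongr; exact hr
      _ = 1 / 2 := by field_simp

/-- For a uniformly a.e. bounded field of `C₀`-semigroups with generators
`A s` such that `iℝ ⊆ ρ(A s)` a.e. and `esssup_s ‖R(i r, A s)‖ < ∞` for each `r`, and for
`α > 0`, the following are equivalent: (i) `esssup_s sup_{|r| ≥ 1} |r|^{-α} ‖R(i r, A s)‖ < ∞`;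
(ii) `esssup_s sup_{t ≥ 0} t^{1/α} ‖T(s,t) (A s)⁻¹‖ < ∞` (where `(A s)⁻¹ = -R(0, A s)`). -/
theorem directIntegral_quantified_asymptotics (T : Ω → ℝ → H →L[ℂ] H)
    (hsg : ∀ᵐ s ∂μ, IsC0Semigroup (T s))
    (hmeas : ∀ t : ℝ, 0 ≤ t → ∀ x : H, StronglyMeasurable fun s => T s t x)
    (hbddT : ∃ C : ℝ, ∀ᵐ s ∂μ, ∀ t : ℝ, 0 ≤ t → ‖T s t‖ ≤ C)
    (As : Ω → H →ₗ.[ℂ] H) (hAs : ∀ᵐ s ∂μ, IsGenerator (T s) (As s))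
    (hres : ∀ᵐ s ∂μ, ∀ r : ℝ, ∃ Rs : H →L[ℂ] H, ResolventAt (As s) ((r : ℂ) * Complex.I) Rs)
    (hresbdd : ∀ r : ℝ, ∃ C : ℝ, ∀ᵐ s ∂μ, ∀ Rs : H →L[ℂ] H,
      ResolventAt (As s) ((r : ℂ) * Complex.I) Rs → ‖Rs‖ ≤ C)
    (α : ℝ) (hα : 0 < α) :
    (∃ C : ℝ, ∀ᵐ s ∂μ, ∀ r : ℝ, 1 ≤ |r| → ∀ Rs : H →L[ℂ] H,
        ResolventAt (As s) ((r : ℂ) * Complex.I) Rs → |r| ^ (-α) * ‖Rs‖ ≤ C) ↔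
      ∃ C : ℝ, ∀ᵐ s ∂μ, ∀ t : ℝ, 0 ≤ t → ∀ R₀ : H →L[ℂ] H,
        ResolventAt (As s) 0 R₀ → t ^ (1 / α) * ‖(T s t).comp (-R₀)‖ ≤ C := by
  obtain ⟨M, hM⟩ := hbddT
  constructor
  · rintro ⟨C, hC⟩
    obtain ⟨κ, hκ⟩ := exists_ae_bound_resolvent_of_isCompact hres hresbdd
      (isCompact_Icc (a := (-1 : ℝ)) (b := 1))
    obtain ⟨D, hD⟩ := exists_polynomial_decay_bound H hα M κ C
    refine ⟨D, ?_⟩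
    filter_upwards [hsg, hM, hAs, hres, hC, hκ] with s hT hMs hB hRs hCs hκs t ht R₀ hR₀
    refine hD (T s) (As s) R₀ hT hB hMs (fun r => ?_) hR₀ t ht
    obtain ⟨R, hR⟩ := hRs r
    refine ⟨R, hR, fun hr => hκs r (abs_le.1 hr) R hR, fun hr => ?_⟩
    have h := hCs r hr R hR
    rw [Real.rpow_neg (abs_nonneg r)] at h
    rwa [inv_mul_le_iff₀ (Real.rpow_pos_of_pos (one_pos.trans_le hr) α), mul_comm] at h
  · rintro ⟨C, hC⟩
    refine ⟨1 + 2 * M * (2 * max C 1) ^ α, ?_⟩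
    filter_upwards [hsg, hM, hAs, hres, hC] with s hT hMs hB hRs hCs r hr R hR
    obtain ⟨R₀, hR₀⟩ := hRs 0
    rw [Complex.ofReal_zero, zero_mul] at hR₀
    have h := norm_resolvent_le_of_decay hT hB hMs hα (lt_max_of_lt_right one_pos) hR₀
      (fun t ht => (hCs t ht R₀ hR₀).trans (le_max_left C 1)) hr hR
    rw [Real.rpow_neg (abs_nonneg r),
      inv_mul_le_iff₀ (Real.rpow_pos_of_pos (one_pos.trans_le hr) α), mul_comm]
    exact h
end
end
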